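/- Let K ⊆ 𝓜 be the limit set of an irreducible finite algebraic similarity IFS on the space 𝓜 of M×N real matrices, satisfying the open set condition. If ν is a doubling Borel measure on 𝓜 with supp ν = K, then ν(BA) = 0. -/

import Mathlib

open MeasureTheory Filter Topology Matrix Metric
open scoped NNReal ENNReal

noncomputable section

attribute [local instance] Matrix.normedAddCommGroup Matrix.normedSpace

/-- The space of `M × N` real matrices (with the entrywise sup norm as the fixed norm). -/
abbrev MatSpace (M N : ℕ) := Matrix (Fin M) (Fin N) ℝ

instance (M N : ℕ) : MeasurableSpace (MatSpace M N) := borel _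
instance (M N : ℕ) : BorelSpace (MatSpace M N) := ⟨rfl⟩

/-- `φ` is an algebraic similarity of the space of `M × N` matrices with scaling ratio `r`:
`φ(α) = r • (B α C) + δ` with `B, C` orthogonal. -/
def IsAlgebraicSimilarity {M N : ℕ} (r : ℝ) (φ : MatSpace M N → MatSpace M N) : Prop :=
  0 < r ∧ ∃ B ∈ Matrix.orthogonalGroup (Fin M) ℝ, ∃ C ∈ Matrix.orthogonalGroup (Fin N) ℝ,
    ∃ δ : MatSpace M N, ∀ α, φ α = r • (B * α * C) + δ

def IrreducibleMatIFS {E : Type*} {M N : ℕ} (φ : E → MatSpace M N → MatSpace M N) : Prop :=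
  ¬ ∃ L : AffineSubspace ℝ (MatSpace M N),
      (L : Set (MatSpace M N)).Nonempty ∧ L ≠ ⊤ ∧
        ∀ e, φ e '' (L : Set (MatSpace M N)) = (L : Set (MatSpace M N))

/-- The open set condition. -/
def OpenSetConditionMat {E : Type*} {M N : ℕ} (φ : E → MatSpace M N → MatSpace M N) : Prop :=
  ∃ U : Set (MatSpace M N), IsOpen U ∧ U.Nonempty ∧
    (∀ e, φ e '' U ⊆ U) ∧ ∀ e e', e ≠ e' → Disjoint (φ e '' U) (φ e' '' U)

def seqApply {E X : Type*} (φ : E → X → X) (b : ℕ → E) : ℕ → X → X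
  | 0 => id
  | n + 1 => fun x => seqApply φ b n (φ (b n) x)

/-- The (topological) support of a Borel measure. -/
def measSupport {X : Type*} [PseudoMetricSpace X] [MeasurableSpace X] (ν : Measure X) :
    Set X :=
  {x | ∀ ε : ℝ, 0 < ε → ν (ball x ε) ≠ 0}

/-- A locally finite Borel measure `ν` is doubling if there is `C ≥ 1` such that
`ν(B(x,2r)) ≤ C ν(B(x,r))` for all `x ∈ supp ν` and `0 < r ≤ 1`. -/
def IsDoubling {X : Type*} [PseudoMetricSpace X] [MeasurableSpace X] (ν : Measure X) : Prop :=
  ∃ C : ℝ≥0, 1 ≤ C ∧ ∀ x ∈ measSupport ν, ∀ r : ℝ, 0 < r → r ≤ 1 →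
    ν (ball x (2 * r)) ≤ C * ν (ball x r)

/-- The set of badly approximable `M × N` matrices. -/
def badlyApproximableMat (M N : ℕ) : Set (MatSpace M N) :=
  {α | ∃ c : ℝ, 0 < c ∧ ∀ q : Fin N → ℤ, q ≠ 0 → ∀ p : Fin M → ℤ,
    c * ‖fun j => (q j : ℝ)‖ ^ (-(N : ℝ) / M) ≤
      ‖α.mulVec (fun j => (q j : ℝ)) - fun i => (p i : ℝ)‖}


section part1

/-! ## Lattices: Minkowski and Mahler -/

/-- real vector of an integer vector -/
def zc {ι : Type*} (z : ι → ℤ) : ι → ℝ := fun i => (z i : ℝ)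

/-- real matrix of an integer matrix -/
def zm {ι : Type*} (g : Matrix ι ι ℤ) : Matrix ι ι ℝ := g.map (fun x : ℤ => (x : ℝ))

section lattice
variable {ι : Type*} [Fintype ι] [DecidableEq ι]

lemma zc_eq_zero {z : ι → ℤ} : zc z = 0 ↔ z = 0 := by
  constructor
  · intro h; ext i; have := congrFun h i; simpa [zc] using this
  · rintro rfl; ext i; simp [zc]

lemma zm_mul (g h : Matrix ι ι ℤ) : zm (g * h) = zm g * zm h := by
  ext i j; simp [zm, Matrix.mul_apply]

lemma zm_one : zm (1 : Matrix ι ι ℤ) = 1 := by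
  ext i j; simp [zm, Matrix.one_apply]

lemma zm_mulVec (g : Matrix ι ι ℤ) (z : ι → ℤ) : zm g *ᵥ zc z = zc (g *ᵥ z) := by
  ext i; simp [zm, zc, Matrix.mulVec, dotProduct]

lemma zm_det (g : Matrix ι ι ℤ) : (zm g).det = (g.det : ℝ) := by
  have := (Int.castRingHom ℝ).map_det g
  simpa [zm] using this.symm

lemma minkowski (A : Matrix ι ι ℝ) (h0 : A.det ≠ 0) (h1 : |A.det| < 1) :
    ∃ z : ι → ℤ, z ≠ 0 ∧ ‖A *ᵥ zc z‖ < 1 := by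
  let b := Pi.basisFun ℝ ι
  have fund := ZSpan.isAddFundamentalDomain' b (volume : Measure (ι → ℝ))
  have hd : LinearMap.det (Matrix.toLin' A) = A.det := LinearMap.det_toLin' A
  let s : Set (ι → ℝ) := Matrix.toLin' A ⁻¹' (ball 0 1)
  have hF : volume (ZSpan.fundamentalDomain b) = 1 := by
    rw [ZSpan.volume_fundamentalDomain]; simp [b]
    convert! abs_one (α := ℝ) 
    have : (Matrix.of (Pi.basisFun ℝ ι)) = (1 : Matrix ι ι ℝ) := by
      ext i j; simp [Matrix.one_apply, Pi.single_apply, eq_comm]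
    simpa using congrArg Matrix.det this
  have hs : volume s = ENNReal.ofReal |(A.det)⁻¹| * volume (ball (0 : ι → ℝ) 1) := by
    have := Measure.addHaar_preimage_linearMap (volume : Measure (ι → ℝ)) (f := Matrix.toLin' A)
      (by rw [hd]; exact h0) (ball 0 1)
    rw [hd] at this; exact this
  have : Countable (Submodule.span ℤ (Set.range b)).toAddSubgroup :=
    inferInstanceAs (Countable (Submodule.span ℤ (Set.range b)))
  obtain ⟨x, hx, hxs⟩ := exists_ne_zero_mem_lattice_of_measure_mul_two_pow_lt_measure fund (s := s)
    (by intro x hx; simp only [s, Set.mem_preimage, mem_ball_zero_iff, map_neg, norm_neg] at hx ⊢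
        exact hx)
    ((convex_ball 0 1).linear_preimage _) (by
      rw [hF, hs, Real.volume_pi_ball _ one_pos, one_mul, mul_one]
      simp only [Module.finrank_fintype_fun_eq_card]
      rw [ENNReal.ofReal_pow (by norm_num)]
      simp only [ENNReal.ofReal_ofNat]
      have h2 : (1 : ℝ≥0∞) < ENNReal.ofReal |(A.det)⁻¹| := by
        rw [ENNReal.one_lt_ofReal, abs_inv]
        exact (one_lt_inv₀ (abs_pos.2 h0)).2 h1
      calc (2 : ℝ≥0∞) ^ Fintype.card ι = 1 * 2 ^ Fintype.card ι := by rw [one_mul]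
        _ < _ := (ENNReal.mul_lt_mul_iff_left (by simp) (by finiteness)).2 h2)
  have hm : (x : ι → ℝ) ∈ Submodule.span ℤ (Set.range b) := x.2
  rw [Module.Basis.mem_span_iff_repr_mem] at hm
  choose z hz using hm
  have hzx : zc z = (x : ι → ℝ) := by
    ext i; have := hz i; simpa [b, zc] using this
  refine ⟨z, ?_, ?_⟩
  · rintro rfl
    apply hx
    have : (x : ι → ℝ) = 0 := by rw [← hzx, zc_eq_zero]
    exact Subtype.ext this
  · rw [hzx]
    simpa [s] using hxs

lemma mulVec_norm_le {m n : Type*} [Fintype m] [Fintype n] (A : Matrix m n ℝ) (v : n → ℝ) :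
    ‖A *ᵥ v‖ ≤ Fintype.card n * ‖A‖ * ‖v‖ := by
  rw [pi_norm_le_iff_of_nonneg (by positivity)]
  intro i
  calc ‖(A *ᵥ v) i‖ ≤ ∑ j, ‖A i j * v j‖ := norm_sum_le _ _
    _ ≤ ∑ _j : n, ‖A‖ * ‖v‖ := by
        apply Finset.sum_le_sum; intro j _
        rw [norm_mul]
        exact mul_le_mul (Matrix.norm_entry_le_entrywise_sup_norm A) (norm_le_pi_norm v j)
          (norm_nonneg _) (norm_nonneg _)
    _ = _ := by simp; ring

lemma matmul_norm_le {m n k : Type*} [Fintype m] [Fintype n] [Fintype k]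
    (A : Matrix m n ℝ) (B : Matrix n k ℝ) :
    ‖A * B‖ ≤ Fintype.card n * ‖A‖ * ‖B‖ := by
  rw [Matrix.norm_le_iff (by positivity)]
  intro i l
  rw [Matrix.mul_apply]
  calc ‖∑ j, A i j * B j l‖ ≤ ∑ j, ‖A i j * B j l‖ := norm_sum_le _ _
    _ ≤ ∑ _j : n, ‖A‖ * ‖B‖ := by
        apply Finset.sum_le_sum; intro j _
        rw [norm_mul]
        exact mul_le_mul (Matrix.norm_entry_le_entrywise_sup_norm A)
          (Matrix.norm_entry_le_entrywise_sup_norm B)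
          (norm_nonneg _) (norm_nonneg _)
    _ = _ := by simp; ring

end lattice

end part1


section part2

section mahler
variable {ι : Type*} [Fintype ι] [DecidableEq ι]

/-- no short lattice vectors -/
def XX (ε : ℝ) (y : Matrix ι ι ℝ) : Prop := ∀ z : ι → ℤ, z ≠ 0 → ε ≤ ‖y *ᵥ zc z‖

lemma det_updateRow_smul_one (c : ℝ) (i : ι) (v : ι → ℝ) :
    ((c • (1 : Matrix ι ι ℝ)).updateRow i v).det = c ^ (Fintype.card ι - 1) * v i := by
  rw [← Matrix.cramer_transpose_apply, Matrix.cramer_eq_adjugate_mulVec]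
  simp [Matrix.adjugate_smul, Matrix.smul_mulVec]

lemma mahler_span (ε : ℝ) (hε : 0 < ε) : ∃ R : ℝ, ∀ y : Matrix ι ι ℝ, |y.det| = 1 → XX ε y →
    Submodule.span ℝ {x | ∃ z : ι → ℤ, x = y *ᵥ zc z ∧ ‖x‖ ≤ R} = ⊤ := by
  let d : ℝ := Fintype.card ι
  let c : ℝ := (d + 1) / ε
  have hd : 0 ≤ d := by positivity
  have hc : 0 < c := by positivity
  let θ : ℝ := 1 / (2 * c ^ (Fintype.card ι - 1))
  have hθ : 0 < θ := by positivity
  refine ⟨1 / θ + d / c + 1 / c, fun y hy hX => ?_⟩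
  by_contra hne
  obtain ⟨f, hf0, hf⟩ := Submodule.exists_le_ker_of_lt_top _ (lt_top_iff_ne_top.2 hne)
  -- the vector
  let ξ' : ι → ℝ := fun i => f (Pi.single i 1)
  have hfξ' : ∀ v, f v = ∑ i, v i * ξ' i := by
    intro v
    conv_lhs => rw [← Finset.univ_sum_single v]
    rw [map_sum]
    refine Finset.sum_congr rfl fun i _ => ?_
    have : Pi.single i (v i) = v i • (Pi.single i (1:ℝ) : ι → ℝ) := by
      ext j; simp [Pi.single_apply]
    rw [this, map_smul, smul_eq_mul]
  have hne' : Nonempty ι := by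
    by_contra h
    rw [not_nonempty_iff] at h
    apply hf0; ext v; exact isEmptyElim v
  obtain ⟨i0, hi0⟩ := Finite.exists_max (fun i => |ξ' i|)
  have hξ0 : 0 < |ξ' i0| := by
    by_contra h
    have h0 : ∀ i, ξ' i = 0 := fun i => by
      have := hi0 i
      have h1 := abs_nonneg (ξ' i)
      exact abs_eq_zero.1 (by linarith)
    apply hf0
    apply LinearMap.ext; intro v
    rw [hfξ']; simp [h0]
  let ξ : ι → ℝ := fun i => ξ' i / |ξ' i0|
  have hξ1 : ∀ i, |ξ i| ≤ 1 := fun i => by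
    simp only [ξ, abs_div, abs_abs]
    exact (div_le_one hξ0).2 (hi0 i)
  have hξi0 : |ξ i0| = 1 := by
    simp only [ξ, abs_div, abs_abs]; exact div_self hξ0.ne'
  have hfξ : ∀ v, f v = 0 → ξ ⬝ᵥ v = 0 := by
    intro v hv
    rw [hfξ'] at hv
    have : ξ ⬝ᵥ v = (∑ i, v i * ξ' i) / |ξ' i0| := by
      rw [Finset.sum_div]; simp only [dotProduct, ξ]
      exact Finset.sum_congr rfl fun i _ => by ring
    rw [this, hv, zero_div]
  let T := (c • (1 : Matrix ι ι ℝ)).updateRow i0 (θ • ξ)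
  have hT : |T.det| = 1 / 2 := by
    simp only [T, det_updateRow_smul_one, Pi.smul_apply, smul_eq_mul, abs_mul, hξi0, mul_one,
      abs_of_pos hθ, abs_of_pos (pow_pos hc _)]
    simp only [θ]; field_simp
  obtain ⟨z, hz, hzn⟩ := minkowski (T * y)
    (by rw [Matrix.det_mul]; intro h
        have := congrArg abs h
        rw [abs_mul, hT, hy, abs_zero] at this; norm_num at this)
    (by rw [Matrix.det_mul, abs_mul, hT, hy]; norm_num)
  set x := y *ᵥ zc z with hx
  rw [← Matrix.mulVec_mulVec, ← hx, pi_norm_lt_iff one_pos] at hzn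
  have h1 : ∀ j, j ≠ i0 → |x j| < 1 / c := by
    intro j hj
    have := hzn j
    simp only [T, Matrix.mulVec, Matrix.updateRow_ne hj] at this
    have e : ((c • (1 : Matrix ι ι ℝ)) j ⬝ᵥ x) = c * x j := by
      simp [dotProduct, Matrix.one_apply]
    rw [e, Real.norm_eq_abs, abs_mul, abs_of_pos hc] at this
    rw [lt_div_iff₀ hc]; linarith
  have h2 : |ξ ⬝ᵥ x| < 1 / θ := by
    have := hzn i0
    simp only [T, Matrix.mulVec, Matrix.updateRow_self] at this
    rw [smul_dotProduct, smul_eq_mul, Real.norm_eq_abs, abs_mul, abs_of_pos hθ] at this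
    rw [lt_div_iff₀ hθ]; linarith
  have h3 : |x i0| ≤ |ξ ⬝ᵥ x| + (d - 1) * (1 / c) := by
    have e : ξ ⬝ᵥ x = ξ i0 * x i0 + ∑ j ∈ Finset.univ.erase i0, ξ j * x j :=
      (Finset.add_sum_erase _ _ (Finset.mem_univ i0)).symm
    have e2 : |∑ j ∈ Finset.univ.erase i0, ξ j * x j| ≤ (d - 1) * (1 / c) := by
      calc _ ≤ ∑ j ∈ Finset.univ.erase i0, |ξ j * x j| := Finset.abs_sum_le_sum_abs _ _
        _ ≤ ∑ j ∈ Finset.univ.erase i0, (1 / c) := by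
            apply Finset.sum_le_sum; intro j hj
            rw [abs_mul]
            have a1 := hξ1 j
            have a2 := (h1 j (Finset.ne_of_mem_erase hj)).le
            calc |ξ j| * |x j| ≤ 1 * (1 / c) := mul_le_mul a1 a2 (abs_nonneg _) zero_le_one
              _ = _ := one_mul _
        _ = _ := by
            rw [Finset.sum_const, Finset.card_erase_of_mem (Finset.mem_univ _), nsmul_eq_mul,
              Nat.cast_sub]
            · simp [d]
            · exact Finset.card_pos.2 ⟨i0, Finset.mem_univ _⟩
    have e3 : |x i0| = |ξ i0 * x i0| := by rw [abs_mul, hξi0, one_mul]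
    rw [e3]
    have : ξ i0 * x i0 = ξ ⬝ᵥ x - ∑ j ∈ Finset.univ.erase i0, ξ j * x j := by rw [e]; ring
    rw [this]
    exact (abs_sub _ _).trans (by linarith)
  have hR : ‖x‖ ≤ 1 / θ + d / c + 1 / c := by
    rw [pi_norm_le_iff_of_nonneg (by positivity)]
    intro j
    rw [Real.norm_eq_abs]
    have a1 : 0 < 1 / θ := by positivity
    have a2 : 0 ≤ d / c := by positivity
    have a3 : 0 < 1 / c := by positivity
    have a4 : (d - 1) * (1 / c) = d / c - 1 / c := by ring
    by_cases hj : j = i0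
    · subst hj; linarith
    · have := h1 j hj; linarith
  have h0 : ξ ⬝ᵥ x = 0 := hfξ x (LinearMap.mem_ker.1 (hf (Submodule.subset_span ⟨z, hx, hR⟩)))
  have hlt : ‖x‖ < ε := by
    rw [pi_norm_lt_iff hε]
    intro j
    rw [Real.norm_eq_abs]
    have a5 : 1 / c = ε / (d + 1) := by simp only [c]; field_simp
    have a6 : d * (ε / (d + 1)) < ε := by
      rw [mul_div_assoc', div_lt_iff₀ (by positivity)]; nlinarith
    have a7 : ε / (d+1) ≤ ε := div_le_self hε.le (by linarith)
    have a8 : 0 < ε / (d+1) := by positivity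
    by_cases hj : j = i0
    · subst hj; rw [h0, abs_zero, a5] at h3; nlinarith
    · have := h1 j hj; linarith
  exact absurd (hX z hz) (not_le.2 hlt)

lemma mahler_int (ε : ℝ) (hε : 0 < ε) : ∃ R : ℝ, ∀ y : Matrix ι ι ℝ, |y.det| = 1 → XX ε y →
    ∃ A : Matrix ι ι ℤ, A.det ≠ 0 ∧ ‖y * zm A‖ ≤ R := by
  obtain ⟨R, hR⟩ := mahler_span (ι := ι) ε hε
  refine ⟨max R 0, fun y hy hX => ?_⟩
  have hs := hR y hy hX
  set s := {x | ∃ z : ι → ℤ, x = y *ᵥ zc z ∧ ‖x‖ ≤ R} with hsdef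
  let b := Module.Basis.ofSpan hs.ge
  have hb : ∀ i, b i ∈ s := fun i => Module.Basis.ofSpan_subset hs.ge ⟨i, rfl⟩
  have : Fintype _ := Module.Basis.fintypeIndexOfRankLtAleph0 b (Module.rank_lt_aleph0 ℝ (ι → ℝ))
  let e := b.indexEquiv (Pi.basisFun ℝ ι)
  let b' := b.reindex e
  have hb' : ∀ i, b' i ∈ s := fun i => by simp only [b', Module.Basis.reindex_apply]; exact hb _
  choose z hz hn using hb'
  let A : Matrix ι ι ℤ := Matrix.of fun i j => z j i
  have hcol : ∀ i j, (y * zm A) i j = b' j i := by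
    intro i j
    rw [hz j]
    simp [Matrix.mul_apply, Matrix.mulVec, dotProduct, zm, zc, A]
  refine ⟨A, ?_, ?_⟩
  · intro h
    have h1 : (y * zm A).det = 0 := by rw [Matrix.det_mul, zm_det, h]; simp
    have h2 : (y * zm A) = (Pi.basisFun ℝ ι).toMatrix b' := by
      ext i j; rw [hcol]; simp [Module.Basis.toMatrix_apply]
    rw [h2, ← Module.Basis.det_apply] at h1
    have := (Pi.basisFun ℝ ι).isUnit_det b'
    rw [h1] at this
    simp at this
  · rw [Matrix.norm_le_iff (le_max_right _ _)]
    intro i j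
    rw [hcol]
    exact ((norm_le_pi_norm (b' j) i).trans (hn j)).trans (le_max_left _ _)

end mahler

end part2


section part3

section mahler2
variable {ι : Type*} [Fintype ι] [DecidableEq ι]

/-- reduction of the row lattice modulo `m` -/
def redSet (m : ℕ) (A : Matrix ι ι ℤ) : Set (ι → ZMod m) :=
  {x | ∃ v : ι → ℤ, ∀ i, x i = (((v ᵥ* A) i : ℤ) : ZMod m)}

lemma redSet_sub (m : ℕ) (A A' : Matrix ι ι ℤ) (h0 : A'.det ≠ 0) (hm : A'.det ∣ (m : ℤ))
    (h : redSet m A ⊆ redSet m A') : ∃ X : Matrix ι ι ℤ, A = X * A' := by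
  have key : ∀ i, ∃ x : ι → ℤ, A i = x ᵥ* A' := by
    intro i
    have h1 : (fun j => ((A i j : ℤ) : ZMod m)) ∈ redSet m A := by
      refine ⟨Pi.single i 1, fun j => ?_⟩
      simp
    obtain ⟨v, hv⟩ := h h1
    have h2 : ∀ j, ∃ k : ℤ, A i j = (v ᵥ* A') j + m * k := by
      intro j
      have := hv j
      rw [ZMod.intCast_eq_intCast_iff_dvd_sub] at this
      obtain ⟨k, hk⟩ := this
      exact ⟨-k, by linarith⟩
    choose k hk using h2
    obtain ⟨q, hq⟩ := hm
    refine ⟨v + (q • (k ᵥ* A'.adjugate)), ?_⟩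
    rw [Matrix.add_vecMul, Matrix.smul_vecMul, Matrix.vecMul_vecMul, Matrix.adjugate_mul,
      Matrix.vecMul_smul, Matrix.vecMul_one]
    ext j
    rw [hk j, hq]
    simp; ring
  choose x hx using key
  refine ⟨Matrix.of x, ?_⟩
  ext i j
  rw [hx i]; rfl

lemma coset_finite (D : ℕ) : ∃ R : ℝ, ∀ A : Matrix ι ι ℤ, A.det ≠ 0 → A.det.natAbs ≤ D →
    ∃ (γ : (Matrix ι ι ℤ)ˣ) (H : Matrix ι ι ℤ), A = γ * H ∧ H.det ≠ 0 ∧ ‖zm H‖ ≤ R := by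
  let m := D.factorial
  have : NeZero m := ⟨Nat.factorial_ne_zero _⟩
  let P : Set (ι → ZMod m) → Matrix ι ι ℤ → Prop := fun s A =>
    A.det ≠ 0 ∧ A.det.natAbs ≤ D ∧ redSet m A = s
  have hrep : ∀ s, ∃ H, (∃ A, P s A) → P s H := by
    intro s
    by_cases h : ∃ A, P s A
    · obtain ⟨A, hA⟩ := h; exact ⟨A, fun _ => hA⟩
    · exact ⟨0, fun h' => absurd h' h⟩
  choose H hH using hrep
  have hdvd : ∀ A : Matrix ι ι ℤ, A.det ≠ 0 → A.det.natAbs ≤ D → A.det ∣ (m : ℤ) := by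
    intro A h0 hD
    rw [← Int.natAbs_dvd_natAbs, Int.natAbs_natCast]
    exact Nat.dvd_factorial (Int.natAbs_pos.2 h0) hD
  obtain ⟨R, hR⟩ := (Set.finite_range (fun s => ‖zm (H s)‖)).bddAbove
  refine ⟨R, fun A h0 hD => ?_⟩
  have hP : P (redSet m A) A := ⟨h0, hD, rfl⟩
  obtain ⟨h0', hD', hs⟩ := hH _ ⟨A, hP⟩
  set B := H (redSet m A)
  obtain ⟨X, hX⟩ := redSet_sub m A B h0' (hdvd _ h0' hD') hs.ge
  obtain ⟨Y, hY⟩ := redSet_sub m B A h0 (hdvd _ h0 hD) hs.le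
  have hXY : X * Y = 1 := by
    have : (X * Y - 1) * A = 0 := by
      rw [Matrix.sub_mul, Matrix.mul_assoc, ← hY, ← hX, Matrix.one_mul, sub_self]
    have h2 : (X * Y - 1) * (A * A.adjugate) = 0 := by
      rw [← Matrix.mul_assoc, this, Matrix.zero_mul]
    rw [Matrix.mul_adjugate] at h2
    have h3 : A.det • (X * Y - 1) = 0 := by
      rw [Matrix.mul_smul, Matrix.mul_one] at h2; exact h2
    rcases smul_eq_zero.1 h3 with h | h
    · exact absurd h h0
    · exact sub_eq_zero.1 h
  refine ⟨⟨X, Y, hXY, mul_eq_one_comm.1 hXY⟩, B, hX, h0', hR ⟨_, rfl⟩⟩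

lemma bound_on_ball {f : Matrix ι ι ℝ → ℝ} (hf : Continuous f) (R : ℝ) :
    ∃ C : ℝ, 0 ≤ C ∧ ∀ A, ‖A‖ ≤ R → |f A| ≤ C := by
  obtain ⟨C, hC⟩ := (isCompact_closedBall (0 : Matrix ι ι ℝ) R).exists_bound_of_continuousOn
    hf.continuousOn
  exact ⟨max C 0, le_max_right _ _, fun A hA => (hC A (by simpa using hA)).trans (le_max_left _ _)⟩

/-- **Mahler** compactness. -/
lemma mahler_bdd (ε : ℝ) (hε : 0 < ε) : ∃ R : ℝ, 0 < R ∧ ∀ y : Matrix ι ι ℝ, |y.det| = 1 → XX ε y →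
    ∃ γ : (Matrix ι ι ℤ)ˣ, ‖y * zm γ‖ ≤ R := by
  obtain ⟨R, hR⟩ := mahler_int (ι := ι) ε hε
  obtain ⟨C, hC0, hC⟩ := bound_on_ball (ι := ι) (f := fun A => A.det)
    (Continuous.matrix_det continuous_id) R
  obtain ⟨R', hR'⟩ := coset_finite (ι := ι) ⌈C⌉₊
  obtain ⟨C', hC0', hC'⟩ := bound_on_ball (ι := ι) (f := fun A => ‖A.adjugate‖)
    (Continuous.norm (Continuous.matrix_adjugate continuous_id)) R'
  refine ⟨|Fintype.card ι * R * C'| + 1, by positivity, fun y hy hX => ?_⟩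
  obtain ⟨A, hA0, hA⟩ := hR y hy hX
  have hdet : A.det.natAbs ≤ ⌈C⌉₊ := by
    have h1 := hC _ hA
    rw [Matrix.det_mul, abs_mul, hy, one_mul, zm_det] at h1
    have h2 : ((A.det.natAbs : ℕ) : ℝ) ≤ C := by
      rw [Nat.cast_natAbs]; exact_mod_cast h1
    exact_mod_cast h2.trans (Nat.le_ceil C)
  obtain ⟨γ, H, hAH, hH0, hHR⟩ := hR' A hA0 hdet
  refine ⟨γ, ?_⟩
  have hHd : (zm H).det ≠ 0 := by rw [zm_det]; exact_mod_cast hH0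
  have e : y * zm γ = (zm H).det⁻¹ • (y * zm A * (zm H).adjugate) := by
    rw [hAH, zm_mul, Matrix.mul_assoc y, Matrix.mul_assoc (zm _), Matrix.mul_adjugate]
    simp [smul_smul, inv_mul_cancel₀ hHd]
  have h1 : ‖(zm H).det⁻¹‖ ≤ 1 := by
    rw [norm_inv, zm_det]
    apply inv_le_one_of_one_le₀
    rw [Real.norm_eq_abs]
    exact_mod_cast Int.one_le_abs hH0
  rw [e, norm_smul]
  have h2 := matmul_norm_le (y * zm A) (zm H).adjugate
  have h3 := hC' _ hHR
  rw [abs_of_nonneg (norm_nonneg _)] at h3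
  have h4 : 0 ≤ R := (norm_nonneg _).trans hA
  calc _ ≤ 1 * (Fintype.card ι * ‖y * zm A‖ * ‖(zm H).adjugate‖) :=
        mul_le_mul h1 h2 (norm_nonneg _) zero_le_one
    _ ≤ Fintype.card ι * R * C' := by rw [one_mul]; gcongr
    _ ≤ _ := by linarith [le_abs_self (Fintype.card ι * R * C')]

end mahler2

end part3


section part4

/-! ## The acting group -/

/-- scales together with pairs of orthogonal matrices -/
abbrev Qg (M N : ℕ) := {σ : ℝ // 0 < σ} × Matrix.orthogonalGroup (Fin M) ℝ ×
  Matrix.orthogonalGroup (Fin N) ℝ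

abbrev Ix (M N : ℕ) := Fin M ⊕ Fin N
abbrev Big (M N : ℕ) := Matrix (Ix M N) (Ix M N) ℝ

section grp
variable {M N : ℕ}

def sc (q : Qg M N) : ℝ := q.1
def lB (q : Qg M N) : Matrix (Fin M) (Fin M) ℝ := q.2.1
def lC (q : Qg M N) : Matrix (Fin N) (Fin N) ℝ := q.2.2

lemma sc_pos (q : Qg M N) : 0 < sc q := q.1.2
lemma sc_one : sc (1 : Qg M N) = 1 := rfl
lemma sc_mul (q q' : Qg M N) : sc (q * q') = sc q * sc q' := rfl
lemma sc_inv (q : Qg M N) : sc q⁻¹ = (sc q)⁻¹ := rfl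
lemma lB_one : lB (1 : Qg M N) = 1 := rfl
lemma lC_one : lC (1 : Qg M N) = 1 := rfl
lemma lB_mul (q q' : Qg M N) : lB (q * q') = lB q * lB q' := rfl
lemma lC_mul (q q' : Qg M N) : lC (q * q') = lC q * lC q' := rfl
lemma lB_inv (q : Qg M N) : lB q⁻¹ = (lB q)ᵀ := by
  simp only [lB, Prod.snd_inv, Prod.fst_inv]; rfl
lemma lC_inv (q : Qg M N) : lC q⁻¹ = (lC q)ᵀ := by
  simp only [lC, Prod.snd_inv]; rfl
lemma lB_mul_tr (q : Qg M N) : lB q * (lB q)ᵀ = 1 := by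
  rw [← lB_inv, ← lB_mul, mul_inv_cancel, lB_one]
lemma lB_tr_mul (q : Qg M N) : (lB q)ᵀ * lB q = 1 := by
  rw [← lB_inv, ← lB_mul, inv_mul_cancel, lB_one]
lemma lC_mul_tr (q : Qg M N) : lC q * (lC q)ᵀ = 1 := by
  rw [← lC_inv, ← lC_mul, mul_inv_cancel, lC_one]
lemma lC_tr_mul (q : Qg M N) : (lC q)ᵀ * lC q = 1 := by
  rw [← lC_inv, ← lC_mul, inv_mul_cancel, lC_one]

lemma continuous_sc : Continuous (sc : Qg M N → ℝ) := by unfold sc; fun_prop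
lemma continuous_lB : Continuous (lB : Qg M N → _) := by unfold lB; fun_prop
lemma continuous_lC : Continuous (lC : Qg M N → _) := by unfold lC; fun_prop

lemma orth_norm_le {n : ℕ} (B : Matrix.orthogonalGroup (Fin n) ℝ) :
    ‖(B : Matrix (Fin n) (Fin n) ℝ)‖ ≤ 1 := entrywise_sup_norm_bound_of_unitary B.2

lemma lB_norm (q : Qg M N) : ‖lB q‖ ≤ 1 := orth_norm_le _
lemma lC_norm (q : Qg M N) : ‖lC q‖ ≤ 1 := orth_norm_le _

instance orthCompact (n : ℕ) : CompactSpace (Matrix.orthogonalGroup (Fin n) ℝ) := by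
  suffices h : IsCompact ((Matrix.orthogonalGroup (Fin n) ℝ : Submonoid _) :
      Set (Matrix (Fin n) (Fin n) ℝ)) from isCompact_iff_compactSpace.1 h
  apply Metric.isCompact_of_isClosed_isBounded
  · have : ((Matrix.orthogonalGroup (Fin n) ℝ : Submonoid _) : Set (Matrix (Fin n) (Fin n) ℝ))
      = {A | star A * A = 1} ∩ {A | A * star A = 1} := by
      ext A; exact Iff.rfl
    rw [this]
    exact (isClosed_eq (by fun_prop) continuous_const).inter
      (isClosed_eq (by fun_prop) continuous_const)
  · rw [isBounded_iff_forall_norm_le]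
    exact ⟨1, fun A hA => orth_norm_le ⟨A, hA⟩⟩

lemma isCompact_scIcc (a b : ℝ) (ha : 0 < a) :
    IsCompact {q : Qg M N | a ≤ sc q ∧ sc q ≤ b} := by
  have h1 : IsCompact {s : {σ : ℝ // 0 < σ} | a ≤ (s : ℝ) ∧ (s : ℝ) ≤ b} := by
    rw [Subtype.isCompact_iff]
    have : ((↑) : {σ : ℝ // 0 < σ} → ℝ) '' {s | a ≤ (s : ℝ) ∧ (s : ℝ) ≤ b} = Set.Icc a b := by
      ext x; constructor
      · rintro ⟨s, hs, rfl⟩; exact hs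
      · intro hx; exact ⟨⟨x, ha.trans_le hx.1⟩, hx, rfl⟩
    rw [this]; exact isCompact_Icc
  have := h1.prod (isCompact_univ (X := Matrix.orthogonalGroup (Fin M) ℝ ×
    Matrix.orthogonalGroup (Fin N) ℝ))
  convert this using 1
  ext q; simp [sc]

/-- action on translations -/
def act (q : Qg M N) (s : MatSpace M N) : MatSpace M N :=
  (sc q) ^ (M + N) • (lB q * s * (lC q)ᵀ)

/-- diagonal matrix -/
def dg (q : Qg M N) : Big M N :=
  Matrix.fromBlocks ((sc q) ^ N • lB q) 0 0 ((sc q)⁻¹ ^ M • lC q)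

/-- unipotent matrix -/
def uu (s : MatSpace M N) : Big M N := Matrix.fromBlocks 1 s 0 1

lemma uu_zero : uu (0 : MatSpace M N) = 1 := Matrix.fromBlocks_one
lemma uu_mul (s s' : MatSpace M N) : uu s * uu s' = uu (s + s') := by
  simp [uu, Matrix.fromBlocks_multiply, add_comm]
lemma dg_one : dg (1 : Qg M N) = 1 := by
  simp [dg, sc_one, lB_one, lC_one, Matrix.fromBlocks_one]
lemma dg_mul (q q' : Qg M N) : dg q * dg q' = dg (q * q') := by
  simp [dg, Matrix.fromBlocks_multiply, sc_mul, lB_mul, lC_mul, mul_pow, smul_smul, mul_comm]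

lemma act_one (s : MatSpace M N) : act 1 s = s := by
  simp [act, sc_one, lB_one, lC_one]
lemma act_mul (q q' : Qg M N) (s : MatSpace M N) : act (q * q') s = act q (act q' s) := by
  simp [act, sc_mul, lB_mul, lC_mul, mul_pow, smul_smul, Matrix.mul_assoc]
lemma act_add (q : Qg M N) (s s' : MatSpace M N) : act q (s + s') = act q s + act q s' := by
  simp [act, Matrix.mul_add, Matrix.add_mul]
lemma act_smul (q : Qg M N) (c : ℝ) (s : MatSpace M N) : act q (c • s) = c • act q s := by
  simp [act, smul_smul, mul_comm]
lemma act_neg (q : Qg M N) (s : MatSpace M N) : act q (-s) = -act q s := by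
  simp [act]
lemma act_zero (q : Qg M N) : act q (0 : MatSpace M N) = 0 := by simp [act]
lemma act_sub (q : Qg M N) (s s' : MatSpace M N) : act q (s - s') = act q s - act q s' := by
  rw [sub_eq_add_neg, act_add, act_neg, sub_eq_add_neg]

lemma dg_uu (q : Qg M N) (s : MatSpace M N) : dg q * uu s = uu (act q s) * dg q := by
  have h := (sc_pos q).ne'
  have : (sc q) ^ (M + N) * ((sc q) ^ M)⁻¹ = (sc q) ^ N := by
    rw [pow_add]; field_simp
  simp [dg, uu, act, Matrix.fromBlocks_multiply, Matrix.mul_assoc, lC_tr_mul, smul_smul]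
  rw [mul_comm, this]

lemma abs_det_orth {n : ℕ} (B C : Matrix (Fin n) (Fin n) ℝ) (h : B * Bᵀ = 1) : |B.det| = 1 := by
  have := congrArg Matrix.det h
  rw [Matrix.det_mul, Matrix.det_transpose, Matrix.det_one] at this
  rw [← sq_eq_sq₀ (abs_nonneg _) zero_le_one, sq_abs]; linarith

lemma abs_det_dg (q : Qg M N) : |(dg q).det| = 1 := by
  have h := (sc_pos q)
  rw [dg, Matrix.det_fromBlocks_zero₂₁, Matrix.det_smul, Matrix.det_smul]
  simp only [Fintype.card_fin, abs_mul]
  rw [abs_det_orth (lB q) 1 (lB_mul_tr q), abs_det_orth (lC q) 1 (lC_mul_tr q), abs_of_pos (by positivity),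
    abs_of_pos (by positivity), mul_one, mul_one, ← pow_mul, ← pow_mul, mul_comm N M,
    ← mul_pow, mul_inv_cancel₀ h.ne', one_pow]

lemma det_uu (s : MatSpace M N) : (uu s).det = 1 := by
  simp [uu, Matrix.det_fromBlocks_zero₂₁]

lemma continuous_act : Continuous (fun p : Qg M N × MatSpace M N => act p.1 p.2) := by
  unfold act
  have h1 := continuous_sc (M := M) (N := N)
  have h2 := continuous_lB (M := M) (N := N)
  have h3 := continuous_lC (M := M) (N := N)
  fun_prop

lemma continuous_dg : Continuous (dg : Qg M N → _) := by
  unfold dg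
  have h1 := continuous_sc (M := M) (N := N)
  have h2 := continuous_lB (M := M) (N := N)
  have h3 := continuous_lC (M := M) (N := N)
  refine Continuous.matrix_fromBlocks (by fun_prop) continuous_const continuous_const ?_
  exact ((h1.inv₀ fun q => (sc_pos q).ne').pow _).smul h3

lemma continuous_uu : Continuous (uu : MatSpace M N → _) := by
  unfold uu
  exact Continuous.matrix_fromBlocks continuous_const continuous_id continuous_const
    continuous_const

instance : IsTopologicalGroup {σ : ℝ // 0 < σ} where
  continuous_mul := by
    refine Continuous.subtype_mk (f := fun p : {σ : ℝ // 0 < σ} × {σ : ℝ // 0 < σ} =>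
      (p.1 : ℝ) * p.2) ?_ _
    fun_prop
  continuous_inv := by
    refine Continuous.subtype_mk (f := fun p : {σ : ℝ // 0 < σ} => (p : ℝ)⁻¹) ?_ _
    exact continuous_subtype_val.inv₀ fun p => p.2.ne'

lemma Qg_mul_cont : Continuous (fun p : Qg M N × Qg M N => p.1 * p.2) := continuous_mul
lemma Qg_inv_cont : Continuous (fun p : Qg M N => p⁻¹) := continuous_inv

/-- affine element -/
def fm (q : Qg M N) (x : MatSpace M N) : Big M N := uu x * dg q

lemma fm_mul (q q' : Qg M N) (x x' : MatSpace M N) :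
    fm q x * fm q' x' = fm (q * q') (act q x' + x) := by
  unfold fm
  rw [Matrix.mul_assoc, ← Matrix.mul_assoc (dg q), dg_uu, Matrix.mul_assoc, ← Matrix.mul_assoc,
    uu_mul, dg_mul, add_comm]

lemma fm_one : fm (1 : Qg M N) 0 = 1 := by simp [fm, uu_zero, dg_one]

/-- its inverse -/
def fmi (q : Qg M N) (x : MatSpace M N) : Big M N := dg q⁻¹ * uu (-x)

lemma fm_fmi (q : Qg M N) (x : MatSpace M N) : fm q x * fmi q x = 1 := by
  unfold fm fmi
  rw [Matrix.mul_assoc, ← Matrix.mul_assoc (dg q), dg_mul, mul_inv_cancel, dg_one, Matrix.one_mul,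
    uu_mul, add_neg_cancel, uu_zero]

lemma fmi_fm (q : Qg M N) (x : MatSpace M N) : fmi q x * fm q x = 1 :=
  mul_eq_one_comm.1 (fm_fmi q x)

lemma abs_det_fm (q : Qg M N) (x : MatSpace M N) : |(fm q x).det| = 1 := by
  rw [fm, Matrix.det_mul, det_uu, one_mul, abs_det_dg]

lemma abs_det_fmi (q : Qg M N) (x : MatSpace M N) : |(fmi q x).det| = 1 := by
  rw [fmi, Matrix.det_mul, det_uu, mul_one, abs_det_dg]

lemma fm_uu (q : Qg M N) (x s : MatSpace M N) : fm q x * uu s = uu (act q s) * fm q x := by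
  unfold fm
  rw [Matrix.mul_assoc, dg_uu, ← Matrix.mul_assoc, ← Matrix.mul_assoc, uu_mul, uu_mul, add_comm]

lemma fmi_uu (q : Qg M N) (x s : MatSpace M N) : fmi q x * uu s = uu (act q⁻¹ s) * fmi q x := by
  unfold fmi
  rw [Matrix.mul_assoc, uu_mul, add_comm, ← uu_mul, ← Matrix.mul_assoc, dg_uu, Matrix.mul_assoc]

end grp

end part4


section part5

/-! ## Systems, words and good lattices -/

structure Sys (M N : ℕ) (E : Type*) where
  t : E → Qg M N
  δ : E → MatSpace M N
  hM : 1 ≤ M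
  hN : 1 ≤ N
  lo : ℝ
  hi : ℝ
  lo_pos : 0 < lo
  hi_pos : 0 < hi
  hi_lt : hi < 1
  lo_le : ∀ e, lo ≤ sc (t e)
  le_hi : ∀ e, sc (t e) ≤ hi

/-- reversed past word -/
def bw {E : Type*} (b : ℕ → E) : ℕ → List E
  | 0 => []
  | n + 1 => b n :: bw b n

/-- initial word -/
def pf {E : Type*} (b : ℕ → E) : ℕ → List E
  | 0 => []
  | n + 1 => pf b n ++ [b n]

def pcons {E : Type*} (e : E) (b : ℕ → E) : ℕ → E
  | 0 => e
  | n + 1 => b n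

def pw {E : Type*} : List E → (ℕ → E) → (ℕ → E)
  | [], b => b
  | e :: w, b => pw w (pcons e b)

def bsh {E : Type*} (b : ℕ → E) (n : ℕ) : ℕ → E := fun k => b (k + n)

section seqs
variable {E : Type*}

lemma pf_length (b : ℕ → E) (n : ℕ) : (pf b n).length = n := by
  induction n with
  | zero => rfl
  | succ n ih => simp [pf, ih]

lemma bw_pcons (e : E) (b : ℕ → E) (n : ℕ) : bw (pcons e b) (n + 1) = bw b n ++ [e] := by
  induction n with
  | zero => rfl
  | succ n ih => rw [bw, ih]; rfl

lemma bw_bsh (b : ℕ → E) (n k : ℕ) : bw b (k + n) = bw (bsh b n) k ++ bw b n := by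
  induction k with
  | zero => simp [bw]
  | succ k ih => rw [show k + 1 + n = (k + n) + 1 by omega, bw, ih]; rfl

lemma pcons_bsh (b : ℕ → E) (n : ℕ) : pcons (b n) (bsh b (n + 1)) = bsh b n := by
  ext k; cases k with
  | zero => simp [pcons, bsh]
  | succ k => simp only [pcons, bsh]; congr 1; omega

lemma pw_bw (b : ℕ → E) (n : ℕ) : pw (bw b n) (bsh b n) = b := by
  induction n with
  | zero => rfl
  | succ n ih => rw [bw, pw, pcons_bsh, ih]

lemma pw_append (w w' : List E) (b : ℕ → E) : pw (w ++ w') b = pw w' (pw w b) := by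
  induction w generalizing b with
  | nil => rfl
  | cons e w ih => simp only [List.cons_append, pw, ih]

/-- the first `k` entries of `pw w b` depend only on `w` when `w` has length at least `k` -/
lemma pw_agree (w : List E) (b b' : ℕ → E) (n : ℕ) (h : ∀ k < n, b k = b' k) :
    ∀ k < w.length + n, pw w b k = pw w b' k := by
  induction w generalizing b b' n with
  | nil => simpa [pw] using h
  | cons e w ih =>
    intro k hk
    refine ih (pcons e b) (pcons e b') (n + 1) ?_ k (by simp at hk; omega)
    intro k hk
    cases k with
    | zero => rfl
    | succ k => exact h k (by omega)

lemma tendsto_bw {T : Type*} {l : Filter T} [TopologicalSpace E] [DiscreteTopology E]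
    {b : T → ℕ → E} {b0 : ℕ → E}
    (h : Tendsto b l (𝓝 b0)) (n : ℕ) : ∀ᶠ i in l, bw (b i) n = bw b0 n := by
  induction n with
  | zero => exact Eventually.of_forall fun _ => rfl
  | succ n ih =>
    have h1 : Tendsto (fun i => b i n) l (𝓝 (b0 n)) := (tendsto_pi_nhds.1 h) n
    rw [nhds_discrete, tendsto_pure] at h1
    filter_upwards [ih, h1] with i hi h1
    rw [bw, bw, hi, h1]

end seqs

lemma step_down (a : ℕ → ℝ) (lo s : ℝ) (hs : 0 < s) (hlo : 0 < lo) (h0 : lo * s ≤ a 0)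
    (hst : ∀ n, lo * a n ≤ a (n + 1)) (hex : ∃ n, a n ≤ s) : ∃ n, lo * s ≤ a n ∧ a n ≤ s := by
  classical
  refine ⟨Nat.find hex, ?_, Nat.find_spec hex⟩
  rcases hn : Nat.find hex with _ | k
  · exact h0
  · have h1 : ¬ a k ≤ s := Nat.find_min hex (by omega)
    push Not at h1
    exact (mul_le_mul_of_nonneg_left h1.le hlo.le).trans (hst k)

namespace Sys
variable {M N : ℕ} {E : Type*} (S : Sys M N E)

def tw (w : List E) : Qg M N := (w.map S.t).prod

def xw : List E → MatSpace M N
  | [] => 0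
  | e :: w => act (S.t e) (xw w) + S.δ e

def F (w : List E) : Big M N := fm (S.tw w) (S.xw w)
def Fi (w : List E) : Big M N := fmi (S.tw w) (S.xw w)
/-- the affine map of a word -/
def ph (w : List E) (x : MatSpace M N) : MatSpace M N := act (S.tw w) x + S.xw w

lemma tw_nil : S.tw [] = 1 := rfl
lemma xw_nil : S.xw [] = 0 := rfl
lemma tw_cons (e : E) (w : List E) : S.tw (e :: w) = S.t e * S.tw w := by simp [tw]
lemma tw_append (w w' : List E) : S.tw (w ++ w') = S.tw w * S.tw w' := by simp [tw]
lemma tw_single (e : E) : S.tw [e] = S.t e := by simp [tw]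
lemma xw_append (w w' : List E) : S.xw (w ++ w') = act (S.tw w) (S.xw w') + S.xw w := by
  induction w with
  | nil => simp [xw, tw_nil, act_one]
  | cons e w ih =>
    rw [List.cons_append, xw, ih, tw_cons, act_mul, act_add, xw, add_assoc]
lemma F_nil : S.F [] = 1 := fm_one
lemma F_append (w w' : List E) : S.F (w ++ w') = S.F w * S.F w' := by
  unfold F; rw [fm_mul, tw_append, xw_append]
lemma F_Fi (w : List E) : S.F w * S.Fi w = 1 := fm_fmi _ _
lemma Fi_F (w : List E) : S.Fi w * S.F w = 1 := fmi_fm _ _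
lemma Fi_nil : S.Fi [] = 1 := by
  have := S.F_Fi []
  rwa [F_nil, Matrix.one_mul] at this
lemma Fi_append (w w' : List E) : S.Fi (w ++ w') = S.Fi w' * S.Fi w := by
  have h : (S.Fi w' * S.Fi w) * S.F (w ++ w') = 1 := by
    rw [F_append, Matrix.mul_assoc, ← Matrix.mul_assoc (S.Fi w), Fi_F, Matrix.one_mul, Fi_F]
  calc S.Fi (w ++ w') = (S.Fi w' * S.Fi w) * S.F (w ++ w') * S.Fi (w ++ w') := by
        rw [h, Matrix.one_mul]
    _ = _ := by rw [Matrix.mul_assoc, F_Fi, Matrix.mul_one]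
lemma ph_append (w w' : List E) (x : MatSpace M N) : S.ph (w ++ w') x = S.ph w (S.ph w' x) := by
  unfold ph; rw [tw_append, xw_append, act_mul, act_add, add_assoc]
lemma F_uu (w : List E) (x : MatSpace M N) : S.F w * uu x = uu (S.ph w x) * dg (S.tw w) := by
  unfold F ph; rw [fm_uu, fm, ← Matrix.mul_assoc, uu_mul]
lemma abs_det_F (w : List E) : |(S.F w).det| = 1 := abs_det_fm _ _
lemma abs_det_Fi (w : List E) : |(S.Fi w).det| = 1 := abs_det_fmi _ _

/-- lattices all of whose relevant renormalisations have no short vectors -/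
def Good (ε : ℝ) (b : ℕ → E) (y : Big M N) : Prop :=
  |y.det| = 1 ∧ ∀ (n : ℕ) (w : List E), XX ε (S.Fi w * S.F (bw b n) * y)

variable {S} {ε : ℝ}

lemma Good.xx {b : ℕ → E} {y : Big M N} (h : S.Good ε b y) : XX ε y := by
  have := h.2 0 []
  simpa [bw, Fi_nil, F_nil] using this

lemma Good.fwd1 {b : ℕ → E} {y : Big M N} (h : S.Good ε b y) (e : E) :
    S.Good ε (pcons e b) (S.Fi [e] * y) := by
  refine ⟨by rw [Matrix.det_mul, abs_mul, abs_det_Fi, one_mul, h.1], fun n w => ?_⟩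
  rcases n with _ | n
  · have := h.2 0 ([e] ++ w)
    rw [Fi_append] at this
    simpa [bw, F_nil, Matrix.mul_assoc] using this
  · have := h.2 n w
    rw [bw_pcons, F_append]
    rw [Matrix.mul_assoc, Matrix.mul_assoc, ← Matrix.mul_assoc (S.F [e]), F_Fi, Matrix.one_mul,
      ← Matrix.mul_assoc]
    exact this

lemma Good.fwd {b : ℕ → E} {y : Big M N} (h : S.Good ε b y) (w : List E) :
    S.Good ε (pw w b) (S.Fi w * y) := by
  induction w generalizing b y with
  | nil => simpa [pw, Fi_nil] using h
  | cons e w ih =>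
    have := ih (h.fwd1 e)
    rw [← Matrix.mul_assoc, ← Fi_append] at this
    exact this

lemma Good.back {b : ℕ → E} {y : Big M N} (h : S.Good ε b y) (n : ℕ) :
    S.Good ε (bsh b n) (S.F (bw b n) * y) := by
  refine ⟨by rw [Matrix.det_mul, abs_mul, abs_det_F, one_mul, h.1], fun k w => ?_⟩
  have := h.2 (k + n) w
  rw [bw_bsh, F_append] at this
  simpa [Matrix.mul_assoc] using this

lemma good_back_iff {b : ℕ → E} {y : Big M N} (n : ℕ) :
    S.Good ε (bsh b n) (S.F (bw b n) * y) ↔ S.Good ε b y := by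
  refine ⟨fun h => ?_, fun h => h.back n⟩
  have := h.fwd (bw b n)
  rwa [pw_bw, ← Matrix.mul_assoc, Fi_F, Matrix.one_mul] at this

lemma good_fwd1_iff {b : ℕ → E} {y : Big M N} (e : E) :
    S.Good ε (pcons e b) (S.Fi [e] * y) ↔ S.Good ε b y := by
  refine ⟨fun h => ?_, fun h => h.fwd1 e⟩
  have := h.back 1
  have e1 : bsh (pcons e b) 1 = b := by ext k; rfl
  have e2 : bw (pcons e b) 1 = [e] := rfl
  rwa [e1, e2, ← Matrix.mul_assoc, F_Fi, Matrix.one_mul] at this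

lemma good_fwd_iff {b : ℕ → E} {y : Big M N} (w : List E) :
    S.Good ε (pw w b) (S.Fi w * y) ↔ S.Good ε b y := by
  induction w generalizing b y with
  | nil => simp [pw, Fi_nil]
  | cons e w ih =>
    rw [← good_fwd1_iff (b := b) e, ← ih (b := pcons e b), ← Matrix.mul_assoc, ← Fi_append]; rfl

lemma XX_gamma {ι : Type*} [Fintype ι] [DecidableEq ι] {ε : ℝ} {y : Matrix ι ι ℝ} (h : XX ε y)
    (γ : (Matrix ι ι ℤ)ˣ) : XX ε (y * zm γ) := by
  intro z hz
  rw [← Matrix.mulVec_mulVec, zm_mulVec]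
  apply h
  intro h0
  apply hz
  have : (γ⁻¹.1 * γ.1) *ᵥ z = 0 := by rw [← Matrix.mulVec_mulVec, h0, Matrix.mulVec_zero]
  rwa [← Units.val_mul, inv_mul_cancel, Units.val_one, Matrix.one_mulVec] at this

lemma zm_inv {ι : Type*} [Fintype ι] [DecidableEq ι] (γ : (Matrix ι ι ℤ)ˣ) :
    zm γ.1 * zm γ⁻¹.1 = 1 := by
  rw [← zm_mul, ← Units.val_mul, mul_inv_cancel, Units.val_one, zm_one]

lemma abs_det_zm {ι : Type*} [Fintype ι] [DecidableEq ι] (γ : (Matrix ι ι ℤ)ˣ) :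
    |(zm γ.1).det| = 1 := by
  rw [zm_det]
  have : IsUnit (γ.1.det) := (Matrix.isUnit_iff_isUnit_det _).1 γ.isUnit
  rcases Int.isUnit_iff.1 this with h | h <;> rw [h] <;> simp

lemma Good.gamma {b : ℕ → E} {y : Big M N} (h : S.Good ε b y) (γ : (Matrix (Ix M N) (Ix M N) ℤ)ˣ) :
    S.Good ε b (y * zm γ) := by
  refine ⟨by rw [Matrix.det_mul, abs_mul, h.1, one_mul, abs_det_zm], fun n w => ?_⟩
  rw [← Matrix.mul_assoc]
  exact XX_gamma (h.2 n w) γ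

lemma good_gamma_iff {b : ℕ → E} {y : Big M N} (γ : (Matrix (Ix M N) (Ix M N) ℤ)ˣ) :
    S.Good ε b (y * zm γ) ↔ S.Good ε b y := by
  refine ⟨fun h => ?_, fun h => h.gamma γ⟩
  have := h.gamma γ⁻¹
  rwa [Matrix.mul_assoc, zm_inv, Matrix.mul_one] at this

lemma XX_limit {ι T : Type*} [Fintype ι] [DecidableEq ι] {l : Filter T} [NeBot l] {ε : ℝ}
    {y : T → Matrix ι ι ℝ} {y0 : Matrix ι ι ℝ} (hy : Tendsto y l (𝓝 y0))
    (h : ∀ᶠ i in l, XX ε (y i)) : XX ε y0 := by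
  intro z hz
  have : Tendsto (fun i => ‖y i *ᵥ zc z‖) l (𝓝 ‖y0 *ᵥ zc z‖) :=
    ((Continuous.matrix_mulVec continuous_id continuous_const).tendsto y0 |>.comp hy).norm
  exact ge_of_tendsto this (h.mono fun i hi => hi z hz)

lemma absdet_limit {ι T : Type*} [Fintype ι] [DecidableEq ι] {l : Filter T} [NeBot l]
    {y : T → Matrix ι ι ℝ} {y0 : Matrix ι ι ℝ} (hy : Tendsto y l (𝓝 y0))
    (h : ∀ᶠ i in l, |(y i).det| = 1) : |y0.det| = 1 := by
  have : Tendsto (fun i => |(y i).det|) l (𝓝 |y0.det|) :=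
    ((Continuous.matrix_det continuous_id).tendsto y0 |>.comp hy).abs
  refine tendsto_nhds_unique this (tendsto_const_nhds.congr' (h.mono fun i hi => hi.symm))

lemma good_limit {T : Type*} {l : Filter T} [NeBot l] [TopologicalSpace E] [DiscreteTopology E]
    {b : T → ℕ → E} {b0 : ℕ → E} {y : T → Big M N} {y0 : Big M N}
    (hb : Tendsto b l (𝓝 b0)) (hy : Tendsto y l (𝓝 y0))
    (h : ∀ᶠ i in l, S.Good ε (b i) (y i)) : S.Good ε b0 y0 := by
  refine ⟨absdet_limit hy (h.mono fun i hi => hi.1), fun n w => ?_⟩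
  have h1 : Tendsto (fun i => S.Fi w * S.F (bw b0 n) * y i) l
      (𝓝 (S.Fi w * S.F (bw b0 n) * y0)) :=
    (Continuous.matrix_mul continuous_const continuous_id).tendsto y0 |>.comp hy
  refine XX_limit h1 ?_
  filter_upwards [tendsto_bw hb n, h] with i hi hg
  rw [← hi]; exact hg.2 n w

variable (S) (ε) in
/-- translates that stay good -/
def Ph (q : Qg M N) (b : ℕ → E) (y : Big M N) : Set (MatSpace M N) :=
  {s | S.Good ε b (uu (act q s) * y)}

lemma zero_mem_Ph {q : Qg M N} {b : ℕ → E} {y : Big M N} :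
    (0 : MatSpace M N) ∈ S.Ph ε q b y ↔ S.Good ε b y := by
  simp [Ph, act_zero, uu_zero]

lemma Ph_fwd (q : Qg M N) (b : ℕ → E) (y : Big M N) (w : List E) :
    S.Ph ε ((S.tw w)⁻¹ * q) (pw w b) (S.Fi w * y) = S.Ph ε q b y := by
  ext s
  simp only [Ph, Set.mem_setOf_eq]
  rw [← good_fwd_iff w (y := uu (act q s) * y), ← Matrix.mul_assoc (S.Fi w), act_mul]
  rw [show S.Fi w * uu (act q s) = uu (act (S.tw w)⁻¹ (act q s)) * S.Fi w from fmi_uu _ _ _,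
    Matrix.mul_assoc]

lemma Ph_back (q : Qg M N) (b : ℕ → E) (y : Big M N) (n : ℕ) :
    S.Ph ε (S.tw (bw b n) * q) (bsh b n) (S.F (bw b n) * y) = S.Ph ε q b y := by
  ext s
  simp only [Ph, Set.mem_setOf_eq]
  rw [← good_back_iff n (y := uu (act q s) * y), ← Matrix.mul_assoc (S.F _), act_mul]
  rw [show S.F (bw b n) * uu (act q s) = uu (act (S.tw (bw b n)) (act q s)) * S.F (bw b n) from
    fm_uu _ _ _, Matrix.mul_assoc]

lemma Ph_gamma (q : Qg M N) (b : ℕ → E) (y : Big M N) (γ : (Matrix (Ix M N) (Ix M N) ℤ)ˣ) :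
    S.Ph ε q b (y * zm γ) = S.Ph ε q b y := by
  ext s
  simp only [Ph, Set.mem_setOf_eq]
  rw [← Matrix.mul_assoc, good_gamma_iff]

lemma mem_Ph_trans (q : Qg M N) (b : ℕ → E) (y : Big M N) (s s' : MatSpace M N) :
    s' ∈ S.Ph ε q b (uu (act q s) * y) ↔ s' + s ∈ S.Ph ε q b y := by
  simp only [Ph, Set.mem_setOf_eq]
  rw [← Matrix.mul_assoc, uu_mul, act_add]

lemma Ph_limit {T : Type*} {l : Filter T} [NeBot l] [TopologicalSpace E] [DiscreteTopology E]
    {q : T → Qg M N} {q0 : Qg M N}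
    {b : T → ℕ → E} {b0 : ℕ → E} {y : T → Big M N} {y0 : Big M N} {s : T → MatSpace M N}
    {s0 : MatSpace M N} (hq : Tendsto q l (𝓝 q0))
    (hb : Tendsto b l (𝓝 b0)) (hy : Tendsto y l (𝓝 y0)) (hs : Tendsto s l (𝓝 s0))
    (h : ∀ᶠ i in l, s i ∈ S.Ph ε (q i) (b i) (y i)) : s0 ∈ S.Ph ε q0 b0 y0 := by
  have h1 : Tendsto (fun i => act (q i) (s i)) l (𝓝 (act q0 s0)) :=
    (continuous_act.tendsto (q0, s0)).comp (hq.prodMk_nhds hs)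
  have h2 : Tendsto (fun i => uu (act (q i) (s i)) * y i) l (𝓝 (uu (act q0 s0) * y0)) :=
    ((continuous_uu.tendsto _).comp h1).mul hy
  exact good_limit hb h2 h

lemma sc_tw_pos (w : List E) : 0 < sc (S.tw w) := sc_pos _

lemma sc_tw_le (w : List E) : sc (S.tw w) ≤ S.hi ^ w.length := by
  induction w with
  | nil => simp [tw_nil, sc_one]
  | cons e w ih =>
    rw [tw_cons, sc_mul, List.length_cons, pow_succ']
    exact mul_le_mul (S.le_hi e) ih (sc_pos _).le S.hi_pos.le

lemma lo_le_one [Nonempty E] : S.lo ≤ 1 :=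
  (S.lo_le (Classical.arbitrary E)).trans ((S.le_hi _).trans S.hi_lt.le)

lemma hi_pow_tendsto : Tendsto (fun n : ℕ => S.hi ^ n) atTop (𝓝 0) :=
  tendsto_pow_atTop_nhds_zero_of_lt_one S.hi_pos.le S.hi_lt

lemma bw_length (b : ℕ → E) (n : ℕ) : (bw b n).length = n := by
  induction n with
  | zero => rfl
  | succ n ih => simp [bw, ih]

lemma back_scale (b : ℕ → E) (q : Qg M N) (s : ℝ) (hs : 0 < s) (h : S.lo * s ≤ sc q) :
    ∃ m, S.lo * s ≤ sc (S.tw (bw b m) * q) ∧ sc (S.tw (bw b m) * q) ≤ s := by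
  apply step_down (fun m => sc (S.tw (bw b m) * q)) S.lo s hs S.lo_pos
  · simpa [bw, tw_nil] using h
  · intro n
    simp only [bw, tw_cons, sc_mul, mul_assoc]
    exact mul_le_mul_of_nonneg_right (S.lo_le _) (mul_pos (sc_pos _) (sc_pos _)).le
  · have h1 : Tendsto (fun n => S.hi ^ n * sc q) atTop (𝓝 0) := by
      simpa using (S.hi_pow_tendsto).mul_const (sc q)
    obtain ⟨n, hn⟩ := (h1.eventually (gt_mem_nhds hs)).exists
    refine ⟨n, le_trans ?_ hn.le⟩
    rw [sc_mul]
    have := S.sc_tw_le (bw b n)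
    rw [bw_length] at this
    exact mul_le_mul_of_nonneg_right this (sc_pos _).le

lemma fwd_scale (c : ℕ → E) (s : ℝ) (hs : 0 < s) (h : s ≤ 1) :
    ∃ n, s ≤ sc (S.tw (pf c n)) ∧ sc (S.tw (pf c n)) ≤ s / S.lo := by
  have h3 : S.lo * (s / S.lo) = s := mul_div_cancel₀ _ S.lo_pos.ne'
  have := step_down (fun m => sc (S.tw (pf c m))) S.lo (s / S.lo) (div_pos hs S.lo_pos) S.lo_pos
    (by rw [h3]; simpa [pf, tw_nil, sc_one] using h) (by
      intro n
      simp only [pf, tw_append, tw_single, sc_mul]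
      rw [mul_comm]
      exact mul_le_mul_of_nonneg_left (S.lo_le _) (sc_pos _).le) (by
      obtain ⟨n, hn⟩ := (S.hi_pow_tendsto.eventually (gt_mem_nhds (div_pos hs S.lo_pos))).exists
      refine ⟨n, le_trans ?_ hn.le⟩
      have := S.sc_tw_le (pf c n)
      rwa [pf_length] at this)
  rwa [h3] at this

/-- normalisation of states -/
lemma normalize [Nonempty E] (q : Qg M N) (b : ℕ → E) (y : Big M N) :
    ∃ q' b' y', S.lo ≤ sc q' ∧ sc q' ≤ 1 ∧ S.Ph ε q' b' y' = S.Ph ε q b y := by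
  by_cases h : sc q ≤ 1
  · obtain ⟨n, h1, h2⟩ := S.fwd_scale (fun _ => Classical.arbitrary E) (sc q) (sc_pos q) h
    refine ⟨_, _, _, ?_, ?_, Ph_fwd q b y (pf (fun _ => Classical.arbitrary E) n)⟩
    · rw [sc_mul, sc_inv, inv_mul_eq_div, le_div_iff₀ (sc_pos _)]
      rw [le_div_iff₀ S.lo_pos] at h2; linarith
    · rw [sc_mul, sc_inv, inv_mul_eq_div, div_le_one (sc_pos _)]
      exact h1
  · push Not at h
    obtain ⟨m, h1, h2⟩ := S.back_scale b q 1 one_pos (by rw [mul_one]; linarith [S.lo_le_one])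
    exact ⟨_, _, _, by simpa using h1, h2, Ph_back q b y m⟩

end Sys

end part5


section part6

/-! ## Maximal sets of good translates -/

/-- a free ultrafilter on the naturals -/
def UU : Filter ℕ := (Filter.hyperfilter ℕ : Filter ℕ)
instance : NeBot UU := by unfold UU; infer_instance
lemma UU_le : UU ≤ atTop := by
  unfold UU; rw [← Nat.cofinite_eq_atTop]; exact Filter.hyperfilter_le_cofinite

lemma ulim {X : Type*} [TopologicalSpace X] {K : Set X} (hK : IsCompact K) (f : ℕ → X)
    (hf : ∀ n, f n ∈ K) : ∃ x ∈ K, Tendsto f UU (𝓝 x) := by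
  have := hK.ultrafilter_le_nhds ((Filter.hyperfilter ℕ).map f) (by
    rw [Ultrafilter.coe_map, Filter.le_principal_iff, Filter.mem_map]
    exact Filter.univ_mem' hf)
  exact this

lemma uconst {T : Type*} [Finite T] (f : ℕ → T) : ∃ a, ∀ᶠ n in UU, f n = a := by
  letI : TopologicalSpace T := ⊥
  haveI : DiscreteTopology T := ⟨rfl⟩
  obtain ⟨x, -, hx⟩ := ulim (isCompact_univ (X := T)) f (fun _ => Set.mem_univ _)
  rw [nhds_discrete, tendsto_pure] at hx
  exact ⟨x, hx⟩

lemma ulim_ball {V : Type*} [NormedAddCommGroup V] [ProperSpace V] (f : ℕ → V) (R : ℝ)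
    (hf : ∀ n, ‖f n‖ ≤ R) : ∃ x, ‖x‖ ≤ R ∧ Tendsto f UU (𝓝 x) := by
  obtain ⟨x, hx, h⟩ := ulim (isCompact_closedBall (0 : V) R) f (fun n => by simpa using hf n)
  exact ⟨x, by simpa using hx, h⟩

lemma closed_of_filter {X : Type*} [TopologicalSpace X] (s : Set X)
    (h : ∀ (x : X) (l : Filter X), NeBot l → l ≤ 𝓝 x → s ∈ l → x ∈ s) : IsClosed s := by
  refine isClosed_of_closure_subset fun x hx => ?_
  exact h x (𝓝[s] x) (mem_closure_iff_nhdsWithin_neBot.1 hx) nhdsWithin_le_nhds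
    self_mem_nhdsWithin

namespace Sys
variable {M N : ℕ} {E : Type*} {S : Sys M N E} {ε : ℝ}

lemma bw_const (e : E) (n : ℕ) : bw (fun _ => e) n = List.replicate n e := by
  induction n with
  | zero => rfl
  | succ n ih => rw [bw, ih]; rfl

lemma exists_good [Nonempty E] (hε : 0 < ε) (y₀ : Big M N) (h0 : |y₀.det| = 1)
    (h : ∀ w, XX ε (S.Fi w * y₀)) : ∃ b y, S.Good ε b y := by
  obtain ⟨R, hR, hm⟩ := mahler_bdd (ι := Ix M N) ε hε
  let e : E := Classical.arbitrary E
  have h1 : ∀ n : ℕ, ∃ γ : (Matrix (Ix M N) (Ix M N) ℤ)ˣ,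
      ‖S.Fi (List.replicate n e) * y₀ * zm γ‖ ≤ R := fun n =>
    hm _ (by rw [Matrix.det_mul, abs_mul, abs_det_Fi, h0, one_mul]) (h _)
  choose γ hγ using h1
  obtain ⟨y, -, hy⟩ := ulim_ball _ R hγ
  refine ⟨fun _ => e, y, absdet_limit hy (Eventually.of_forall fun n => ?_), fun n w => ?_⟩
  · rw [Matrix.det_mul, abs_mul, Matrix.det_mul, abs_mul, abs_det_Fi, h0, one_mul, abs_det_zm,
      one_mul]
  · have h2 : Tendsto (fun i => S.Fi w * S.F (bw (fun _ => e) n) *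
      (S.Fi (List.replicate i e) * y₀ * zm (γ i))) UU
      (𝓝 (S.Fi w * S.F (bw (fun _ => e) n) * y)) :=
      (Continuous.matrix_mul continuous_const continuous_id).tendsto y |>.comp hy
    refine XX_limit h2 ?_
    filter_upwards [UU_le (eventually_ge_atTop n)] with i hi
    have e1 : List.replicate i e = List.replicate n e ++ List.replicate (i - n) e := by
      rw [← List.replicate_add]; congr 1; omega
    have e2 : S.Fi w * S.F (bw (fun _ => e) n) * (S.Fi (List.replicate i e) * y₀ * zm (γ i))
        = (S.Fi (List.replicate (i - n) e ++ w) * y₀) * zm (γ i) := by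
      have e3 : S.F (List.replicate n e) * S.Fi (List.replicate i e)
        = S.Fi (List.replicate (i-n) e) := by
        have e5 : List.replicate i e = List.replicate (i - n) e ++ List.replicate n e := by
          rw [← List.replicate_add]; congr 1; omega
        rw [e5, Fi_append, ← Matrix.mul_assoc, F_Fi, Matrix.one_mul]
      rw [bw_const, Fi_append, ← e3]
      simp only [Matrix.mul_assoc]
    rw [e2]
    exact XX_gamma (h _) _

/-- a normalised representative -/
lemma Good.norm_state [Nonempty E] {R : ℝ} (hm : ∀ y : Matrix (Ix M N) (Ix M N) ℝ, |y.det| = 1 → XX ε y →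
      ∃ γ : (Matrix (Ix M N) (Ix M N) ℤ)ˣ, ‖y * zm γ.1‖ ≤ R) {q : Qg M N} {b : ℕ → E} {y : Big M N}
    (h : S.Good ε b y) :
    ∃ (q' : Qg M N) (b' : ℕ → E) (y' : Big M N),
      S.lo ≤ sc q' ∧ sc q' ≤ 1 ∧ ‖y'‖ ≤ R ∧ S.Ph ε q' b' y' = S.Ph ε q b y := by
  obtain ⟨q', b', y', h1, h2, h3⟩ := normalize (S := S) (ε := ε) q b y
  have hg : S.Good ε b' y' := by
    rw [← zero_mem_Ph (q := q'), h3, zero_mem_Ph]; exact h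
  obtain ⟨γ, hγ⟩ := hm y' hg.1 hg.xx
  refine ⟨q', b', y' * zm γ.1, h1, h2, ?_, ?_⟩
  · exact hγ
  · rw [Ph_gamma, h3]

lemma isClosed_states [TopologicalSpace E] [DiscreteTopology E] (A : Set (MatSpace M N)) :
    IsClosed {p : Qg M N × (ℕ → E) × Big M N | A ⊆ S.Ph ε p.1 p.2.1 p.2.2} := by
  refine closed_of_filter _ fun x l hl hx hp s hs => ?_
  have h1 := (continuous_fst.tendsto x).mono_left hx
  have h2 := ((continuous_fst.comp continuous_snd).tendsto x).mono_left hx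
  have h3 := ((continuous_snd.comp continuous_snd).tendsto x).mono_left hx
  exact Ph_limit h1 h2 h3 tendsto_const_nhds (Filter.mem_of_superset hp fun i hi => hi hs)

lemma exists_maximal [Finite E] [Nonempty E] (hε : 0 < ε) (hg : ∃ b y, S.Good ε b y) :
    ∃ (Fs : Set (MatSpace M N)) (q : Qg M N) (b : ℕ → E) (y : Big M N),
      (0 : MatSpace M N) ∈ Fs ∧ S.Ph ε q b y = Fs ∧
      ∀ q b y, Fs ⊆ S.Ph ε q b y → S.Ph ε q b y = Fs := by
  letI : TopologicalSpace E := ⊥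
  haveI : DiscreteTopology E := ⟨rfl⟩
  obtain ⟨R, hR, hm⟩ := mahler_bdd (ι := Ix M N) ε hε
  let FF : Set (Set (MatSpace M N)) := {A | ∃ q b y, S.Good ε b y ∧ A = S.Ph ε q b y}
  obtain ⟨b0, y0, hg0⟩ := hg
  have hA0 : S.Ph ε 1 b0 y0 ∈ FF := ⟨1, b0, y0, hg0, rfl⟩
  obtain ⟨Fs, -, hmax⟩ := zorn_subset_nonempty FF (by
    intro c hc hchain hne
    let T : c → Set (Qg M N × (ℕ → E) × Big M N) := fun A =>
      ({q : Qg M N | S.lo ≤ sc q ∧ sc q ≤ 1} ×ˢ (Set.univ ×ˢ closedBall 0 R)) ∩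
        {p | (A : Set (MatSpace M N)) ⊆ S.Ph ε p.1 p.2.1 p.2.2}
    have hcpt : IsCompact ({q : Qg M N | S.lo ≤ sc q ∧ sc q ≤ 1} ×ˢ
        ((Set.univ : Set (ℕ → E)) ×ˢ closedBall (0 : Big M N) R)) :=
      (isCompact_scIcc _ _ S.lo_pos).prod (isCompact_univ.prod (isCompact_closedBall _ _))
    have hTc : ∀ A, IsCompact (T A) := fun A => hcpt.inter_right (isClosed_states _)
    haveI : Nonempty c := hne.to_subtype
    obtain ⟨p, hp⟩ := IsCompact.nonempty_iInter_of_directed_nonempty_isCompact_isClosed T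
      (by
        intro A B
        rcases hchain.total A.2 B.2 with h | h
        · exact ⟨B, fun p hp => ⟨hp.1, h.trans hp.2⟩, fun p hp => hp⟩
        · exact ⟨A, fun p hp => hp, fun p hp => ⟨hp.1, h.trans hp.2⟩⟩)
      (by
        intro A
        obtain ⟨q, b, y, hgood, hA⟩ := hc A.2
        obtain ⟨q', b', y', h1, h2, h3, h4⟩ := hgood.norm_state hm (q := q)
        refine ⟨(q', b', y'), ⟨⟨h1, h2⟩, Set.mem_univ _, by simpa using h3⟩, ?_⟩
        rw [Set.mem_setOf_eq, h4, hA])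
      hTc (fun A => (hTc A).isClosed)
    rw [Set.mem_iInter] at hp
    refine ⟨S.Ph ε p.1 p.2.1 p.2.2, ⟨_, _, _, ?_, rfl⟩, fun A hA => (hp ⟨A, hA⟩).2⟩
    obtain ⟨A, hA⟩ := hne
    obtain ⟨q, b, y, hgood, hA'⟩ := hc hA
    have h0 : (0 : MatSpace M N) ∈ A := by rw [hA']; exact zero_mem_Ph.2 hgood
    exact zero_mem_Ph.1 ((hp ⟨A, hA⟩).2 h0)) _ hA0
  obtain ⟨q, b, y, hgood, hFs⟩ := hmax.1
  have h0 : (0 : MatSpace M N) ∈ Fs := by rw [hFs]; exact zero_mem_Ph.2 hgood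
  refine ⟨Fs, q, b, y, h0, hFs.symm, fun q b y h => ?_⟩
  exact (hmax.eq_of_subset ⟨q, b, y, zero_mem_Ph.1 (h h0), rfl⟩ h).symm

/-- stabiliser of a set -/
def stab (A : Set (MatSpace M N)) : AddSubgroup (MatSpace M N) where
  carrier := {h | ∀ s, s + h ∈ A ↔ s ∈ A}
  zero_mem' := by simp
  add_mem' := by
    intro a b ha hb s
    rw [← add_assoc, hb, ha]
  neg_mem' := by
    intro a ha s
    rw [← ha, neg_add_cancel_right]

lemma mem_stab {A : Set (MatSpace M N)} {h : MatSpace M N} :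
    h ∈ stab A ↔ ∀ s, s + h ∈ A ↔ s ∈ A := Iff.rfl

lemma isClosed_Ph [TopologicalSpace E] [DiscreteTopology E] (q : Qg M N) (b : ℕ → E)
    (y : Big M N) : IsClosed (S.Ph ε q b y) := by
  refine closed_of_filter _ fun x l hl hx hp => ?_
  exact Ph_limit tendsto_const_nhds tendsto_const_nhds tendsto_const_nhds
    (tendsto_id.mono_left hx) hp

lemma stab_isClosed {A : Set (MatSpace M N)} (hA : IsClosed A) :
    IsClosed (stab A : Set (MatSpace M N)) := by
  refine closed_of_filter _ fun x l hl hx hp s => ?_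
  have hx : Tendsto id l (𝓝 x) := tendsto_id.mono_left hx
  constructor
  · intro h
    have h1 : Tendsto (fun n => s + x - id n) l (𝓝 (s + x - x)) :=
      tendsto_const_nhds.sub hx
    rw [add_sub_cancel_right] at h1
    refine hA.mem_of_tendsto h1 (Filter.mem_of_superset hp fun n hn => ?_)
    change s + x - n ∈ A
    rw [← (mem_stab.1 hn), sub_add_cancel]; exact h
  · intro h
    have h1 : Tendsto (fun n => s + id n) l (𝓝 (s + x)) :=
      tendsto_const_nhds.add hx
    exact hA.mem_of_tendsto h1 (Filter.mem_of_superset hp fun n hn => (mem_stab.1 hn s).2 h)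

end Sys

end part6


section part7

/-! ## The limit set and polynomial lemmas -/

section rot
variable {M N : ℕ}

def rot (q : Qg M N) (s : MatSpace M N) : MatSpace M N := lB q * s * (lC q)ᵀ

lemma act_eq (q : Qg M N) (s : MatSpace M N) : act q s = (sc q) ^ (M + N) • rot q s := rfl

/-- norm constant -/
def kap (M N : ℕ) : ℝ := M * N + 1
lemma kap_pos : 0 < kap M N := by unfold kap; positivity
lemma one_le_kap : 1 ≤ kap M N := by
  unfold kap; have : (0:ℝ) ≤ M * N := by positivity
  linarith

lemma tr_norm {m n : ℕ} (A : Matrix (Fin m) (Fin n) ℝ) : ‖Aᵀ‖ = ‖A‖ := Matrix.norm_transpose A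

lemma rot_norm (q : Qg M N) (s : MatSpace M N) : ‖rot q s‖ ≤ kap M N * ‖s‖ := by
  unfold rot
  have h1 := matmul_norm_le (lB q * s) (lC q)ᵀ
  have h2 := matmul_norm_le (lB q) s
  have h3 := lB_norm q
  have h4 := lC_norm q
  rw [tr_norm] at h1
  simp only [Fintype.card_fin] at h1 h2
  calc _ ≤ _ := h1
    _ ≤ N * (M * 1 * ‖s‖) * 1 := by
        gcongr
        exact h2.trans (by gcongr)
    _ ≤ _ := by unfold kap; nlinarith [norm_nonneg s]

lemma act_norm (q : Qg M N) (s : MatSpace M N) :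
    ‖act q s‖ ≤ (sc q) ^ (M + N) * (kap M N * ‖s‖) := by
  rw [act_eq, norm_smul, Real.norm_of_nonneg (pow_pos (sc_pos q) _).le]
  exact mul_le_mul_of_nonneg_left (rot_norm q s) (pow_pos (sc_pos q) _).le

lemma rot_inv (q : Qg M N) (s : MatSpace M N) : rot q (rot q⁻¹ s) = s := by
  unfold rot
  rw [lB_inv, lC_inv, Matrix.transpose_transpose, ← Matrix.mul_assoc, ← Matrix.mul_assoc,
    lB_mul_tr, Matrix.one_mul, Matrix.mul_assoc, lC_mul_tr, Matrix.mul_one]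

/-- `act q` as a linear map -/
def actL (q : Qg M N) : MatSpace M N →ₗ[ℝ] MatSpace M N where
  toFun := act q
  map_add' := act_add q
  map_smul' := act_smul q

def rotL (q : Qg M N) : MatSpace M N →ₗ[ℝ] MatSpace M N where
  toFun := rot q
  map_add' := by intro x y; simp [rot, Matrix.mul_add, Matrix.add_mul]
  map_smul' := by intro c x; simp [rot]

lemma act_inv_act (q : Qg M N) (s : MatSpace M N) : act q⁻¹ (act q s) = s := by
  rw [← act_mul, inv_mul_cancel, act_one]

lemma continuous_rot : Continuous (fun p : Qg M N × MatSpace M N => rot p.1 p.2) := by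
  unfold rot
  have h2 := continuous_lB (M := M) (N := N)
  have h3 := continuous_lC (M := M) (N := N)
  fun_prop

/-- building an element of unit scale -/
def mkq (B : Matrix.orthogonalGroup (Fin M) ℝ) (C : Matrix.orthogonalGroup (Fin N) ℝ) : Qg M N :=
  (⟨1, one_pos⟩, B, C)
lemma lB_mkq (B : Matrix.orthogonalGroup (Fin M) ℝ) (C : Matrix.orthogonalGroup (Fin N) ℝ) :
    lB (mkq B C) = B.1 := rfl
lemma lC_mkq (B : Matrix.orthogonalGroup (Fin M) ℝ) (C : Matrix.orthogonalGroup (Fin N) ℝ) :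
    lC (mkq B C) = C.1 := rfl

lemma lim_lBC (u : ℕ → Qg M N) : ∃ q : Qg M N, 
    Tendsto (fun n => lB (u n)) UU (𝓝 (lB q)) ∧ Tendsto (fun n => lC (u n)) UU (𝓝 (lC q)) := by
  obtain ⟨B, -, hB⟩ := ulim (isCompact_univ (X := Matrix.orthogonalGroup (Fin M) ℝ))
    (fun n => (u n).2.1) (fun _ => Set.mem_univ _)
  obtain ⟨C, -, hC⟩ := ulim (isCompact_univ (X := Matrix.orthogonalGroup (Fin N) ℝ))
    (fun n => (u n).2.2) (fun _ => Set.mem_univ _)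
  refine ⟨mkq B C, ?_, ?_⟩
  · rw [lB_mkq]; exact (continuous_subtype_val.tendsto B).comp hB
  · rw [lC_mkq]; exact (continuous_subtype_val.tendsto C).comp hC

lemma mm_lim {T : Type*} {l : Filter T} {m n k : Type*} [Fintype n] [Fintype m] [Fintype k] {a : T → Matrix m n ℝ} {s : T → Matrix n k ℝ} {a0 s0} (h1 : Tendsto a l (𝓝 a0)) (hs : Tendsto s l (𝓝 s0)) : Tendsto (fun n => a n * s n) l (𝓝 (a0 * s0)) := by
  have h := ((Continuous.matrix_mul continuous_fst continuous_snd : Continuous (fun p : Matrix m n ℝ × Matrix n k ℝ => p.1 * p.2)).tendsto (a0, s0))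
  exact h.comp (h1.prodMk_nhds hs)
lemma tr_lim {T : Type*} {l : Filter T} {m n : Type*} [Fintype n] [Fintype m]  {a : T → Matrix m n ℝ}  {a0 } (h1 : Tendsto a l (𝓝 a0)) : Tendsto (fun n => (a n)ᵀ) l (𝓝 (a0ᵀ)) := by
  exact ((continuous_id.matrix_transpose : Continuous (fun p : Matrix m n ℝ => pᵀ)).tendsto a0).comp h1
lemma rot_lim (u : ℕ → Qg M N) : ∃ q : Qg M N, ∀ (s : ℕ → MatSpace M N) (s0 : MatSpace M N),
    Tendsto s UU (𝓝 s0) → Tendsto (fun n => rot (u n) (s n)) UU (𝓝 (rot q s0)) := by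
  obtain ⟨q, h1, h2⟩ := lim_lBC u
  exact ⟨q, fun s s0 hs => mm_lim (mm_lim h1 hs) (tr_lim h2)⟩
end rot

namespace Sys
variable {M N : ℕ} {E : Type*} (S : Sys M N E)

/-- `pi` is the coding map and the system is irreducible -/
structure IsCod (pi : (ℕ → E) → MatSpace M N) : Prop where
  lim : ∀ c x, Tendsto (fun n => S.ph (pf c n) x) atTop (𝓝 (pi c))
  irr : ∀ L : AffineSubspace ℝ (MatSpace M N), (L : Set (MatSpace M N)).Nonempty →
    (∀ e, S.ph [e] '' (L : Set (MatSpace M N)) = L) → L = ⊤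

lemma xw_bound [Finite E] : ∃ X : ℝ, 0 < X ∧ ∀ w, ‖S.xw w‖ ≤ X := by
  obtain ⟨Δ, hΔ⟩ := (Set.finite_range (fun e => ‖S.δ e‖)).bddAbove
  have hΔ' : ∀ e, ‖S.δ e‖ ≤ |Δ| := fun e => (hΔ ⟨e, rfl⟩).trans (le_abs_self _)
  have h1 : ∀ w, ‖S.xw w‖ ≤ kap M N * |Δ| * ∑ k ∈ Finset.range w.length, S.hi ^ k := by
    intro w
    induction w using List.reverseRecOn with
    | nil => simp [xw_nil]
    | append_singleton w e ih =>
      rw [xw_append, List.length_append, List.length_singleton, Finset.sum_range_succ, mul_add]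
      have h2 : ‖act (S.tw w) (S.xw [e])‖ ≤ kap M N * |Δ| * S.hi ^ w.length := by
        refine (act_norm _ _).trans ?_
        have h3 : sc (S.tw w) ^ (M + N) ≤ S.hi ^ w.length := by
          have h4 := S.sc_tw_le w
          have h5 : sc (S.tw w) ≤ 1 := h4.trans (pow_le_one₀ S.hi_pos.le S.hi_lt.le)
          have hM := S.hM
          exact (pow_le_of_le_one (sc_pos _).le h5 (by omega)).trans h4
        have h6 : ‖S.xw [e]‖ ≤ |Δ| := by simpa [xw, act_zero] using hΔ' e
        have := kap_pos (M := M) (N := N)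
        have h7 := (sc_pos (S.tw w))
        have h8 := S.hi_pos
        calc _ ≤ S.hi ^ w.length * (kap M N * |Δ|) := by gcongr
          _ = _ := by ring
      calc _ ≤ _ := norm_add_le _ _
        _ ≤ _ := by linarith
  refine ⟨kap M N * |Δ| * (1 - S.hi)⁻¹ + 1, ?_, fun w => ?_⟩
  · have := kap_pos (M := M) (N := N)
    have := S.hi_lt
    have : 0 < 1 - S.hi := by linarith
    positivity
  · refine (h1 w).trans ?_
    have : ∑ k ∈ Finset.range w.length, S.hi ^ k ≤ (1 - S.hi)⁻¹ := by
      rw [← tsum_geometric_of_lt_one S.hi_pos.le S.hi_lt]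
      exact (summable_geometric_of_lt_one S.hi_pos.le S.hi_lt).sum_le_tsum _
        (fun i _ => (pow_pos S.hi_pos i).le)
    have h9 := kap_pos (M := M) (N := N)
    have := mul_le_mul_of_nonneg_left this (show 0 ≤ kap M N * |Δ| by positivity)
    linarith

variable {S} {pi : (ℕ → E) → MatSpace M N}

lemma pf_add (c : ℕ → E) (n k : ℕ) : pf c (n + k) = pf c n ++ pf (bsh c n) k := by
  induction k with
  | zero => simp [pf]
  | succ k ih =>
    rw [← add_assoc, pf, ih, pf, List.append_assoc]; simp only [bsh]; rw [add_comm n k]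

lemma continuous_ph (w : List E) : Continuous (S.ph w) := by
  unfold ph
  exact (continuous_act.comp (Continuous.prodMk continuous_const continuous_id)).add
    continuous_const

namespace IsCod

lemma shift (h : S.IsCod pi) (c : ℕ → E) (n : ℕ) : pi c = S.ph (pf c n) (pi (bsh c n)) := by
  have h1 := h.lim c 0
  have h2 : Tendsto (fun k => S.ph (pf c (n + k)) 0) atTop (𝓝 (pi c)) := by
    have := h1.comp (tendsto_add_atTop_nat n)
    refine this.congr fun k => ?_
    simp only [Function.comp]; rw [add_comm]
  have h3 : Tendsto (fun k => S.ph (pf c n) (S.ph (pf (bsh c n) k) 0)) atTop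
      (𝓝 (S.ph (pf c n) (pi (bsh c n)))) :=
    ((continuous_ph (pf c n)).tendsto _).comp (h.lim _ 0)
  refine tendsto_nhds_unique h2 (h3.congr fun k => ?_)
  rw [← ph_append, ← pf_add]

lemma mem_cons (h : S.IsCod pi) (e : E) (c : ℕ → E) : S.ph [e] (pi c) = pi (pcons e c) := by
  rw [h.shift (pcons e c) 1]; rfl

lemma mem_word (h : S.IsCod pi) (w : List E) (c : ℕ → E) : ∃ d, S.ph w (pi c) = pi d := by
  induction w with
  | nil => exact ⟨c, by simp [ph, tw_nil, xw_nil, act_one]⟩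
  | cons e w ih =>
    obtain ⟨d, hd⟩ := ih
    refine ⟨pcons e d, ?_⟩
    rw [← h.mem_cons, ← hd, ← ph_append]; rfl

lemma bdd [Finite E] (h : S.IsCod pi) : ∃ X : ℝ, 0 < X ∧ (∀ w, ‖S.xw w‖ ≤ X) ∧
    ∀ c, ‖pi c‖ ≤ X := by
  obtain ⟨X, hX, hw⟩ := S.xw_bound
  refine ⟨X, hX, hw, fun c => ?_⟩
  refine le_of_tendsto (h.lim c 0).norm (Eventually.of_forall fun n => ?_)
  simpa [ph, act_zero] using hw (pf c n)

lemma aff_const [Nonempty E] (h : S.IsCod pi) (l : MatSpace M N →ₗ[ℝ] ℝ) (a : ℝ)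
    (hl : ∀ c, l (pi c) = a) : l = 0 := by
  let L := affineSpan ℝ (Set.range pi)
  let c0 : ℕ → E := fun _ => Classical.arbitrary E
  have hne : (L : Set (MatSpace M N)).Nonempty := ⟨pi c0, subset_affineSpan ℝ _ ⟨c0, rfl⟩⟩
  have htop : L = ⊤ := by
    refine h.irr L hne fun e => ?_
    let g : MatSpace M N →ᵃ[ℝ] MatSpace M N :=
      { toFun := S.ph [e], linear := actL (S.tw [e]),
        map_vadd' := by
          intro p v; simp only [vadd_eq_add, ph, act_add]; change _ = act _ v + _; abel }
    have hle : L.map g ≤ L := by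
      rw [AffineSubspace.map_span]
      apply affineSpan_mono
      rintro _ ⟨_, ⟨c, rfl⟩, rfl⟩
      exact ⟨pcons e c, (h.mem_cons e c).symm⟩
    have hinj : Function.Injective (actL (S.tw [e])) := by
      intro x y hxy
      have : act (S.tw [e]) x = act (S.tw [e]) y := hxy
      rw [← act_inv_act (S.tw [e]) x, this, act_inv_act]
    have hdir : (L.map g).direction = L.direction := by
      refine Submodule.eq_of_le_of_finrank_eq (AffineSubspace.direction_le hle) ?_
      rw [AffineSubspace.map_direction]
      exact (Submodule.equivMapOfInjective g.linear hinj L.direction).finrank_eq.symm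
    have := AffineSubspace.eq_of_direction_eq_of_nonempty_of_le hdir
      (by obtain ⟨x, hx⟩ := hne; exact ⟨g x, AffineSubspace.mem_map_of_mem g hx⟩) hle
    calc S.ph [e] '' (L : Set (MatSpace M N)) = (L.map g : Set (MatSpace M N)) := by
          rw [AffineSubspace.coe_map]; rfl
      _ = L := by rw [this]
  have hall : ∀ x, l x = a := by
    intro x
    have hx : x ∈ affineSpan ℝ (Set.range pi) := by
      change x ∈ L; rw [htop]; exact AffineSubspace.mem_top ℝ _ x
    have h2 : affineSpan ℝ (Set.range pi) ≤
        (AffineSubspace.comap l.toAffineMap (affineSpan ℝ {a})) := by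
      rw [affineSpan_le]
      rintro _ ⟨c, rfl⟩
      simp only [SetLike.mem_coe, AffineSubspace.mem_comap, LinearMap.coe_toAffineMap, hl]
      exact subset_affineSpan ℝ _ rfl
    have h3 := h2 hx
    simpa [AffineSubspace.mem_comap, AffineSubspace.mem_affineSpan_singleton] using h3
  have h0 : a = 0 := by rw [← hall 0, map_zero]
  ext1 x; rw [hall x, h0]; rfl

lemma quad [Finite E] [Nonempty E] (h : S.IsCod pi) (f l : MatSpace M N →ₗ[ℝ] ℝ)
    (Cm : Matrix (Fin N) (Fin M) ℝ) (a : ℝ)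
    (hq : ∀ c, a + f (pi c) - l (pi c * Cm * pi c) = 0) :
    f = 0 ∧ ∀ x y : MatSpace M N, l (x * Cm * y + y * Cm * x) = 0 := by
  obtain ⟨X, hX0, -, hX⟩ := h.bdd
  have hlc : Continuous l := l.continuous_of_finiteDimensional
  have hfc : Continuous f := f.continuous_of_finiteDimensional
  have key : ∀ c z, f z - l (pi c * Cm * z + z * Cm * pi c) = 0 := by
    intro c
    let G : MatSpace M N →ₗ[ℝ] ℝ :=
      { toFun := fun z => f z - l (pi c * Cm * z + z * Cm * pi c)
        map_add' := by
          intro x y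
          simp only [map_add, Matrix.mul_add, Matrix.add_mul]; ring
        map_smul' := by
          intro r x
          simp only [map_add, map_smul, Matrix.mul_smul, Matrix.smul_mul, smul_eq_mul,
            RingHom.id_apply]; ring }
    have hGc : Continuous G := G.continuous_of_finiteDimensional
    -- step identity
    have hstep : ∀ d n, G (rot (S.tw (pf c n)) (pi d - pi (bsh c n))) =
        (sc (S.tw (pf c n))) ^ (M + N) *
          l (rot (S.tw (pf c n)) (pi d - pi (bsh c n)) * Cm *
            rot (S.tw (pf c n)) (pi d - pi (bsh c n))) := by
      intro d n
      obtain ⟨d', hd'⟩ := h.mem_word (pf c n) d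
      have h1 := hq c
      have h2 := hq d'
      set lam := (sc (S.tw (pf c n))) ^ (M + N) with hlam
      have hlam0 : lam ≠ 0 := (pow_pos (sc_pos _) _).ne'
      set z := rot (S.tw (pf c n)) (pi d - pi (bsh c n)) with hz
      have h3 : pi d' = pi c + lam • z := by
        rw [← hd', h.shift c n]
        simp only [ph]
        rw [hz, hlam, ← act_eq, act_sub]; abel
      rw [h3] at h2
      simp only [map_add, map_smul, Matrix.mul_add, Matrix.add_mul, Matrix.mul_smul,
        Matrix.smul_mul, smul_eq_mul] at h2
      have h4 : lam * (G z - lam * l (z * Cm * z)) = 0 := by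
        simp only [G, LinearMap.coe_mk, AddHom.coe_mk, map_add]
        linarith
      rcases mul_eq_zero.1 h4 with h5 | h5
      · exact absurd h5 hlam0
      · linarith
    obtain ⟨x0, -, hx0⟩ := ulim_ball (fun n => pi (bsh c n)) X (fun n => hX _)
    obtain ⟨q, hq1⟩ := rot_lim (fun n => S.tw (pf c n))
    have hrot : ∀ d, Tendsto (fun n => rot (S.tw (pf c n)) (pi d - pi (bsh c n))) UU
        (𝓝 (rot q (pi d - x0))) := fun d => hq1 _ _ (tendsto_const_nhds.sub hx0)
    have hlam : Tendsto (fun n => (sc (S.tw (pf c n))) ^ (M + N)) UU (𝓝 0) := by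
      have h1 : Tendsto (fun n => sc (S.tw (pf c n))) atTop (𝓝 0) := by
        refine squeeze_zero (fun n => (sc_pos _).le) (fun n => ?_) S.hi_pow_tendsto
        have := S.sc_tw_le (pf c n); rwa [pf_length] at this
      have h2 := h1.pow (M + N)
      rw [zero_pow (by have := S.hM; omega)] at h2
      exact h2.mono_left UU_le
    have hG0 : ∀ d, G (rot q (pi d - x0)) = 0 := by
      intro d
      have h1 := (hGc.tendsto _).comp (hrot d)
      have hcont : Continuous (fun z : MatSpace M N => l (z * Cm * z)) :=
        hlc.comp (by fun_prop)
      have h2 := hlam.mul ((hcont.tendsto _).comp (hrot d))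
      rw [zero_mul] at h2
      refine tendsto_nhds_unique h1 (h2.congr fun n => ?_)
      exact (hstep d n).symm
    have hGr : G ∘ₗ rotL q = 0 := by
      refine h.aff_const _ (G (rot q x0)) fun d => ?_
      have h1 := hG0 d
      have h2 : rot q (pi d - x0) = rot q (pi d) - rot q x0 := (rotL q).map_sub _ _
      rw [h2, map_sub] at h1
      exact sub_eq_zero.1 h1
    intro z
    have := LinearMap.congr_fun hGr (rot q⁻¹ z)
    have h2 : G (rot q (rot q⁻¹ z)) = 0 := this
    rw [rot_inv] at h2
    exact h2
  have hsym : ∀ x z : MatSpace M N, l (x * Cm * z + z * Cm * x) = 0 := by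
    intro x z
    let H : MatSpace M N →ₗ[ℝ] ℝ :=
      { toFun := fun x => l (x * Cm * z + z * Cm * x)
        map_add' := by
          intro x y
          simp only [map_add, Matrix.mul_add, Matrix.add_mul]; ring
        map_smul' := by
          intro r x
          simp only [map_add, map_smul, Matrix.mul_smul, Matrix.smul_mul, smul_eq_mul,
            RingHom.id_apply]; ring }
    have : H = 0 := h.aff_const H (f z) fun c => by
      have := key c z
      simp only [H, LinearMap.coe_mk, AddHom.coe_mk]; linarith
    exact LinearMap.congr_fun this x
  refine ⟨?_, hsym⟩
  ext1 z
  have h1 := key (fun _ => Classical.arbitrary E) z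
  rw [hsym] at h1
  simpa using h1

end IsCod

/-- a functional that kills all symmetrised products vanishes -/
lemma sym_zero (l : MatSpace M N →ₗ[ℝ] ℝ) (Cm : Matrix (Fin N) (Fin M) ℝ) (hC : Cm ≠ 0)
    (h : ∀ x y : MatSpace M N, l (x * Cm * y + y * Cm * x) = 0) : l = 0 := by
  have hx : ∃ k k', Cm k k' ≠ 0 := by
    by_contra hcon; push Not at hcon; exact hC (by ext i j; simpa using hcon i j)
  obtain ⟨k, m, hkm⟩ := hx
  have hs : ∀ i j, l (Matrix.single i j (1:ℝ)) = 0 := by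
    intro i j
    by_cases hji : Cm j i = 0
    · have h1 := h (Matrix.single i k (1:ℝ)) (Matrix.single m j (1:ℝ))
      have e1 : Matrix.single i k (1:ℝ) * Cm * Matrix.single m j (1:ℝ) = Cm k m • Matrix.single i j (1:ℝ) := by
        rw [Matrix.single_mul_mul_single]; simp
      have e2 : Matrix.single m j (1:ℝ) * Cm * Matrix.single i k (1:ℝ) = 0 := by
        rw [Matrix.single_mul_mul_single]; simp [hji]
      rw [e1, e2, add_zero, map_smul, smul_eq_mul] at h1
      exact (mul_eq_zero.1 h1).resolve_left hkm
    · have h1 := h (Matrix.single i j (1:ℝ)) (Matrix.single i j (1:ℝ))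
      have e1 : Matrix.single i j (1:ℝ) * Cm * Matrix.single i j (1:ℝ) = Cm j i • Matrix.single i j (1:ℝ) := by
        rw [Matrix.single_mul_mul_single]; simp
      rw [e1, map_add, map_smul, smul_eq_mul] at h1
      have : Cm j i * l (Matrix.single i j (1:ℝ)) = 0 := by linarith
      exact (mul_eq_zero.1 this).resolve_left hji
  have hall : ∀ x, l x = 0 := by
    intro x
    rw [Matrix.matrix_eq_sum_single x, map_sum]
    refine Finset.sum_eq_zero fun i _ => ?_
    rw [map_sum]
    refine Finset.sum_eq_zero fun j _ => ?_
    have : Matrix.single i j (x i j) = x i j • Matrix.single i j (1:ℝ) := by simp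
    rw [this, map_smul, hs, smul_zero]
  exact LinearMap.ext hall

/-- the quadratic polynomial of a matrix in block form -/
def PP (v : Big M N) (x : MatSpace M N) : MatSpace M N :=
  v.toBlocks₁₂ + v.toBlocks₁₁ * x - x * v.toBlocks₂₂ - x * v.toBlocks₂₁ * x

lemma poly_span [Finite E] [Nonempty E] (h : S.IsCod pi) (W : Submodule ℝ (MatSpace M N)) (v : Big M N)
    (hW : ∀ c, PP v (pi c) ∈ W) :
    (v.toBlocks₂₁ ≠ 0 → W = ⊤) ∧
      (v.toBlocks₂₁ = 0 → ∀ x : MatSpace M N, v.toBlocks₁₁ * x - x * v.toBlocks₂₂ ∈ W) := by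
  have key : ∀ l : MatSpace M N →ₗ[ℝ] ℝ, W ≤ LinearMap.ker l →
      (∀ x : MatSpace M N, l (v.toBlocks₁₁ * x - x * v.toBlocks₂₂) = 0) ∧
      ∀ x y : MatSpace M N, l (x * v.toBlocks₂₁ * y + y * v.toBlocks₂₁ * x) = 0 := by
    intro l hl
    let f : MatSpace M N →ₗ[ℝ] ℝ :=
      { toFun := fun x => l (v.toBlocks₁₁ * x - x * v.toBlocks₂₂)
        map_add' := by
          intro x y
          simp only [map_sub, map_add, Matrix.mul_add, Matrix.add_mul]; ring
        map_smul' := by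
          intro r x
          simp only [map_sub, map_smul, Matrix.mul_smul, Matrix.smul_mul, smul_eq_mul,
            RingHom.id_apply]; ring }
    have := h.quad f l v.toBlocks₂₁ (l v.toBlocks₁₂) (fun c => by
      have h1 : l (PP v (pi c)) = 0 := hl (hW c)
      simp only [PP, map_sub, map_add] at h1
      simp only [f, LinearMap.coe_mk, AddHom.coe_mk, map_sub]
      linarith)
    exact ⟨fun x => LinearMap.congr_fun this.1 x, this.2⟩
  constructor
  · intro hC
    by_contra hne
    obtain ⟨l, hl0, hl⟩ := Submodule.exists_le_ker_of_lt_top _ (lt_top_iff_ne_top.2 hne)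
    exact hl0 (sym_zero l _ hC (key l hl).2)
  · intro _ x
    by_contra hne
    obtain ⟨l, hl0, hl⟩ := Submodule.exists_le_ker_of_notMem hne
    exact hl0 ((key l hl).1 x)

end Sys

end part7


section part8

/-! ## Norm helpers and discreteness -/

section helpers
variable {ι : Type*} [Fintype ι] [DecidableEq ι]

lemma inv_bd (R : ℝ) : ∃ C : ℝ, 0 < C ∧ ∀ y : Matrix ι ι ℝ, ‖y‖ ≤ R → |y.det| = 1 →
    ∃ yi : Matrix ι ι ℝ, y * yi = 1 ∧ yi * y = 1 ∧ ‖yi‖ ≤ C := by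
  have hc : Continuous (fun A : Matrix ι ι ℝ => ‖A.adjugate‖) :=
    (Continuous.matrix_adjugate continuous_id).norm
  obtain ⟨C, hC0, hC⟩ := bound_on_ball hc R
  refine ⟨C + 1, by linarith, fun y hy hd => ?_⟩
  have hu : y.det ≠ 0 := by intro h; rw [h] at hd; simp at hd
  have h1 : y * (y.det⁻¹ • y.adjugate) = 1 := by
    rw [Matrix.mul_smul, Matrix.mul_adjugate, smul_smul, inv_mul_cancel₀ hu, one_smul]
  refine ⟨y.det⁻¹ • y.adjugate, h1, mul_eq_one_comm.1 h1, ?_⟩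
  have := hC y hy
  rw [norm_smul, norm_inv, Real.norm_eq_abs, hd, inv_one, one_mul]
  rw [abs_of_nonneg (norm_nonneg _)] at this
  linarith

lemma int_small (g : Matrix ι ι ℤ) (h : ‖zm g - 1‖ < 1) : zm g = 1 := by
  rw [← zm_one] at h ⊢
  ext i j
  have h1 := (Matrix.norm_entry_le_entrywise_sup_norm (zm g - zm 1) (i := i) (j := j)).trans_lt h
  simp only [zm, Matrix.sub_apply, Matrix.map_apply] at h1 ⊢
  rw [Real.norm_eq_abs, ← Int.cast_sub, ← Int.cast_abs] at h1
  have h2 : |g i j - (1 : Matrix ι ι ℤ) i j| < 1 := by exact_mod_cast h1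
  have h3 := Int.abs_lt_one_iff.1 h2
  have : g i j = (1 : Matrix ι ι ℤ) i j := by omega
  rw [this]

lemma zm_closed {T : Type*} {l : Filter T} [NeBot l] (g : T → Matrix ι ι ℤ) (A : Matrix ι ι ℝ)
    (h : Tendsto (fun i => zm (g i)) l (𝓝 A)) : ∃ g0 : Matrix ι ι ℤ, A = zm g0 := by
  have h1 : ∀ i j, ∃ z : ℤ, (z : ℝ) = A i j := by
    intro i j
    have h2 : Tendsto (fun k => ((g k i j : ℤ) : ℝ)) l (𝓝 (A i j)) :=
      ((Continuous.matrix_elem continuous_id i j).tendsto A).comp h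
    have h3 : IsClosed (Set.range ((↑) : ℤ → ℝ)) := Int.isClosedEmbedding_coe_real.isClosed_range
    exact h3.mem_of_tendsto h2 (Eventually.of_forall fun k => ⟨_, rfl⟩)
  choose g0 hg0 using h1
  exact ⟨g0, by ext i j; exact (hg0 i j).symm⟩

lemma pigeon {V : Type*} [NormedAddCommGroup V] [ProperSpace V] (R d : ℝ) (hd : 0 < d) :
    ∃ J : ℕ, ∀ f : Fin J → V, (∀ j, ‖f j‖ ≤ R) → ∃ j j', j < j' ∧ ‖f j' - f j‖ < d := by
  obtain ⟨t, -, ht, hcov⟩ := (isCompact_closedBall (0 : V) R).totallyBounded.exists_subset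
    (Metric.dist_mem_uniformity (half_pos hd))
  refine ⟨ht.toFinset.card + 1, fun f hf => ?_⟩
  have h1 : ∀ j, ∃ c ∈ t, dist (f j) c < d / 2 := by
    intro j
    have := hcov (show f j ∈ closedBall (0 : V) R by simpa using hf j)
    simpa using this
  choose c hct hc using h1
  obtain ⟨j, -, j', -, hne, heq⟩ := Finset.exists_ne_map_eq_of_card_lt_of_maps_to
    (s := Finset.univ) (t := ht.toFinset) (by simp) (f := c) (by intro j _; simpa using hct j)
  have h2 : ∀ j j', c j = c j' → ‖f j' - f j‖ < d := by
    intro j j' h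
    rw [← dist_eq_norm]
    have := dist_triangle_right (f j') (f j) (c j)
    have h3 := hc j
    have h4 := hc j'
    rw [← h] at h4
    linarith
  rcases lt_or_gt_of_ne hne with h | h
  · exact ⟨j, j', h, h2 _ _ heq⟩
  · exact ⟨j', j, h, h2 _ _ heq.symm⟩

end helpers

section blocks
variable {M N : ℕ}

def kk (M N : ℕ) : ℝ := M + N + 1
lemma one_le_kk : 1 ≤ kk M N := by
  unfold kk; have : (0:ℝ) ≤ M + N := by positivity
  linarith
lemma kk_pos : 0 < kk M N := lt_of_lt_of_le one_pos one_le_kk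

lemma big_mul (A B : Big M N) : ‖A * B‖ ≤ kk M N * ‖A‖ * ‖B‖ := by
  refine (matmul_norm_le A B).trans ?_
  have : (Fintype.card (Ix M N) : ℝ) ≤ kk M N := by
    simp [kk]
  gcongr

lemma big_mul3 (A B C : Big M N) : ‖A * B * C‖ ≤ kk M N ^ 2 * (‖A‖ * ‖C‖) * ‖B‖ := by
  refine (big_mul _ _).trans ?_
  have := big_mul A B
  have h := kk_pos (M := M) (N := N)
  calc _ ≤ kk M N * (kk M N * ‖A‖ * ‖B‖) * ‖C‖ := by gcongr
    _ = _ := by ring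

lemma blocks_norm_le (A : Matrix (Fin M) (Fin M) ℝ) (B : MatSpace M N)
    (C : Matrix (Fin N) (Fin M) ℝ) (D : Matrix (Fin N) (Fin N) ℝ) :
    ‖Matrix.fromBlocks A B C D‖ ≤ ‖A‖ + ‖B‖ + ‖C‖ + ‖D‖ := by
  have h1 := norm_nonneg A
  have h2 := norm_nonneg B
  have h3 := norm_nonneg C
  have h4 := norm_nonneg D
  rw [Matrix.norm_le_iff (by positivity)]
  rintro (i | i) (j | j)
  · exact (Matrix.norm_entry_le_entrywise_sup_norm A).trans (by linarith)
  · exact (Matrix.norm_entry_le_entrywise_sup_norm B).trans (by linarith)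
  · exact (Matrix.norm_entry_le_entrywise_sup_norm C).trans (by linarith)
  · exact (Matrix.norm_entry_le_entrywise_sup_norm D).trans (by linarith)

lemma norm_b11 (v : Big M N) : ‖v.toBlocks₁₁‖ ≤ ‖v‖ := by
  rw [Matrix.norm_le_iff (norm_nonneg _)]; intro i j
  exact Matrix.norm_entry_le_entrywise_sup_norm v
lemma norm_b12 (v : Big M N) : ‖v.toBlocks₁₂‖ ≤ ‖v‖ := by
  rw [Matrix.norm_le_iff (norm_nonneg _)]; intro i j
  exact Matrix.norm_entry_le_entrywise_sup_norm v
lemma norm_b21 (v : Big M N) : ‖v.toBlocks₂₁‖ ≤ ‖v‖ := by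
  rw [Matrix.norm_le_iff (norm_nonneg _)]; intro i j
  exact Matrix.norm_entry_le_entrywise_sup_norm v
lemma norm_b22 (v : Big M N) : ‖v.toBlocks₂₂‖ ≤ ‖v‖ := by
  rw [Matrix.norm_le_iff (norm_nonneg _)]; intro i j
  exact Matrix.norm_entry_le_entrywise_sup_norm v

lemma norm_blocks (v : Big M N) :
    ‖v‖ ≤ ‖v.toBlocks₁₁‖ + ‖v.toBlocks₁₂‖ + ‖v.toBlocks₂₁‖ + ‖v.toBlocks₂₂‖ := by
  conv_lhs => rw [← Matrix.fromBlocks_toBlocks v]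
  exact blocks_norm_le _ _ _ _

lemma one_norm_le {n : ℕ} : ‖(1 : Matrix (Fin n) (Fin n) ℝ)‖ ≤ 1 := by
  rw [Matrix.norm_le_iff zero_le_one]; intro i j
  rw [Matrix.one_apply]; split_ifs <;> simp

lemma uu_norm (s : MatSpace M N) : ‖uu s‖ ≤ 2 + ‖s‖ := by
  unfold uu
  refine (blocks_norm_le _ _ _ _).trans ?_
  have h1 := one_norm_le (n := M)
  have h2 := one_norm_le (n := N)
  rw [norm_zero]; linarith


lemma conj_uu (v : Big M N) (x : MatSpace M N) : uu (-x) * v * uu x =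
    Matrix.fromBlocks (v.toBlocks₁₁ - x * v.toBlocks₂₁) (Sys.PP v x)
      v.toBlocks₂₁ (v.toBlocks₂₁ * x + v.toBlocks₂₂) := by
  conv_lhs => rw [← Matrix.fromBlocks_toBlocks v]
  simp only [uu, Sys.PP, Matrix.fromBlocks_multiply, Matrix.one_mul, Matrix.mul_one,
    Matrix.zero_mul, Matrix.mul_zero, zero_add, add_zero, Matrix.neg_mul, Matrix.add_mul,
    Matrix.mul_assoc]
  congr 1
  all_goals abel

/-- conjugation by the diagonal part, blockwise -/
lemma conj_dg (q : Qg M N) (A : Matrix (Fin M) (Fin M) ℝ) (B : MatSpace M N)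
    (C : Matrix (Fin N) (Fin M) ℝ) (D : Matrix (Fin N) (Fin N) ℝ) :
    dg q * Matrix.fromBlocks A B C D * dg q⁻¹ =
      Matrix.fromBlocks (lB q * A * (lB q)ᵀ) (act q B)
        (((sc q)⁻¹) ^ (M + N) • (lC q * C * (lB q)ᵀ)) (lC q * D * (lC q)ᵀ) := by
  have h := (sc_pos q).ne'
  simp only [dg, act, Matrix.fromBlocks_multiply, sc_inv, lB_inv, lC_inv, inv_inv,
    Matrix.zero_mul, Matrix.mul_zero, zero_add, add_zero, Matrix.smul_mul, Matrix.mul_smul,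
    smul_smul, pow_add, inv_pow]
  congr 1
  · rw [inv_mul_cancel₀ (pow_ne_zero _ h), one_smul]
  · rw [mul_comm]
  · rw [mul_inv_cancel₀ (pow_ne_zero _ h), one_smul]

end blocks

section orthconj
lemma orth_conj {n : ℕ} (B X : Matrix (Fin n) (Fin n) ℝ) (hB : B * Bᵀ = 1) (hn : ‖B‖ ≤ 1) :
    ‖B * X * Bᵀ - 1‖ ≤ (n : ℝ) ^ 2 * ‖X - 1‖ := by
  have e : B * X * Bᵀ - 1 = B * (X - 1) * Bᵀ := by
    rw [Matrix.mul_sub, Matrix.sub_mul, Matrix.mul_one, hB]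
  rw [e]
  have h1 := matmul_norm_le (B * (X - 1)) Bᵀ
  have h2 := matmul_norm_le B (X - 1)
  rw [Matrix.norm_transpose] at h1
  simp only [Fintype.card_fin] at h1 h2
  calc _ ≤ _ := h1
    _ ≤ n * (n * 1 * ‖X - 1‖) * 1 := by
      gcongr; exact h2.trans (by gcongr)
    _ = _ := by ring
end orthconj

namespace Sys
variable {M N : ℕ} {E : Type*} {S : Sys M N E} {ε : ℝ}

lemma fm_conj_norm (X0 : ℝ) (hX0 : 0 < X0) : ∃ C : ℝ, 0 < C ∧ ∀ (q t : Qg M N) (x X : MatSpace M N), ‖x‖ ≤ X0 →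
    sc t = 1 → ‖fm q x * fm t X * fmi q x - 1‖ ≤
      C * (‖lB t - 1‖ + ‖lC t - 1‖ + ‖act q X‖) := by
  have hk := one_le_kk (M := M) (N := N)
  refine ⟨kk M N ^ 2 * ((2 + X0) * (2 + X0)) * kk M N ^ 2, by positivity, fun q t x X hx ht => ?_⟩
  set T : Big M N := uu (act q X) * dg (q * t * q⁻¹) with hT
  have e1 : fm q x * fm t X * fmi q x - 1 = uu x * (T - 1) * uu (-x) := by
    rw [Matrix.mul_sub, Matrix.sub_mul, Matrix.mul_one, uu_mul, add_neg_cancel, uu_zero, hT]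
    congr 1
    unfold fm fmi
    rw [← dg_mul, ← dg_mul]
    have := dg_uu q X
    simp only [Matrix.mul_assoc]
    rw [← Matrix.mul_assoc (dg q) (uu X), this]
    simp only [Matrix.mul_assoc]
  have hsc : sc (q * t * q⁻¹) = 1 := by
    rw [sc_mul, sc_mul, sc_inv, ht, mul_one, mul_inv_cancel₀ (sc_pos q).ne']
  have e2 : T - 1 = Matrix.fromBlocks (lB (q * t * q⁻¹) - 1) (act q X * lC (q * t * q⁻¹)) 0
      (lC (q * t * q⁻¹) - 1) := by
    rw [hT, uu, dg, hsc, Matrix.fromBlocks_multiply, ← Matrix.fromBlocks_one, sub_eq_add_neg,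
      Matrix.fromBlocks_neg, Matrix.fromBlocks_add]
    simp [sub_eq_add_neg]
  have h1 : ‖lB (q * t * q⁻¹) - 1‖ ≤ (M : ℝ) ^ 2 * ‖lB t - 1‖ := by
    rw [lB_mul, lB_mul, lB_inv]; exact orth_conj _ _ (lB_mul_tr q) (lB_norm q)
  have h2 : ‖lC (q * t * q⁻¹) - 1‖ ≤ (N : ℝ) ^ 2 * ‖lC t - 1‖ := by
    rw [lC_mul, lC_mul, lC_inv]; exact orth_conj _ _ (lC_mul_tr q) (lC_norm q)
  have h3 : ‖act q X * lC (q * t * q⁻¹)‖ ≤ N * ‖act q X‖ := by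
    refine (matmul_norm_le _ _).trans ?_
    rw [Fintype.card_fin]
    have := lC_norm (q * t * q⁻¹)
    have h0 : (0:ℝ) ≤ N * ‖act q X‖ := by positivity
    nlinarith
  have hM : (M : ℝ) ^ 2 ≤ kk M N ^ 2 := by
    have : (M : ℝ) ≤ kk M N := by unfold kk; have : (0:ℝ) ≤ N := by positivity
                                  linarith
    gcongr
  have hN1 : (N : ℝ) ≤ kk M N := by
    unfold kk; have : (0:ℝ) ≤ M := by positivity
    linarith
  have hN : (N : ℝ) ^ 2 ≤ kk M N ^ 2 := by gcongr
  have hN2 : (N : ℝ) ≤ kk M N ^ 2 := by nlinarith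
  have h4 : ‖T - 1‖ ≤ kk M N ^ 2 * (‖lB t - 1‖ + ‖lC t - 1‖ + ‖act q X‖) := by
    rw [e2]
    refine (blocks_norm_le _ _ _ _).trans ?_
    rw [norm_zero]
    have h5 := mul_le_mul_of_nonneg_right hM (norm_nonneg (lB t - 1))
    have h6 := mul_le_mul_of_nonneg_right hN (norm_nonneg (lC t - 1))
    have h7 := mul_le_mul_of_nonneg_right hN2 (norm_nonneg (act q X))
    linarith
  rw [e1]
  refine (big_mul3 _ _ _).trans ?_
  have h8 : ‖uu x‖ ≤ 2 + X0 := (uu_norm x).trans (by linarith)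
  have h9 : ‖uu (-x)‖ ≤ 2 + X0 := (uu_norm _).trans (by rw [norm_neg]; linarith)
  calc _ ≤ kk M N ^ 2 * ((2 + X0) * (2 + X0)) *
        (kk M N ^ 2 * (‖lB t - 1‖ + ‖lC t - 1‖ + ‖act q X‖)) := by gcongr
    _ = _ := by ring

lemma sc_tw_pow_le (w : List E) : sc (S.tw w) ^ (M + N) ≤ S.hi ^ w.length := by
  have h4 := S.sc_tw_le w
  have h5 : sc (S.tw w) ≤ 1 := h4.trans (pow_le_one₀ S.hi_pos.le S.hi_lt.le)
  have hM := S.hM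
  exact (pow_le_of_le_one (sc_pos _).le h5 (by omega)).trans h4

/-- translations decay when going back -/
lemma act_bw_tendsto (b : ℕ → E) (X : MatSpace M N) :
    Tendsto (fun n => ‖act (S.tw (bw b n)) X‖) atTop (𝓝 0) := by
  have h1 : Tendsto (fun n => S.hi ^ n * (kap M N * ‖X‖)) atTop (𝓝 0) := by
    have := S.hi_pow_tendsto.mul_const (kap M N * ‖X‖)
    rwa [zero_mul] at this
  refine squeeze_zero (fun n => norm_nonneg _) (fun n => ?_) h1
  refine (act_norm _ _).trans ?_
  have h2 := S.sc_tw_pow_le (bw b n)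
  rw [bw_length] at h2
  have := kap_pos (M := M) (N := N)
  gcongr

lemma discrete0 [Finite E] (S : Sys M N E) (hε : 0 < ε) : ∃ d0 : ℝ, 0 < d0 ∧ ∀ (b : ℕ → E) (z : Big M N),
    S.Good ε b z → ∀ (t : Qg M N) (X : MatSpace M N), sc t = 1 → ‖lB t - 1‖ ≤ d0 →
    ‖lC t - 1‖ ≤ d0 → ∀ g : Matrix (Ix M N) (Ix M N) ℤ, fm t X * z = z * zm g → fm t X = 1 := by
  obtain ⟨X0, hX0, hX⟩ := S.xw_bound
  obtain ⟨R, hR, hm⟩ := mahler_bdd (ι := Ix M N) ε hε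
  obtain ⟨C, hC0, hC⟩ := inv_bd (ι := Ix M N) R
  obtain ⟨C', hC'0, hC'⟩ := fm_conj_norm (M := M) (N := N) X0 hX0
  have hk := kk_pos (M := M) (N := N)
  set Q := kk M N ^ 2 * (C * R) * C' with hQ
  have hQ0 : 0 < Q := by positivity
  refine ⟨1 / (4 * Q), by positivity, fun b z hz t X ht h1 h2 g hg => ?_⟩
  have h3 : ∀ᶠ n in atTop, ‖act (S.tw (bw b n)) X‖ < 1 / (4 * Q) :=
    (act_bw_tendsto b X).eventually (gt_mem_nhds (by positivity))
  obtain ⟨n, hn⟩ := h3.exists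
  have hz' := hz.back n
  obtain ⟨γ, hγ⟩ := hm _ hz'.1 hz'.xx
  set y := S.F (bw b n) * z * zm γ.1 with hy
  have hyd : |y.det| = 1 := (hz'.gamma γ).1
  obtain ⟨yi, hyi1, hyi2, hyi⟩ := hC y hγ hyd
  set rr := S.F (bw b n) * fm t X * S.Fi (bw b n) with hrr
  have h4 : rr * y = y * zm (γ⁻¹.1 * g * γ.1) := by
    have e1 : rr * y = S.F (bw b n) * (fm t X * ((S.Fi (bw b n) * S.F (bw b n)) * z)) * zm γ.1 := by
      rw [hrr, hy]; simp only [Matrix.mul_assoc]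
    rw [e1, Fi_F, Matrix.one_mul, hg, zm_mul, zm_mul]
    have e2 := zm_inv γ
    calc _ = S.F (bw b n) * z * 1 * zm g * zm γ.1 := by rw [Matrix.mul_one]; simp only [Matrix.mul_assoc]
      _ = _ := by rw [← e2, hy]; simp only [Matrix.mul_assoc]
  have h5 : zm (γ⁻¹.1 * g * γ.1) - 1 = yi * (rr - 1) * y := by
    rw [Matrix.mul_sub, Matrix.sub_mul, Matrix.mul_one, hyi2, Matrix.mul_assoc yi rr y, h4,
      ← Matrix.mul_assoc yi y, hyi2, Matrix.one_mul]
  have h6 : zm (γ⁻¹.1 * g * γ.1) = 1 := by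
    apply int_small
    rw [h5]
    refine (big_mul3 _ _ _).trans_lt ?_
    have h7 := hC' (S.tw (bw b n)) t (S.xw (bw b n)) X (hX _) ht
    have h8 : ‖rr - 1‖ < C' * (3 * (1 / (4 * Q))) := by
      refine lt_of_le_of_lt h7 ?_
      gcongr; linarith
    calc _ ≤ kk M N ^ 2 * (C * R) * ‖rr - 1‖ := by gcongr
      _ < kk M N ^ 2 * (C * R) * (C' * (3 * (1 / (4 * Q)))) := by gcongr
      _ = Q * (3 * (1 / (4 * Q))) := by rw [hQ]; ring
      _ = 3 / 4 := by field_simp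
      _ < 1 := by norm_num
  rw [h6, Matrix.mul_one] at h4
  have h9 : rr = 1 := by
    calc rr = rr * (y * yi) := by rw [hyi1, Matrix.mul_one]
      _ = 1 := by rw [← Matrix.mul_assoc, h4, hyi1]
  calc fm t X = (S.Fi (bw b n) * S.F (bw b n)) * fm t X * (S.Fi (bw b n) * S.F (bw b n)) := by
        rw [Fi_F, Matrix.one_mul, Matrix.mul_one]
    _ = S.Fi (bw b n) * rr * S.F (bw b n) := by rw [hrr]; simp only [Matrix.mul_assoc]
    _ = 1 := by rw [h9, Matrix.mul_one, Fi_F]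

lemma fmi_eq_fm (q : Qg M N) (x : MatSpace M N) : fmi q x = fm q⁻¹ (act q⁻¹ (-x)) := by
  rw [fmi, fm, dg_uu]

lemma discrete [Finite E] (S : Sys M N E) (hε : 0 < ε) : ∃ d0 : ℝ, 0 < d0 ∧ ∀ (b : ℕ → E) (z : Big M N),
    S.Good ε b z → ∀ (w w' : List E), sc (S.tw w) = sc (S.tw w') →
    ‖lB (S.tw w') - lB (S.tw w)‖ ≤ d0 → ‖lC (S.tw w') - lC (S.tw w)‖ ≤ d0 →
    ∀ g : Matrix (Ix M N) (Ix M N) ℤ, S.F w' * S.Fi w * z = z * zm g → S.F w' = S.F w := by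
  obtain ⟨d0, hd0, hd⟩ := discrete0 S hε
  have hk := kk_pos (M := M) (N := N)
  refine ⟨d0 / kk M N, by positivity, fun b z hz w w' hs h1 h2 g hg => ?_⟩
  have e1 : S.F w' * S.Fi w = fm (S.tw w' * (S.tw w)⁻¹)
      (act (S.tw w') (act (S.tw w)⁻¹ (-S.xw w)) + S.xw w') := by
    rw [F, Fi, fmi_eq_fm, fm_mul]
  rw [e1] at hg
  have aux : ∀ {n : ℕ} (A B : Matrix (Fin n) (Fin n) ℝ), B * Bᵀ = 1 → ‖B‖ ≤ 1 → (n : ℝ) ≤ kk M N →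
      ‖A - B‖ ≤ d0 / kk M N → ‖A * Bᵀ - 1‖ ≤ d0 := by
    intro n A B hB hn hnk hAB
    have : A * Bᵀ - 1 = (A - B) * Bᵀ := by rw [Matrix.sub_mul, hB]
    rw [this]
    refine (matmul_norm_le _ _).trans ?_
    rw [Matrix.norm_transpose, Fintype.card_fin]
    calc (n : ℝ) * ‖A - B‖ * ‖B‖ ≤ kk M N * (d0 / kk M N) * 1 := by gcongr
      _ = d0 := by field_simp
  have := hd b z hz _ _ (by rw [sc_mul, sc_inv, ← hs, mul_inv_cancel₀ (sc_pos _).ne'])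
    (by rw [lB_mul, lB_inv]
        exact aux _ _ (lB_mul_tr _) (lB_norm _) (by unfold kk; linarith [(Nat.cast_nonneg N : (0:ℝ) ≤ N)]) h1)
    (by rw [lC_mul, lC_inv]
        exact aux _ _ (lC_mul_tr _) (lC_norm _) (by unfold kk; linarith [(Nat.cast_nonneg M : (0:ℝ) ≤ M)]) h2) g hg
  rw [← e1] at this
  calc S.F w' = S.F w' * (S.Fi w * S.F w) := by rw [Fi_F, Matrix.mul_one]
    _ = S.F w := by rw [← Matrix.mul_assoc, this, Matrix.one_mul]

end Sys

end part8


section part9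

/-! ## Pairs of nearby states -/

namespace Sys
variable {M N : ℕ} {E : Type*} {S : Sys M N E} {ε : ℝ} {pi : (ℕ → E) → MatSpace M N}

lemma ph_of_F {w w' : List E} (h : S.F w = S.F w') (x : MatSpace M N) : S.ph w x = S.ph w' x := by
  have h1 : uu (S.ph w x) * dg (S.tw w) = uu (S.ph w' x) * dg (S.tw w') := by
    rw [← F_uu, ← F_uu, h]
  simp only [uu, dg, Matrix.fromBlocks_multiply, Matrix.fromBlocks_inj, Matrix.zero_mul,
    Matrix.one_mul, Matrix.mul_zero, zero_add, add_zero] at h1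
  obtain ⟨-, h2, -, h3⟩ := h1
  rw [← h3] at h2
  have hs := (sc_pos (S.tw w)).ne'
  have h4 : ((sc (S.tw w))⁻¹ ^ M • lC (S.tw w)) * ((sc (S.tw w)) ^ M • (lC (S.tw w))ᵀ) = 1 := by
    rw [Matrix.smul_mul, Matrix.mul_smul, smul_smul, lC_mul_tr, ← mul_pow, inv_mul_cancel₀ hs,
      one_pow, one_smul]
  have h5 := congrArg (· * ((sc (S.tw w)) ^ M • (lC (S.tw w))ᵀ)) h2
  simp only [Matrix.mul_assoc, h4, Matrix.mul_one] at h5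
  exact h5

namespace IsCod

lemma exists_letters [Nonempty E] (h : S.IsCod pi) :
    ∃ a e : E, S.ph [e] (pi fun _ => a) ≠ pi fun _ => a := by
  by_contra hcon
  push Not at hcon
  let a : E := Classical.arbitrary E
  have h1 : ∀ c, pi c = pi fun _ => a := by
    intro c
    have h2 : ∀ n, S.ph (pf c n) (pi fun _ => a) = pi fun _ => a := by
      intro n
      induction n with
      | zero => simp [pf, ph, tw_nil, xw_nil, act_one]
      | succ n ih => rw [pf, ph_append, hcon, ih]
    have h3 := h.lim c (pi fun _ => a)
    simp only [h2] at h3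
    exact tendsto_nhds_unique h3 tendsto_const_nhds
  have hM := S.hM
  have hN := S.hN
  let l : MatSpace M N →ₗ[ℝ] ℝ := Matrix.entryLinearMap ℝ ℝ ⟨0, hM⟩ ⟨0, hN⟩
  have h4 := h.aff_const l (l (pi fun _ => a)) (fun c => by rw [h1 c])
  have h5 : l (fun _ _ => 1) = 0 := by rw [h4]; rfl
  have h6 : l (fun _ _ => 1) = 1 := rfl
  rw [h6] at h5
  exact one_ne_zero h5

lemma pf_const (a : E) (n : ℕ) : pf (fun _ => a) n = List.replicate n a := by
  induction n with
  | zero => rfl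
  | succ n ih => rw [pf, ih, List.replicate_succ']

lemma fix (h : S.IsCod pi) (a : E) (k : ℕ) :
    S.ph (List.replicate k a) (pi fun _ => a) = pi fun _ => a := by
  have := h.shift (fun _ => a) k
  rw [pf_const] at this
  exact this.symm

lemma fix_unique (h : S.IsCod pi) (a : E) (k : ℕ) (hk : 0 < k) (z : MatSpace M N)
    (hz : S.ph (List.replicate k a) z = z) : z = pi fun _ => a := by
  have h1 : ∀ n, S.ph (List.replicate (k * n) a) z = z := by
    intro n
    induction n with
    | zero => simp [ph, tw_nil, xw_nil, act_one]
    | succ n ih => rw [mul_add, mul_one, List.replicate_add, ph_append, hz, ih]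
  have h2 := h.lim (fun _ => a) z
  have h3 : Tendsto (fun n => S.ph (pf (fun _ => a) (k * n)) z) atTop (𝓝 (pi fun _ => a)) :=
    h2.comp (tendsto_id.const_mul_atTop' hk)
  simp only [pf_const, h1] at h3
  exact tendsto_nhds_unique tendsto_const_nhds h3

end IsCod

/-- the test words -/
def wj (a e : E) (J j : ℕ) : List E := List.replicate j a ++ [e] ++ List.replicate (J - j) a

lemma wj_ne (h : S.IsCod pi) {a e : E} (hae : S.ph [e] (pi fun _ => a) ≠ pi fun _ => a)
    {J j j' : ℕ} (h1 : j < j') (h2 : j' < J) : S.F (wj a e J j') ≠ S.F (wj a e J j) := by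
  intro heq
  obtain ⟨k, rfl⟩ := Nat.exists_eq_add_of_lt h1
  have e1 : List.replicate (J - j) a = List.replicate (k + 1) a ++
      List.replicate (J - (j + k + 1)) a := by
    rw [← List.replicate_add]; congr 1; omega
  have e2 : List.replicate (j + k + 1) a = List.replicate j a ++ List.replicate (k + 1) a := by
    rw [← List.replicate_add]; rfl
  unfold wj at heq
  rw [e1, e2] at heq
  have e3 : S.F (List.replicate (k + 1) a ++ [e]) = S.F ([e] ++ List.replicate (k + 1) a) := by
    have h3 : S.Fi (List.replicate j a) * (S.F (List.replicate j a ++ List.replicate (k + 1) a ++ [e] ++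
        List.replicate (J - (j + k + 1)) a)) * S.Fi (List.replicate (J - (j + k + 1)) a) =
        S.F (List.replicate (k + 1) a ++ [e]) := by
      simp only [F_append, Matrix.mul_assoc, F_Fi, Matrix.mul_one]
      rw [← Matrix.mul_assoc, Fi_F, Matrix.one_mul]
    have h4 : S.Fi (List.replicate j a) * (S.F (List.replicate j a ++ [e] ++ (List.replicate (k + 1) a ++
        List.replicate (J - (j + k + 1)) a))) * S.Fi (List.replicate (J - (j + k + 1)) a) =
        S.F ([e] ++ List.replicate (k + 1) a) := by
      simp only [F_append, Matrix.mul_assoc, F_Fi, Matrix.mul_one]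
      rw [← Matrix.mul_assoc, Fi_F, Matrix.one_mul]
    rw [← h3, heq, h4]
  have e4 := ph_of_F e3 (pi fun _ => a)
  rw [ph_append, ph_append, h.fix] at e4
  exact hae (h.fix_unique a (k + 1) (by omega) _ e4)

lemma sc_rep (a : E) (k : ℕ) : sc (S.tw (List.replicate k a)) = sc (S.t a) ^ k := by
  induction k with
  | zero => simp [tw_nil, sc_one]
  | succ k ih => rw [List.replicate_succ, tw_cons, sc_mul, ih, pow_succ, mul_comm]

lemma sc_wj (a e : E) (J j : ℕ) (hj : j ≤ J) :
    sc (S.tw (wj a e J j)) = sc (S.t a) ^ J * sc (S.t e) := by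
  unfold wj
  rw [tw_append, tw_append, tw_single, sc_mul, sc_mul, sc_rep, sc_rep, mul_right_comm, ← pow_add,
    Nat.add_sub_cancel' hj]

lemma level (a : E) (w : List E) (q0 : Qg M N) (b0 : ℕ → E) (y0 : Big M N)
    (γ : (Matrix (Ix M N) (Ix M N) ℤ)ˣ) (n k : ℕ) (hk : k ≤ n) :
    S.Ph ε ((S.tw (List.replicate (n - k) a))⁻¹ * ((S.tw w)⁻¹ * q0))
      (pw (List.replicate (n - k) a) (pw w b0))
      (S.F (List.replicate k a) * (S.Fi (List.replicate n a) * (S.Fi w * y0) * zm γ.1)) =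
    S.Ph ε q0 b0 y0 := by
  have e1 : List.replicate n a = List.replicate (n - k) a ++ List.replicate k a := by
    rw [← List.replicate_add]; congr 1; omega
  have e2 : S.F (List.replicate k a) * (S.Fi (List.replicate n a) * (S.Fi w * y0) * zm γ.1) =
      S.Fi (List.replicate (n - k) a) * (S.Fi w * y0) * zm γ.1 := by
    rw [e1, Fi_append]
    simp only [← Matrix.mul_assoc]
    rw [F_Fi, Matrix.one_mul]
  rw [e2, Ph_gamma, Ph_fwd, Ph_fwd]

lemma first_k (τ : ℕ → ℝ) (C2 η : ℝ) (hC : 1 ≤ C2) (hτ : ∀ k, τ (k + 1) ≤ C2 * τ k)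
    (k0 n : ℕ) (h0 : C2 ^ k0 * τ 0 < η) (hη : 0 < η) (hpos : 0 ≤ τ 0) (hex : ∃ k ≤ n, η ≤ τ k) :
    ∃ k ≤ n, k0 < k ∧ η ≤ τ k ∧ τ k ≤ C2 * η := by
  classical
  have hex' : ∃ k, η ≤ τ k := let ⟨k, _, h⟩ := hex; ⟨k, h⟩
  have hle : ∀ k, τ k ≤ C2 ^ k * τ 0 := by
    intro k
    induction k with
    | zero => simp
    | succ k ih =>
      calc _ ≤ C2 * τ k := hτ k
        _ ≤ C2 * (C2 ^ k * τ 0) := by gcongr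
        _ = _ := by ring
  refine ⟨Nat.find hex', ?_, ?_, Nat.find_spec hex', ?_⟩
  · obtain ⟨k, h1, h2⟩ := hex
    exact (Nat.find_min' hex' h2).trans h1
  · by_contra hcon
    push Not at hcon
    have h1 := Nat.find_spec hex'
    have h2 := hle (Nat.find hex')
    have h3 : C2 ^ (Nat.find hex') * τ 0 ≤ C2 ^ k0 * τ 0 := by gcongr
    linarith
  · rcases hk : Nat.find hex' with _ | k
    · have h1 := Nat.find_spec hex'
      rw [hk] at h1
      have : τ 0 ≤ C2 ^ k0 * τ 0 := le_mul_of_one_le_left hpos (one_le_pow₀ hC)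
      linarith
    · have h1 : ¬ η ≤ τ k := Nat.find_min hex' (by omega)
      push Not at h1
      calc _ ≤ C2 * τ k := hτ k
        _ ≤ C2 * η := by gcongr

lemma stuck [Finite E] (hε : 0 < ε) (d0 : ℝ) (hd0 : ∀ (b : ℕ → E) (z : Big M N),
    S.Good ε b z → ∀ (w w' : List E), sc (S.tw w) = sc (S.tw w') →
    ‖lB (S.tw w') - lB (S.tw w)‖ ≤ d0 → ‖lC (S.tw w') - lC (S.tw w)‖ ≤ d0 →
    ∀ g : Matrix (Ix M N) (Ix M N) ℤ, S.F w' * S.Fi w * z = z * zm g → S.F w' = S.F w)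
    {J : ℕ} (wd : Fin J → List E) (j j' : ℕ → Fin J) (b0 : ℕ → ℕ → E) (y0 : ℕ → Big M N)
    (hgood : ∀ n, S.Good ε (b0 n) (y0 n)) (V : ℕ → Big M N) (hV : Tendsto V atTop (𝓝 0))
    (γ γ' : ℕ → (Matrix (Ix M N) (Ix M N) ℤ)ˣ)
    (heq : ∀ n, (1 + V n) * (S.Fi (wd (j n)) * y0 n * zm (γ n).1) =
      S.Fi (wd (j' n)) * y0 n * zm (γ' n).1)
    (hsc : ∀ i i', sc (S.tw (wd i)) = sc (S.tw (wd i')))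
    (hB : ∀ n, ‖lB (S.tw (wd (j' n))) - lB (S.tw (wd (j n)))‖ ≤ d0)
    (hC : ∀ n, ‖lC (S.tw (wd (j' n))) - lC (S.tw (wd (j n)))‖ ≤ d0)
    (hne : ∀ n, S.F (wd (j' n)) ≠ S.F (wd (j n))) : False := by
  letI : TopologicalSpace E := ⊥
  haveI : DiscreteTopology E := ⟨rfl⟩
  obtain ⟨R, hR, hm⟩ := mahler_bdd (ι := Ix M N) ε hε
  obtain ⟨C, hC0, hCi⟩ := inv_bd (ι := Ix M N) R
  have h1 : ∀ n, ∃ Γ : (Matrix (Ix M N) (Ix M N) ℤ)ˣ, ‖y0 n * zm Γ.1‖ ≤ R := fun n =>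
    hm _ (hgood n).1 (hgood n).xx
  choose Γ hΓ using h1
  have h2 : ∀ n, ∃ zi : Big M N, (y0 n * zm (Γ n).1) * zi = 1 ∧ zi * (y0 n * zm (Γ n).1) = 1 ∧
      ‖zi‖ ≤ C := fun n => hCi _ (hΓ n) ((hgood n).gamma (Γ n)).1
  choose zi hzi1 hzi2 hzi3 using h2
  obtain ⟨z, -, hz⟩ := ulim_ball _ R hΓ
  obtain ⟨zi0, -, hzi0⟩ := ulim_ball _ C hzi3
  obtain ⟨bb, -, hbb⟩ := ulim (isCompact_univ (X := ℕ → E)) b0 (fun _ => Set.mem_univ _)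
  obtain ⟨j0, hj0⟩ := uconst j
  obtain ⟨j0', hj0'⟩ := uconst j'
  have hgz : S.Good ε bb z := good_limit hbb hz
    (Eventually.of_forall fun n => (hgood n).gamma (Γ n))
  have hzz : z * zi0 = 1 := by
    have h3 := mm_lim hz hzi0
    simp only [hzi1] at h3
    exact tendsto_nhds_unique h3 tendsto_const_nhds
  have hlim : Tendsto (fun n => zi n * (S.F (wd j0') * ((1 + V n) * (S.Fi (wd j0) *
      (y0 n * zm (Γ n).1))))) UU (𝓝 (zi0 * (S.F (wd j0') * ((1 + 0) * (S.Fi (wd j0) * z))))) :=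
    mm_lim hzi0 (mm_lim tendsto_const_nhds (mm_lim (tendsto_const_nhds.add (hV.mono_left UU_le))
      (mm_lim tendsto_const_nhds hz)))
  have h_integral : ∀ᶠ n in UU, zi n * (S.F (wd j0') * ((1 + V n) * (S.Fi (wd j0) *
      (y0 n * zm (Γ n).1)))) = zm ((Γ n)⁻¹.1 * (γ' n).1 * (γ n)⁻¹.1 * (Γ n).1) := by
    filter_upwards [hj0, hj0'] with n hn hn'
    have e1 := heq n
    rw [hn, hn'] at e1
    have e2 : (1 + V n) * (S.Fi (wd j0) * (y0 n * zm (Γ n).1)) =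
        S.Fi (wd j0') * (y0 n * (zm (γ' n).1 * zm (γ n)⁻¹.1 * zm (Γ n).1)) := by
      calc _ = (1 + V n) * (S.Fi (wd j0) * y0 n * (zm (γ n).1 * zm (γ n)⁻¹.1)) * zm (Γ n).1 := by
            rw [zm_inv, Matrix.mul_one]; simp only [Matrix.mul_assoc]
        _ = ((1 + V n) * (S.Fi (wd j0) * y0 n * zm (γ n).1)) * zm (γ n)⁻¹.1 * zm (Γ n).1 := by
            simp only [Matrix.mul_assoc]
        _ = _ := by rw [e1]; simp only [Matrix.mul_assoc]
    rw [e2, ← Matrix.mul_assoc (S.F _), F_Fi, Matrix.one_mul, zm_mul, zm_mul, zm_mul]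
    calc _ = zi n * (y0 n * (zm (Γ n).1 * zm (Γ n)⁻¹.1) * (zm (γ' n).1 * zm (γ n)⁻¹.1 * zm (Γ n).1)) := by
          rw [zm_inv, Matrix.mul_one]
      _ = (zi n * (y0 n * zm (Γ n).1)) * zm (Γ n)⁻¹.1 * (zm (γ' n).1 * zm (γ n)⁻¹.1 * zm (Γ n).1) := by
          simp only [Matrix.mul_assoc]
      _ = _ := by rw [hzi2, Matrix.one_mul]; simp only [Matrix.mul_assoc]
  obtain ⟨g, hg⟩ := zm_closed _ _ (hlim.congr' h_integral)
  have hfin : S.F (wd j0') * S.Fi (wd j0) * z = z * zm g := by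
    rw [← hg, add_zero, Matrix.one_mul, ← Matrix.mul_assoc z, hzz, Matrix.one_mul, Matrix.mul_assoc]
  obtain ⟨n, hn, hn'⟩ := (hj0.and hj0').exists
  have hB' := hB n
  have hC' := hC n
  have hne' := hne n
  rw [hn, hn'] at hB' hC' hne'
  exact hne' (hd0 bb z hgz _ _ (hsc _ _) hB' hC' g hfin)

end Sys

end part9


section part10

namespace Sys
variable {M N : ℕ} {E : Type*} {S : Sys M N E} {ε : ℝ} {pi : (ℕ → E) → MatSpace M N}

lemma nonU (v : Big M N) (x : MatSpace M N) (X : ℝ) (hX : ‖x‖ ≤ X) (hp : ‖PP v x‖ ≤ 1 / 2 * ‖v‖) :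
    ‖v.toBlocks₁₂‖ ≤ (1 + 2 * (kk M N * X + kk M N ^ 2 * X ^ 2)) *
      (‖v.toBlocks₁₁‖ + ‖v.toBlocks₂₁‖ + ‖v.toBlocks₂₂‖) := by
  have hk := one_le_kk (M := M) (N := N)
  have hX0 : 0 ≤ X := (norm_nonneg _).trans hX
  have hM : (M : ℝ) ≤ kk M N := by unfold kk; have : (0 : ℝ) ≤ N := by positivity
                                   linarith
  have hN : (N : ℝ) ≤ kk M N := by unfold kk; have : (0 : ℝ) ≤ M := by positivity
                                   linarith
  have e1 : ‖v.toBlocks₁₁ * x‖ ≤ kk M N * X * ‖v.toBlocks₁₁‖ := by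
    have := matmul_norm_le v.toBlocks₁₁ x
    rw [Fintype.card_fin] at this
    calc _ ≤ _ := this
      _ ≤ kk M N * ‖v.toBlocks₁₁‖ * X := by gcongr
      _ = _ := by ring
  have e2 : ‖x * v.toBlocks₂₂‖ ≤ kk M N * X * ‖v.toBlocks₂₂‖ := by
    have := matmul_norm_le x v.toBlocks₂₂
    rw [Fintype.card_fin] at this
    calc _ ≤ _ := this
      _ ≤ kk M N * X * ‖v.toBlocks₂₂‖ := by gcongr
  have e3 : ‖x * v.toBlocks₂₁ * x‖ ≤ kk M N ^ 2 * X ^ 2 * ‖v.toBlocks₂₁‖ := by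
    have h1 := matmul_norm_le (x * v.toBlocks₂₁) x
    have h2 := matmul_norm_le x v.toBlocks₂₁
    rw [Fintype.card_fin] at h1 h2
    calc _ ≤ _ := h1
      _ ≤ kk M N * (N * ‖x‖ * ‖v.toBlocks₂₁‖) * ‖x‖ := by gcongr
      _ ≤ kk M N * (kk M N * X * ‖v.toBlocks₂₁‖) * X := by gcongr
      _ = _ := by ring
  have e4 : v.toBlocks₁₂ = PP v x - v.toBlocks₁₁ * x + x * v.toBlocks₂₂ + x * v.toBlocks₂₁ * x := by
    unfold PP; abel
  have e5 : ‖v.toBlocks₁₂‖ ≤ ‖PP v x‖ + ‖v.toBlocks₁₁ * x‖ + ‖x * v.toBlocks₂₂‖ +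
      ‖x * v.toBlocks₂₁ * x‖ := by
    conv_lhs => rw [e4]
    refine (norm_add_le _ _).trans (add_le_add ((norm_add_le _ _).trans
      (add_le_add (norm_sub_le _ _) le_rfl)) le_rfl)
  have e6 := norm_blocks v
  set A := kk M N * X
  have hA : 0 ≤ A := by positivity
  have hB : kk M N ^ 2 * X ^ 2 = A ^ 2 := by ring
  rw [hB] at *
  have p1 := norm_nonneg v.toBlocks₁₁
  have p2 := norm_nonneg v.toBlocks₂₁
  have p3 := norm_nonneg v.toBlocks₂₂
  have q1 := mul_nonneg hA p2
  have q2 := mul_nonneg (sq_nonneg A) p1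
  have q3 := mul_nonneg (sq_nonneg A) p3
  nlinarith

lemma rot_close {n : ℕ} (B0 B B' : Matrix (Fin n) (Fin n) ℝ) (h0 : B0 * B0ᵀ = 1) (h0' : ‖B0‖ ≤ 1)
    (hB : B' * B'ᵀ = 1) (hB' : ‖B'‖ ≤ 1) :
    ‖B0 * (B * B'ᵀ) * B0ᵀ - 1‖ ≤ (n : ℝ) ^ 3 * ‖B' - B‖ := by
  refine (orth_conj B0 (B * B'ᵀ) h0 h0').trans ?_
  have e1 : B * B'ᵀ - 1 = (B - B') * B'ᵀ := by rw [Matrix.sub_mul, hB]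
  have h1 := matmul_norm_le (B - B') B'ᵀ
  rw [Fintype.card_fin, Matrix.norm_transpose, norm_sub_rev] at h1
  rw [e1]
  calc (n : ℝ) ^ 2 * ‖(B - B') * B'ᵀ‖ ≤ (n : ℝ) ^ 2 * (n * ‖B' - B‖ * 1) := by
        gcongr; exact h1.trans (by gcongr)
    _ = _ := by ring

lemma lB_tr (q : Qg M N) : lB q⁻¹ = (lB q)ᵀ := lB_inv q
lemma lC_tr (q : Qg M N) : lC q⁻¹ = (lC q)ᵀ := lC_inv q

end Sys

end part10


section part11

namespace Sys
variable {M N : ℕ} {E : Type*} {S : Sys M N E} {ε : ℝ} {pi : (ℕ → E) → MatSpace M N}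

lemma small_d (d0 A η B η' C δ : ℝ) (h0 : 0 < d0) (hη : 0 < η) (hη' : 0 < η') (hδ : 0 < δ) :
    ∃ d : ℝ, 0 < d ∧ d ≤ d0 ∧ A * d < η ∧ B * d < η' ∧ C * d < δ := by
  have h1 : ∀ (A η : ℝ), 0 < η → ∀ᶠ d : ℝ in 𝓝[>] 0, A * d < η := by
    intro A η hη
    have : Tendsto (fun d : ℝ => A * d) (𝓝[>] 0) (𝓝 0) := by
      have h2 : Tendsto (fun d : ℝ => A * d) (𝓝 0) (𝓝 (A * 0)) := tendsto_id.const_mul A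
      rw [mul_zero] at h2
      exact h2.mono_left nhdsWithin_le_nhds
    exact this.eventually (gt_mem_nhds hη)
  obtain ⟨d, ⟨⟨h2, h3⟩, h4, h5, h6⟩⟩ := ((eventually_mem_nhdsWithin.and (h1 1 d0 h0)).and
    ((h1 A η hη).and ((h1 B η' hη').and (h1 C δ hδ)))).exists
  exact ⟨d, h2, by linarith, h4, h5, h6⟩

lemma conj_step (a : E) (v : Big M N) (k : ℕ) :
    S.F (List.replicate (k + 1) a) * v * S.Fi (List.replicate (k + 1) a) =
    S.F [a] * (S.F (List.replicate k a) * v * S.Fi (List.replicate k a)) * S.Fi [a] := by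
  rw [List.replicate_succ, show a :: List.replicate k a = [a] ++ List.replicate k a from rfl,
    F_append, Fi_append]
  simp only [Matrix.mul_assoc]

lemma conj_PP (w : List E) (v : Big M N) :
    PP (S.F w * v * S.Fi w) (S.xw w) = act (S.tw w) v.toBlocks₁₂ := by
  have h1 := conj_uu (S.F w * v * S.Fi w) (S.xw w)
  have h2 : uu (-(S.xw w)) * (S.F w * v * S.Fi w) * uu (S.xw w) = dg (S.tw w) * v * dg (S.tw w)⁻¹ := by
    unfold F Fi fm fmi
    have e1 : uu (-(S.xw w)) * uu (S.xw w) = 1 := by rw [uu_mul]; simp [uu_zero]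
    calc _ = (uu (-(S.xw w)) * uu (S.xw w)) * (dg (S.tw w) * v * dg (S.tw w)⁻¹) *
          (uu (-(S.xw w)) * uu (S.xw w)) := by simp only [Matrix.mul_assoc]
      _ = _ := by rw [e1, Matrix.one_mul, Matrix.mul_one]
  rw [h2] at h1
  conv_lhs at h1 => rw [← Matrix.fromBlocks_toBlocks v, conj_dg]
  rw [Matrix.fromBlocks_inj] at h1
  exact h1.2.1.symm

set_option maxHeartbeats 1000000 in
lemma pairs [Finite E] [Nonempty E] (h : S.IsCod pi) (hε : 0 < ε) (Fs : Set (MatSpace M N))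
    (hFs : ∃ q b y, S.Ph ε q b y = Fs) (h0 : (0 : MatSpace M N) ∈ Fs) :
    ∃ C0 C1 : ℝ, 0 < C0 ∧ 0 < C1 ∧ ∀ η > 0, ∀ δ > 0, ∃ (q q' : Qg M N) (b b' : ℕ → E)
      (p v : Big M N), S.Ph ε q b p = Fs ∧ S.Ph ε q' b' ((1 + v) * p) = Fs ∧ sc q = sc q' ∧
      sc q < δ ∧ ‖lB (q⁻¹ * q') - 1‖ < δ ∧ ‖lC (q⁻¹ * q') - 1‖ < δ ∧
      η * sc q ^ (M + N) ≤ ‖v‖ ∧ ‖v‖ ≤ C0 * (η * sc q ^ (M + N)) ∧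
      ‖v.toBlocks₁₂‖ ≤ C1 * (‖v.toBlocks₁₁‖ + ‖v.toBlocks₂₁‖ + ‖v.toBlocks₂₂‖) := by
  obtain ⟨a, e, hae⟩ := h.exists_letters
  obtain ⟨d0, hd0, hdisc⟩ := discrete S hε
  obtain ⟨R, hR, hm⟩ := mahler_bdd (ι := Ix M N) ε hε
  obtain ⟨CR, hCR, hinv⟩ := inv_bd (ι := Ix M N) R
  obtain ⟨X, hX, hxw, -⟩ := h.bdd
  have hkk := kk_pos (M := M) (N := N)
  have hk1 := one_le_kk (M := M) (N := N)
  set σ := sc (S.t a) with hσ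
  have hσ0 : 0 < σ := sc_pos _
  have hσ1 : σ < 1 := (S.le_hi a).trans_lt S.hi_lt
  have hlo := S.lo_pos
  set D := M + N with hD
  have hD0 : 0 < D := by have := S.hM; omega
  set K := kk M N ^ 2 * (‖S.F [a]‖ * ‖S.Fi [a]‖) with hK
  have hK0 : 0 ≤ K := by positivity
  set C2 := K / σ ^ D + 1 with hC2
  have hC21 : 1 ≤ C2 := by
    have : 0 ≤ K / σ ^ D := by positivity
    linarith
  set C1 := (1 + 2 * (kk M N * X + kk M N ^ 2 * X ^ 2)) with hC1
  refine ⟨C2, C1, by linarith, by positivity, fun η hη δ hδ => ?_⟩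
  obtain ⟨k0, hk0⟩ := exists_pow_lt_of_lt_one hδ hσ1
  set cv := kk M N * CR with hcv
  have hcv0 : 0 < cv := by positivity
  obtain ⟨d, hd, hdd0, hd1, hd2, hd3⟩ := small_d d0 (C2 ^ k0 * (cv / S.lo ^ D)) η
    (kap M N * cv) (1 / 2 * η * S.lo ^ D) (kk M N ^ 3) δ hd0 hη (by positivity) hδ
  obtain ⟨J, hJ⟩ := pigeon (V := Big M N × (Matrix (Fin M) (Fin M) ℝ × Matrix (Fin N) (Fin N) ℝ))
    (max R 1) d hd
  set wd : Fin J → List E := fun j => wj a e J j with hwd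
  set sw := σ ^ J * sc (S.t e) with hsw
  have hsw0 : 0 < sw := mul_pos (pow_pos hσ0 _) (sc_pos _)
  have hsw1 : sw ≤ 1 := mul_le_one₀ (pow_le_one₀ hσ0.le hσ1.le) (sc_pos _).le
    ((S.le_hi e).trans S.hi_lt.le)
  have hscw : ∀ j, sc (S.tw (wd j)) = sw := fun j => sc_wj a e J j j.2.le
  -- initial states
  have hst : ∀ n : ℕ, ∃ (q0 : Qg M N) (b0 : ℕ → E) (y0 : Big M N), S.Ph ε q0 b0 y0 = Fs ∧
      S.lo * (sw * σ ^ n) ≤ sc q0 ∧ sc q0 ≤ sw * σ ^ n := by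
    intro n
    obtain ⟨q, b, y, hq⟩ := hFs
    obtain ⟨q1, b1, y1, e1, e2, e3⟩ := normalize (S := S) (ε := ε) q b y
    have hs : 0 < sw * σ ^ n := by positivity
    have hs1 : sw * σ ^ n ≤ 1 := mul_le_one₀ hsw1 (by positivity) (pow_le_one₀ hσ0.le hσ1.le)
    obtain ⟨m, e4, e5⟩ := S.back_scale b1 q1 _ hs (by nlinarith)
    exact ⟨_, _, _, by rw [Ph_back, e3, hq], e4, e5⟩
  choose q0 b0 y0 hPh hsl hsu using hst
  have hgood : ∀ n, S.Good ε (b0 n) (y0 n) := fun n => by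
    rw [← zero_mem_Ph (q := q0 n), hPh]; exact h0
  have hγ : ∀ (n : ℕ) (j : Fin J), ∃ γ : (Matrix (Ix M N) (Ix M N) ℤ)ˣ,
      ‖S.Fi (List.replicate n a) * (S.Fi (wd j) * y0 n) * zm γ.1‖ ≤ R := by
    intro n j
    have hg := ((hgood n).fwd (wd j)).fwd (List.replicate n a)
    exact hm _ hg.1 hg.xx
  choose γ hγR using hγ
  set Y : ℕ → Fin J → Big M N := fun n j =>
    S.Fi (List.replicate n a) * (S.Fi (wd j) * y0 n) * zm (γ n j).1 with hY
  have hYdet : ∀ n j, |(Y n j).det| = 1 := fun n j =>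
    ((((hgood n).fwd (wd j)).fwd (List.replicate n a)).gamma (γ n j)).1
  have hpair : ∀ n, ∃ j j' : Fin J, j < j' ∧ ‖Y n j' - Y n j‖ < d ∧
      ‖lB (S.tw (wd j')) - lB (S.tw (wd j))‖ < d ∧ ‖lC (S.tw (wd j')) - lC (S.tw (wd j))‖ < d := by
    intro n
    obtain ⟨j, j', e1, e2⟩ := hJ (fun j => (Y n j, (lB (S.tw (wd j)), lC (S.tw (wd j))))) (by
      intro j
      rw [Prod.norm_def, Prod.norm_def]
      exact max_le ((hγR n j).trans (le_max_left _ _)) (max_le ((lB_norm _).trans (le_max_right _ _))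
        ((lC_norm _).trans (le_max_right _ _))))
    rw [Prod.mk_sub_mk, Prod.mk_sub_mk, Prod.norm_def, Prod.norm_def] at e2
    exact ⟨j, j', e1, (le_max_left _ _).trans_lt e2,
      ((le_max_left _ _).trans (le_max_right _ _)).trans_lt e2,
      ((le_max_right _ _).trans (le_max_right _ _)).trans_lt e2⟩
  choose j j' hjj hYd hBd hCd using hpair
  have hYi : ∀ n, ∃ Yi : Big M N, Y n (j n) * Yi = 1 ∧ Yi * Y n (j n) = 1 ∧ ‖Yi‖ ≤ CR := fun n =>
    hinv _ (hγR n (j n)) (hYdet n _)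
  choose Yi hYi1 hYi2 hYi3 using hYi
  set v : ℕ → Big M N := fun n => (Y n (j' n) - Y n (j n)) * Yi n with hv
  have hvY : ∀ n, (1 + v n) * Y n (j n) = Y n (j' n) := by
    intro n
    rw [Matrix.add_mul, Matrix.one_mul, hv]
    simp only
    rw [Matrix.mul_assoc, hYi2, Matrix.mul_one]; abel
  have hvn : ∀ n, ‖v n‖ ≤ cv * d := by
    intro n
    have e1 := big_mul (Y n (j' n) - Y n (j n)) (Yi n)
    calc _ ≤ _ := e1
      _ ≤ kk M N * d * CR := by
        have := hYd n; have := hYi3 n; gcongr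
      _ = _ := by rw [hcv]; ring
  set V : ℕ → ℕ → Big M N := fun n k =>
    S.F (List.replicate k a) * v n * S.Fi (List.replicate k a) with hV
  have hV0 : ∀ n, V n 0 = v n := by
    intro n; simp [hV, F_nil, Fi_nil]
  have hVst : ∀ n k, ‖V n (k + 1)‖ ≤ K * ‖V n k‖ := by
    intro n k
    simp only [hV]
    rw [conj_step]
    exact big_mul3 _ _ _
  have hVeq : ∀ n k, (1 + V n k) * (S.F (List.replicate k a) * Y n (j n)) =
      S.F (List.replicate k a) * Y n (j' n) := by
    intro n k
    rw [← hvY n, Matrix.add_mul, Matrix.one_mul]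
    simp only [hV, Matrix.mul_assoc]
    rw [← Matrix.mul_assoc (S.Fi (List.replicate k a)), Fi_F, Matrix.one_mul, Matrix.add_mul,
      Matrix.one_mul, Matrix.mul_add]
  set ρ : ℕ → ℕ → ℝ := fun n k => sc (q0 n) / (sw * σ ^ n) * σ ^ k with hρ
  have hs0 : ∀ n, S.lo ≤ sc (q0 n) / (sw * σ ^ n) ∧ sc (q0 n) / (sw * σ ^ n) ≤ 1 := by
    intro n
    have hs : 0 < sw * σ ^ n := by positivity
    exact ⟨(le_div_iff₀ hs).2 (hsl n), (div_le_one hs).2 (hsu n)⟩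
  have hρ0 : ∀ n k, 0 < ρ n k := fun n k => mul_pos (lt_of_lt_of_le hlo (hs0 n).1) (pow_pos hσ0 _)
  have hρ1 : ∀ n k, ρ n k ≤ σ ^ k := fun n k =>
    mul_le_of_le_one_left (pow_pos hσ0 _).le (hs0 n).2
  have hρ2 : ∀ n k, S.lo * σ ^ k ≤ ρ n k := fun n k =>
    mul_le_mul_of_nonneg_right (hs0 n).1 (pow_pos hσ0 _).le
  have hρs : ∀ n k, ρ n (k + 1) = ρ n k * σ := fun n k => by simp only [hρ, pow_succ]; ring
  set τ : ℕ → ℕ → ℝ := fun n k => ‖V n k‖ / ρ n k ^ D with hτ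
  have hτst : ∀ n k, τ n (k + 1) ≤ C2 * τ n k := by
    intro n k
    simp only [hτ]
    rw [hρs, mul_pow]
    have hp := hρ0 n k
    calc _ ≤ K * ‖V n k‖ / (ρ n k ^ D * σ ^ D) := by have := hVst n k; gcongr
      _ = K / σ ^ D * (‖V n k‖ / ρ n k ^ D) := by field_simp
      _ ≤ C2 * (‖V n k‖ / ρ n k ^ D) := by gcongr; linarith
  have hscq : ∀ n k i, k ≤ n → sc ((S.tw (List.replicate (n - k) a))⁻¹ * ((S.tw (wd i))⁻¹ * q0 n))
      = ρ n k := by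
    intro n k i hkn
    simp only [hρ]
    rw [sc_mul, sc_inv, sc_mul, sc_inv, sc_rep, hscw, ← hσ]
    obtain ⟨l, rfl⟩ := Nat.exists_eq_add_of_le hkn
    rw [Nat.add_sub_cancel_left, pow_add]
    field_simp
  have hex : ∃ n, ∃ k ≤ n, η ≤ τ n k := by
    by_contra hcon
    push Not at hcon
    have hb : ∀ n, ‖V n n‖ ≤ η * (σ ^ D) ^ n := by
      intro n
      have e1 := hcon n n le_rfl
      simp only [hτ] at e1
      rw [div_lt_iff₀ (pow_pos (hρ0 n n) _)] at e1
      refine e1.le.trans ?_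
      rw [← pow_mul, mul_comm D n, pow_mul]
      have := hρ1 n n
      have := (hρ0 n n).le
      gcongr
    have hVt : Tendsto (fun n => V n n) atTop (𝓝 0) := by
      refine squeeze_zero_norm hb ?_
      have := (tendsto_pow_atTop_nhds_zero_of_lt_one (pow_nonneg hσ0.le D)
        (pow_lt_one₀ hσ0.le hσ1 hD0.ne')).const_mul η
      rwa [mul_zero] at this
    refine stuck hε d0 hdisc wd j j' b0 y0 hgood (fun n => V n n) hVt (fun n => γ n (j n))
      (fun n => γ n (j' n)) ?_ (fun i i' => by rw [hscw, hscw]) (fun n => (hBd n).le.trans hdd0)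
      (fun n => (hCd n).le.trans hdd0) (fun n => wj_ne h hae (hjj n) (j' n).2)
    intro n
    have e1 : ∀ i, S.F (List.replicate n a) * Y n i = S.Fi (wd i) * y0 n * zm (γ n i).1 := by
      intro i
      simp only [hY, ← Matrix.mul_assoc]
      rw [F_Fi, Matrix.one_mul]
    have e2 := hVeq n n
    rw [e1, e1] at e2
    exact e2
  obtain ⟨n, hnk⟩ := hex
  obtain ⟨k, hkn, hk0k, hτ1, hτ2⟩ := first_k (τ n) C2 η hC21 (hτst n) k0 n (by
    refine lt_of_le_of_lt ?_ hd1
    rw [mul_assoc]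
    simp only [hτ]
    have e1 := hρ2 n 0
    rw [pow_zero, mul_one] at e1
    rw [hV0, div_mul_eq_mul_div]
    have := hvn n
    gcongr) hη (by have := hρ0 n 0; positivity) hnk
  have hqq : ∀ (A W W' q : Qg M N), (A⁻¹ * (W⁻¹ * q))⁻¹ * (A⁻¹ * (W'⁻¹ * q)) =
      q⁻¹ * (W * W'⁻¹) * q⁻¹⁻¹ := by intro A W W' q; group
  refine ⟨(S.tw (List.replicate (n - k) a))⁻¹ * ((S.tw (wd (j n)))⁻¹ * q0 n),
    (S.tw (List.replicate (n - k) a))⁻¹ * ((S.tw (wd (j' n)))⁻¹ * q0 n),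
    pw (List.replicate (n - k) a) (pw (wd (j n)) (b0 n)),
    pw (List.replicate (n - k) a) (pw (wd (j' n)) (b0 n)),
    S.F (List.replicate k a) * Y n (j n), V n k,
    (level (ε := ε) a (wd (j n)) (q0 n) (b0 n) (y0 n) (γ n (j n)) n k hkn).trans (hPh n), ?_, ?_, ?_,
    ?_, ?_, ?_, ?_, ?_⟩
  · rw [hVeq]
    exact (level (ε := ε) a (wd (j' n)) (q0 n) (b0 n) (y0 n) (γ n (j' n)) n k hkn).trans (hPh n)
  · rw [hscq _ _ _ hkn, hscq _ _ _ hkn]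
  · rw [hscq _ _ _ hkn]
    exact (hρ1 n k).trans_lt ((pow_le_pow_of_le_one hσ0.le hσ1.le hk0k.le).trans_lt hk0)
  · rw [hqq, lB_mul, lB_mul, lB_mul, lB_inv (q0 n)⁻¹, lB_inv (S.tw (wd (j' n)))]
    refine (rot_close _ _ _ (lB_mul_tr _) (lB_norm _) (lB_mul_tr _) (lB_norm _)).trans_lt ?_
    refine lt_of_le_of_lt ?_ hd3
    have e1 := (hBd n).le
    have e2 : (M : ℝ) ≤ kk M N := by
      unfold kk
      have : (0 : ℝ) ≤ N := by positivity
      linarith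
    gcongr
  · rw [hqq, lC_mul, lC_mul, lC_mul, lC_inv (q0 n)⁻¹, lC_inv (S.tw (wd (j' n)))]
    refine (rot_close _ _ _ (lC_mul_tr _) (lC_norm _) (lC_mul_tr _) (lC_norm _)).trans_lt ?_
    refine lt_of_le_of_lt ?_ hd3
    have e1 := (hCd n).le
    have e2 : (N : ℝ) ≤ kk M N := by
      unfold kk
      have : (0 : ℝ) ≤ M := by positivity
      linarith
    gcongr
  · rw [hscq _ _ _ hkn]
    exact (le_div_iff₀ (pow_pos (hρ0 n k) _)).1 hτ1
  · rw [hscq _ _ _ hkn, ← mul_assoc]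
    exact (div_le_iff₀ (pow_pos (hρ0 n k) _)).1 hτ2
  · refine nonU (V n k) (S.xw (List.replicate k a)) X (hxw _) ?_
    simp only [hV]
    rw [conj_PP]
    have e1 := (le_div_iff₀ (pow_pos (hρ0 n k) _)).1 hτ1
    refine (act_norm _ _).trans ?_
    rw [sc_rep, ← hσ]
    have e2 := (norm_b12 (v n)).trans (hvn n)
    have e3 := hρ2 n k
    have hka := kap_pos (M := M) (N := N)
    calc (σ ^ k) ^ D * (kap M N * ‖(v n).toBlocks₁₂‖) ≤ (σ ^ k) ^ D * (kap M N * (cv * d)) := by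
          gcongr
      _ ≤ (σ ^ k) ^ D * (1 / 2 * η * S.lo ^ D) := by
          rw [← mul_assoc (kap M N)]; gcongr
      _ = 1 / 2 * (η * (S.lo * σ ^ k) ^ D) := by rw [mul_pow]; ring
      _ ≤ 1 / 2 * (η * ρ n k ^ D) := by gcongr
      _ ≤ _ := by gcongr

end Sys

end part11


section part12

section blk
variable {M N : ℕ} {T : Type*} {l : Filter T}

lemma b11_lim {v : T → Big M N} {v0} (h : Tendsto v l (𝓝 v0)) :
    Tendsto (fun i => (v i).toBlocks₁₁) l (𝓝 v0.toBlocks₁₁) :=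
  ((by unfold Matrix.toBlocks₁₁; fun_prop : Continuous (fun v : Big M N => v.toBlocks₁₁)).tendsto v0).comp h
lemma b12_lim {v : T → Big M N} {v0} (h : Tendsto v l (𝓝 v0)) :
    Tendsto (fun i => (v i).toBlocks₁₂) l (𝓝 v0.toBlocks₁₂) :=
  ((by unfold Matrix.toBlocks₁₂; fun_prop : Continuous (fun v : Big M N => v.toBlocks₁₂)).tendsto v0).comp h
lemma b21_lim {v : T → Big M N} {v0} (h : Tendsto v l (𝓝 v0)) :
    Tendsto (fun i => (v i).toBlocks₂₁) l (𝓝 v0.toBlocks₂₁) :=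
  ((by unfold Matrix.toBlocks₂₁; fun_prop : Continuous (fun v : Big M N => v.toBlocks₂₁)).tendsto v0).comp h
lemma b22_lim {v : T → Big M N} {v0} (h : Tendsto v l (𝓝 v0)) :
    Tendsto (fun i => (v i).toBlocks₂₂) l (𝓝 v0.toBlocks₂₂) :=
  ((by unfold Matrix.toBlocks₂₂; fun_prop : Continuous (fun v : Big M N => v.toBlocks₂₂)).tendsto v0).comp h

lemma fb_lim {a : T → Matrix (Fin M) (Fin M) ℝ} {b : T → MatSpace M N}
    {c : T → Matrix (Fin N) (Fin M) ℝ} {d : T → Matrix (Fin N) (Fin N) ℝ} {a0 b0 c0 d0}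
    (ha : Tendsto a l (𝓝 a0)) (hb : Tendsto b l (𝓝 b0)) (hc : Tendsto c l (𝓝 c0))
    (hd : Tendsto d l (𝓝 d0)) :
    Tendsto (fun i => Matrix.fromBlocks (a i) (b i) (c i) (d i)) l
      (𝓝 (Matrix.fromBlocks a0 b0 c0 d0)) := by
  refine tendsto_pi_nhds.2 fun x => tendsto_pi_nhds.2 fun y => ?_
  rcases x with x | x <;> rcases y with y | y
  · exact tendsto_pi_nhds.1 (tendsto_pi_nhds.1 ha x) y
  · exact tendsto_pi_nhds.1 (tendsto_pi_nhds.1 hb x) y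
  · exact tendsto_pi_nhds.1 (tendsto_pi_nhds.1 hc x) y
  · exact tendsto_pi_nhds.1 (tendsto_pi_nhds.1 hd x) y

lemma PP_lim {v : T → Big M N} {v0} (h : Tendsto v l (𝓝 v0)) {x : T → MatSpace M N} {x0}
    (hx : Tendsto x l (𝓝 x0)) : Tendsto (fun i => Sys.PP (v i) (x i)) l (𝓝 (Sys.PP v0 x0)) := by
  unfold Sys.PP
  exact (((b12_lim h).add (mm_lim (b11_lim h) hx)).sub (mm_lim hx (b22_lim h))).sub
    (mm_lim (mm_lim hx (b21_lim h)) hx)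

lemma PP_smul (r : ℝ) (v : Big M N) (x : MatSpace M N) : Sys.PP (r • v) x = r • Sys.PP v x := by
  have e1 : (r • v).toBlocks₁₁ = r • v.toBlocks₁₁ := rfl
  have e2 : (r • v).toBlocks₁₂ = r • v.toBlocks₁₂ := rfl
  have e3 : (r • v).toBlocks₂₁ = r • v.toBlocks₂₁ := rfl
  have e4 : (r • v).toBlocks₂₂ = r • v.toBlocks₂₂ := rfl
  unfold Sys.PP
  rw [e1, e2, e3, e4]
  simp only [Matrix.smul_mul, Matrix.mul_smul, smul_sub, smul_add]

end blk

namespace Sys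
variable {M N : ℕ} {E : Type*} {S : Sys M N E} {ε : ℝ} {pi : (ℕ → E) → MatSpace M N}

lemma lo_pow_le [Nonempty E] (w : List E) : S.lo ^ w.length ≤ sc (S.tw w) := by
  induction w with
  | nil => simp [tw_nil, sc_one]
  | cons e w ih =>
    rw [tw_cons, sc_mul, List.length_cons, pow_succ']
    exact mul_le_mul (S.lo_le e) ih (pow_pos S.lo_pos _).le (sc_pos _).le

lemma act_congr {q q' : Qg M N} (h1 : sc q = sc q') (h2 : lB q = lB q') (h3 : lC q = lC q')
    (s : MatSpace M N) : act q s = act q' s := by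
  unfold act; rw [h1, h2, h3]

lemma Ph_congr {q q' : Qg M N} (h1 : sc q = sc q') (h2 : lB q = lB q') (h3 : lC q = lC q')
    (b : ℕ → E) (y : Big M N) : S.Ph ε q b y = S.Ph ε q' b y := by
  unfold Ph; simp only [act_congr h1 h2 h3]

lemma conj_word (w : List E) (v : Big M N) : S.Fi w * v * S.F w =
    Matrix.fromBlocks (lB (S.tw w)⁻¹ * (v.toBlocks₁₁ - S.xw w * v.toBlocks₂₁) * (lB (S.tw w)⁻¹)ᵀ)
      (act (S.tw w)⁻¹ (PP v (S.xw w)))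
      (sc (S.tw w) ^ (M + N) • (lC (S.tw w)⁻¹ * v.toBlocks₂₁ * (lB (S.tw w)⁻¹)ᵀ))
      (lC (S.tw w)⁻¹ * (v.toBlocks₂₁ * S.xw w + v.toBlocks₂₂) * (lC (S.tw w)⁻¹)ᵀ) := by
  have h1 := conj_dg (S.tw w)⁻¹ (v.toBlocks₁₁ - S.xw w * v.toBlocks₂₁) (PP v (S.xw w))
    v.toBlocks₂₁ (v.toBlocks₂₁ * S.xw w + v.toBlocks₂₂)
  rw [← conj_uu, sc_inv, inv_inv, inv_inv] at h1
  rw [← h1]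
  unfold F Fi fm fmi
  simp only [Matrix.mul_assoc]

set_option maxHeartbeats 1000000 in
lemma transfer [Finite E] [Nonempty E] (h : S.IsCod pi) (hε : 0 < ε) (Fs : Set (MatSpace M N))
    (h0 : (0 : MatSpace M N) ∈ Fs) (hmax : ∀ q b y, Fs ⊆ S.Ph ε q b y → S.Ph ε q b y = Fs)
    (q q' : ℕ → Qg M N) (b b' : ℕ → ℕ → E) (p v : ℕ → Big M N)
    (hP : ∀ i, S.Ph ε (q i) (b i) (p i) = Fs)
    (hP' : ∀ i, S.Ph ε (q' i) (b' i) ((1 + sc (q i) ^ (M + N) • v i) * p i) = Fs)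
    (hsc : ∀ i, sc (q i) = sc (q' i)) (hs1 : ∀ i, sc (q i) ≤ 1)
    (hs0 : Tendsto (fun i => sc (q i)) UU (𝓝 0))
    (hB : Tendsto (fun i => lB ((q i)⁻¹ * q' i)) UU (𝓝 1))
    (hC : Tendsto (fun i => lC ((q i)⁻¹ * q' i)) UU (𝓝 1))
    (v0 : Big M N) (hv : Tendsto v UU (𝓝 v0)) (qq : Qg M N)
    (hqq : ∀ (s : ℕ → MatSpace M N) (s0 : MatSpace M N),
      Tendsto s UU (𝓝 s0) → Tendsto (fun n => rot (q n)⁻¹ (s n)) UU (𝓝 (rot qq s0)))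
    (c : ℕ → E) : rot qq (PP v0 (pi c)) ∈ stab Fs := by
  letI : TopologicalSpace E := ⊥
  haveI : DiscreteTopology E := ⟨rfl⟩
  obtain ⟨R, hR, hm⟩ := mahler_bdd (ι := Ix M N) ε hε
  have hlo := S.lo_pos
  have hlo1 := S.lo_le_one
  have hD0 : M + N ≠ 0 := by have := S.hM; omega
  choose n hn1 hn2 using fun i => S.fwd_scale c (sc (q i)) (sc_pos _) (hs1 i)
  have hst : Tendsto (fun i => sc (S.tw (pf c (n i)))) UU (𝓝 0) := by
    refine squeeze_zero (fun i => (sc_pos _).le) hn2 ?_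
    have := hs0.div_const S.lo
    rwa [zero_div] at this
  have hn : Tendsto n UU atTop := by
    rw [Filter.tendsto_atTop]
    intro k
    filter_upwards [hst.eventually (gt_mem_nhds (pow_pos hlo k))] with i hi
    by_contra hcon
    push Not at hcon
    have e1 := S.lo_pow_le (pf c (n i))
    rw [pf_length] at e1
    have e2 := pow_le_pow_of_le_one hlo.le hlo1 hcon.le
    linarith
  have hx : Tendsto (fun i => S.xw (pf c (n i))) UU (𝓝 (pi c)) := by
    have := (h.lim c 0).comp hn
    simpa [ph, act_zero, Function.comp_def] using this
  set t : ℕ → Qg M N := fun i => S.tw (pf c (n i)) with ht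
  have hmsc : ∀ i, S.lo ≤ sc ((t i)⁻¹ * q i) ∧ sc ((t i)⁻¹ * q i) ≤ 1 := by
    intro i
    rw [sc_mul, sc_inv, inv_mul_eq_div]
    have hp := sc_pos (t i)
    constructor
    · rw [le_div_iff₀ hp]
      have := (le_div_iff₀ hlo).1 (hn2 i)
      rw [mul_comm]; exact this
    · rw [div_le_one hp]; exact hn1 i
  have hmsc' : ∀ i, S.lo ≤ sc ((t i)⁻¹ * q' i) ∧ sc ((t i)⁻¹ * q' i) ≤ 1 := by
    intro i
    have := hmsc i
    rwa [sc_mul, ← hsc, ← sc_mul]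
  obtain ⟨m, -, hmlim⟩ := ulim (isCompact_scIcc S.lo 1 hlo) (fun i => (t i)⁻¹ * q i) hmsc
  obtain ⟨m', -, hmlim'⟩ := ulim (isCompact_scIcc S.lo 1 hlo) (fun i => (t i)⁻¹ * q' i) hmsc'
  have hmm : ∀ i, (t i)⁻¹ * q' i = (t i)⁻¹ * q i * ((q i)⁻¹ * q' i) := by intro i; group
  have hm1 : sc m' = sc m := by
    have e1 := (continuous_sc.tendsto m').comp hmlim'
    have e2 := (continuous_sc.tendsto m).comp hmlim
    refine tendsto_nhds_unique e1 (e2.congr fun i => ?_)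
    simp only [Function.comp, sc_mul, hsc]
  have hm2 : lB m' = lB m := by
    have e1 := (continuous_lB.tendsto m').comp hmlim'
    have e2 := mm_lim ((continuous_lB.tendsto m).comp hmlim) hB
    rw [Matrix.mul_one] at e2
    refine tendsto_nhds_unique e1 (e2.congr fun i => ?_)
    simp only [Function.comp]
    rw [hmm, lB_mul _ ((q i)⁻¹ * q' i)]
  have hm3 : lC m' = lC m := by
    have e1 := (continuous_lC.tendsto m').comp hmlim'
    have e2 := mm_lim ((continuous_lC.tendsto m).comp hmlim) hC
    rw [Matrix.mul_one] at e2
    refine tendsto_nhds_unique e1 (e2.congr fun i => ?_)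
    simp only [Function.comp]
    rw [hmm, lC_mul _ ((q i)⁻¹ * q' i)]
  have hF1 : ∀ i, S.Ph ε ((t i)⁻¹ * q i) (pw (pf c (n i)) (b i)) (S.Fi (pf c (n i)) * p i) = Fs :=
    fun i => (Ph_fwd _ _ _ _).trans (hP i)
  have hγ : ∀ i, ∃ γ : (Matrix (Ix M N) (Ix M N) ℤ)ˣ, ‖S.Fi (pf c (n i)) * p i * zm γ.1‖ ≤ R := by
    intro i
    have hg : S.Good ε (pw (pf c (n i)) (b i)) (S.Fi (pf c (n i)) * p i) := by
      rw [← zero_mem_Ph (q := (t i)⁻¹ * q i), hF1]; exact h0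
    exact hm _ hg.1 hg.xx
  choose γ hγR using hγ
  obtain ⟨z, -, hz⟩ := ulim_ball _ R hγR
  obtain ⟨bb, -, hbb⟩ := ulim (isCompact_univ (X := ℕ → E)) (fun i => pw (pf c (n i)) (b i))
    (fun _ => Set.mem_univ _)
  have hbb' : Tendsto (fun i => pw (pf c (n i)) (b' i)) UU (𝓝 bb) := by
    rw [tendsto_pi_nhds] at hbb ⊢
    intro k
    refine (hbb k).congr' ?_
    filter_upwards [hn.eventually_gt_atTop k] with i hi
    exact pw_agree _ _ _ 0 (by simp) k (by rw [pf_length]; omega)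
  have hA1 : S.Ph ε m bb z = Fs := by
    refine hmax _ _ _ fun f hf => Ph_limit hmlim hbb hz tendsto_const_nhds
      (Eventually.of_forall fun i => ?_)
    rw [Ph_gamma, hF1]; exact hf
  -- the second family
  obtain ⟨tq, htB, htC⟩ := lim_lBC (fun i => (t i)⁻¹)
  have hsv : Tendsto (fun i => sc (q i) ^ (M + N) • v i) UU (𝓝 0) := by
    have := (hs0.pow (M + N)).smul hv
    rwa [zero_pow hD0, zero_smul] at this
  set hh := rot qq (PP v0 (pi c)) with hhh
  have hz11 : ((0 : Big M N)).toBlocks₁₁ = 0 := rfl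
  have hz21 : ((0 : Big M N)).toBlocks₂₁ = 0 := rfl
  have hz22 : ((0 : Big M N)).toBlocks₂₂ = 0 := rfl
  have hU : Tendsto (fun i => S.Fi (pf c (n i)) * (sc (q i) ^ (M + N) • v i) * S.F (pf c (n i))) UU
      (𝓝 (Matrix.fromBlocks 0 (act m hh) 0 0)) := by
    simp only [conj_word]
    have e21 := b21_lim hsv
    have e11 := (b11_lim hsv).sub (mm_lim hx e21)
    have e22 := (mm_lim e21 hx).add (b22_lim hsv)
    rw [hz11, hz21, Matrix.mul_zero, sub_zero] at e11
    rw [hz21, hz22, Matrix.zero_mul, add_zero] at e22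
    rw [hz21] at e21
    refine fb_lim ?_ ?_ ?_ ?_
    · have := mm_lim (mm_lim htB e11) (tr_lim htB)
      rwa [Matrix.mul_zero, Matrix.zero_mul] at this
    · have e1 := hqq _ _ (PP_lim hv hx)
      have e2 := (continuous_act.tendsto (m, hh)).comp (hmlim.prodMk_nhds e1)
      refine e2.congr fun i => ?_
      simp only [Function.comp]
      rw [act_mul, act_eq (q i), rot_inv, PP_smul]
    · have := (hst.pow (M + N)).smul (mm_lim (mm_lim htC e21) (tr_lim htB))
      rwa [zero_pow hD0, zero_smul] at this
    · have := mm_lim (mm_lim htC e22) (tr_lim htC)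
      rwa [Matrix.mul_zero, Matrix.zero_mul] at this
  have h1U : (1 : Big M N) + Matrix.fromBlocks 0 (act m hh) 0 0 = uu (act m hh) := by
    unfold uu
    rw [← Matrix.fromBlocks_one, Matrix.fromBlocks_add]; simp
  have hz' : Tendsto (fun i => (1 + S.Fi (pf c (n i)) * (sc (q i) ^ (M + N) • v i) *
      S.F (pf c (n i))) * (S.Fi (pf c (n i)) * p i * zm (γ i).1)) UU (𝓝 (uu (act m hh) * z)) := by
    have := mm_lim ((tendsto_const_nhds (x := (1 : Big M N))).add hU) hz
    rwa [h1U] at this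
  have hF2 : ∀ i, S.Ph ε ((t i)⁻¹ * q' i) (pw (pf c (n i)) (b' i)) ((1 + S.Fi (pf c (n i)) *
      (sc (q i) ^ (M + N) • v i) * S.F (pf c (n i))) * (S.Fi (pf c (n i)) * p i * zm (γ i).1)) = Fs := by
    intro i
    have e1 : (1 + S.Fi (pf c (n i)) *
      (sc (q i) ^ (M + N) • v i) * S.F (pf c (n i))) * (S.Fi (pf c (n i)) * p i * zm (γ i).1) =
      S.Fi (pf c (n i)) * ((1 + sc (q i) ^ (M + N) • v i) * p i) * zm (γ i).1 := by
      generalize sc (q i) ^ (M + N) • v i = u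
      have e2 : S.Fi (pf c (n i)) * u * S.F (pf c (n i)) * (S.Fi (pf c (n i)) * p i * zm (γ i).1) =
          S.Fi (pf c (n i)) * u * (S.F (pf c (n i)) * S.Fi (pf c (n i))) * (p i * zm (γ i).1) := by
        simp only [Matrix.mul_assoc]
      rw [Matrix.add_mul, Matrix.one_mul, e2, F_Fi, Matrix.mul_one, Matrix.add_mul, Matrix.one_mul,
        Matrix.mul_add, Matrix.add_mul]
      simp only [Matrix.mul_assoc]
    rw [e1, Ph_gamma]
    exact (Ph_fwd _ _ _ _).trans (hP' i)
  have hA2 : S.Ph ε m bb (uu (act m hh) * z) = Fs := by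
    rw [← Ph_congr hm1 hm2 hm3]
    refine hmax _ _ _ fun f hf => Ph_limit hmlim' hbb' hz' tendsto_const_nhds
      (Eventually.of_forall fun i => ?_)
    rw [hF2]; exact hf
  rw [mem_stab]
  intro s
  have := mem_Ph_trans (S := S) (ε := ε) m bb z hh s
  rw [hA1, hA2] at this
  exact this.symm

end Sys

end part12


section part13

section detL
variable {M N : ℕ}

lemma det_diff : DifferentiableAt ℝ (fun A : Big M N => A.det) 1 := by
  have : (fun A : Big M N => A.det) = fun A : Big M N => ∑ σ : Equiv.Perm (Ix M N),
      ((Equiv.Perm.sign σ : ℤ) : ℝ) * ∏ i, A (σ i) i := by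
    ext A; rw [Matrix.det_apply']
  rw [this]
  have hent : ∀ i j, DifferentiableAt ℝ (fun A : Big M N => A i j) 1 := by
    intro i j
    have h1 : DifferentiableAt ℝ (fun A : Big M N => A i) 1 := 
      (differentiableAt_pi.1 differentiableAt_id) i
    exact (differentiableAt_pi.1 h1) j
  refine DifferentiableAt.fun_sum fun σ _ => ?_
  refine DifferentiableAt.const_mul ?_ _
  have hp : ∀ T : Finset (Ix M N), DifferentiableAt ℝ (fun A : Big M N => ∏ i ∈ T, A (σ i) i) 1 := by
    classical
    intro T
    induction T using Finset.induction_on with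
    | empty => simp only [Finset.prod_empty]; exact differentiableAt_const _
    | insert a T ha ih =>
      simp only [Finset.prod_insert ha]
      exact (hent _ _).fun_mul ih
  exact hp _

/-- the derivative of the determinant at the identity -/
def dL (M N : ℕ) : Big M N →L[ℝ] ℝ := fderiv ℝ (fun A : Big M N => A.det) 1

lemma dL_has : HasFDerivAt (fun A : Big M N => A.det) (dL M N) 1 := det_diff.hasFDerivAt

lemma dL_lim (s : ℕ → ℝ) (v : ℕ → Big M N) (v0 : Big M N) (hs0 : ∀ i, s i ≠ 0)
    (hs : Tendsto s UU (𝓝 0)) (hv : Tendsto v UU (𝓝 v0))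
    (hd : ∀ i, |(1 + s i • v i : Big M N).det| = 1) : dL M N v0 = 0 := by
  have hd0 : Tendsto (fun i => s i • v i) UU (𝓝 0) := by
    have := hs.smul hv
    rwa [zero_smul] at this
  have h1 := (dL_has (M := M) (N := N)).hasFDerivWithinAt (s := Set.univ) |>.lim (l := UU) (c := fun i => (s i)⁻¹)
    (d := fun i => s i • v i) (v := v0) hd0 (by simp) (by
      refine hv.congr fun i => ?_
      rw [smul_smul, inv_mul_cancel₀ (hs0 i), one_smul])
  have hdet : Tendsto (fun i => (1 + s i • v i : Big M N).det) UU (𝓝 1) := by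
    have e1 : Tendsto (fun i => (1 : Big M N) + s i • v i) UU (𝓝 (1 + 0)) := tendsto_const_nhds.add hd0
    rw [add_zero] at e1
    have e2 := (dL_has (M := M) (N := N)).continuousAt.tendsto.comp e1
    simpa [Function.comp_def] using e2
  have hev : ∀ᶠ i in UU, (1 + s i • v i : Big M N).det = 1 := by
    filter_upwards [hdet.eventually (lt_mem_nhds (zero_lt_one))] with i hi
    have := hd i
    rwa [abs_of_pos hi] at this
  refine tendsto_nhds_unique h1 (tendsto_const_nhds.congr' ?_)
  filter_upwards [hev] with i hi
  rw [hi]; simp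

lemma dL_scalar (d : ℝ) (V : MatSpace M N) :
    dL M N (Matrix.fromBlocks (d • 1) V 0 (d • 1)) = (M + N : ℕ) * d := by
  set v : Big M N := Matrix.fromBlocks (d • 1) V 0 (d • 1) with hv
  have h1 : HasDerivAt (fun t : ℝ => (1 : Big M N) + t • v) v 0 := by
    have := ((hasDerivAt_id (0 : ℝ)).smul_const v).const_add (1 : Big M N)
    rw [one_smul] at this
    exact this
  have h2 : HasDerivAt (fun t : ℝ => ((1 : Big M N) + t • v).det) (dL M N v) 0 := by
    have h3 := dL_has (M := M) (N := N)
    rw [show (1 : Big M N) = 1 + (0 : ℝ) • v by simp] at h3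
    have := h3.comp_hasDerivAt (0 : ℝ) h1
    exact this
  have h4 : (fun t : ℝ => ((1 : Big M N) + t • v).det) = fun t => (1 + t * d) ^ (M + N) := by
    ext t
    have e1 : (1 : Big M N) + t • v = Matrix.fromBlocks ((1 + t * d) • 1) (t • V) 0 ((1 + t * d) • 1) := by
      rw [hv, ← Matrix.fromBlocks_one, Matrix.fromBlocks_smul, Matrix.fromBlocks_add]
      simp [add_smul, smul_smul]
    rw [e1, Matrix.det_fromBlocks_zero₂₁, Matrix.det_smul, Matrix.det_smul]
    simp [pow_add]
  have h5 : HasDerivAt (fun t : ℝ => (1 + t * d) ^ (M + N)) ((M + N : ℕ) * d) 0 := by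
    have := (((hasDerivAt_id (0 : ℝ)).mul_const d).const_add 1).fun_pow (M + N)
    have e : ((M + N : ℕ) : ℝ) * (1 + id 0 * d) ^ (M + N - 1) * (1 * d) = (M + N : ℕ) * d := by
      simp
    rw [e] at this
    exact this
  rw [h4] at h2
  exact h2.unique h5

end detL

namespace Sys
variable {M N : ℕ} {E : Type*} {S : Sys M N E} {ε : ℝ} {pi : (ℕ → E) → MatSpace M N}

lemma drift1 [Finite E] [Nonempty E] (h : S.IsCod pi) (hε : 0 < ε) (Fs : Set (MatSpace M N))
    (hFs : ∃ q b y, S.Ph ε q b y = Fs) (h0 : (0 : MatSpace M N) ∈ Fs)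
    (hmax : ∀ q b y, Fs ⊆ S.Ph ε q b y → S.Ph ε q b y = Fs) :
    ∃ C0 C1 : ℝ, 0 < C0 ∧ 0 < C1 ∧ ∀ η > 0, ∃ (v : Big M N) (q : Qg M N), η ≤ ‖v‖ ∧ ‖v‖ ≤ C0 * η ∧
      ‖v.toBlocks₁₂‖ ≤ C1 * (‖v.toBlocks₁₁‖ + ‖v.toBlocks₂₁‖ + ‖v.toBlocks₂₂‖) ∧
      dL M N v = 0 ∧ ∀ c, rot q (PP v (pi c)) ∈ stab Fs := by
  obtain ⟨C0, C1, hC0, hC1, hp⟩ := pairs h hε Fs hFs h0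
  refine ⟨C0, C1, hC0, hC1, fun η hη => ?_⟩
  choose q q' b b' p v hP hP' hsc hs hB hC hv1 hv2 hv3 using fun i : ℕ => hp η hη (1 / (i + 1 : ℝ))
    (by positivity)
  have hlim1 : Tendsto (fun i : ℕ => 1 / (i + 1 : ℝ)) UU (𝓝 0) :=
    tendsto_one_div_add_atTop_nhds_zero_nat.mono_left UU_le
  have hs0 : Tendsto (fun i => sc (q i)) UU (𝓝 0) :=
    squeeze_zero (fun i => (sc_pos _).le) (fun i => (hs i).le) hlim1
  have hpos : ∀ i, 0 < sc (q i) ^ (M + N) := fun i => pow_pos (sc_pos _) _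
  have hD0 : M + N ≠ 0 := by have := S.hM; omega
  set vh : ℕ → Big M N := fun i => (sc (q i) ^ (M + N))⁻¹ • v i with hvh
  have hvv : ∀ i, sc (q i) ^ (M + N) • vh i = v i := fun i => by
    simp only [hvh]; rw [smul_smul, mul_inv_cancel₀ (hpos i).ne', one_smul]
  have hn : ∀ i, ‖v i‖ = sc (q i) ^ (M + N) * ‖vh i‖ := fun i => by
    rw [← hvv i, norm_smul, Real.norm_of_nonneg (hpos i).le]
  have hvh1 : ∀ i, η ≤ ‖vh i‖ := fun i => by
    have := hv1 i
    rw [hn, mul_comm] at this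
    exact le_of_mul_le_mul_left this (hpos i)
  have hvh2 : ∀ i, ‖vh i‖ ≤ C0 * η := fun i => by
    have := hv2 i
    rw [hn, ← mul_assoc, mul_comm (C0 * η)] at this
    exact le_of_mul_le_mul_left this (hpos i)
  have hvh3 : ∀ i, ‖(vh i).toBlocks₁₂‖ ≤ C1 * (‖(vh i).toBlocks₁₁‖ + ‖(vh i).toBlocks₂₁‖ +
      ‖(vh i).toBlocks₂₂‖) := fun i => by
    have e1 : (vh i).toBlocks₁₁ = (sc (q i) ^ (M + N))⁻¹ • (v i).toBlocks₁₁ := rfl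
    have e2 : (vh i).toBlocks₁₂ = (sc (q i) ^ (M + N))⁻¹ • (v i).toBlocks₁₂ := rfl
    have e3 : (vh i).toBlocks₂₁ = (sc (q i) ^ (M + N))⁻¹ • (v i).toBlocks₂₁ := rfl
    have e4 : (vh i).toBlocks₂₂ = (sc (q i) ^ (M + N))⁻¹ • (v i).toBlocks₂₂ := rfl
    have hi := (inv_pos.2 (hpos i)).le
    rw [e1, e2, e3, e4, norm_smul, norm_smul, norm_smul, norm_smul, Real.norm_of_nonneg hi]
    have := mul_le_mul_of_nonneg_left (hv3 i) hi
    linarith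
  obtain ⟨v0, hv0, hv0lim⟩ := ulim_ball vh _ hvh2
  obtain ⟨qq, hqq⟩ := rot_lim (fun i => (q i)⁻¹)
  have hone : ∀ {n : ℕ} (f : ℕ → Matrix (Fin n) (Fin n) ℝ), (∀ i : ℕ, ‖f i - 1‖ < 1 / (i + 1 : ℝ)) →
      Tendsto f UU (𝓝 1) := by
    intro n f hf
    refine tendsto_iff_norm_sub_tendsto_zero.2 ?_
    exact squeeze_zero (fun i => norm_nonneg _) (fun i => (hf i).le) hlim1
  refine ⟨v0, qq, ge_of_tendsto hv0lim.norm (Eventually.of_forall hvh1), hv0, ?_, ?_, ?_⟩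
  · exact le_of_tendsto_of_tendsto' (b12_lim hv0lim).norm
      ((((b11_lim hv0lim).norm.add (b21_lim hv0lim).norm).add (b22_lim hv0lim).norm).const_mul C1) hvh3
  · refine dL_lim (fun i => sc (q i) ^ (M + N)) vh v0 (fun i => (hpos i).ne') ?_ hv0lim ?_
    · have := hs0.pow (M + N)
      rwa [zero_pow hD0] at this
    · intro i
      rw [hvv]
      have g1 : S.Good ε (b i) (p i) := by
        rw [← zero_mem_Ph (q := q i), hP]; exact h0
      have g2 : S.Good ε (b' i) ((1 + v i) * p i) := by
        rw [← zero_mem_Ph (q := q' i), hP']; exact h0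
      have := g2.1
      rwa [Matrix.det_mul, abs_mul, g1.1, mul_one] at this
  · intro c
    refine transfer h hε Fs h0 hmax q q' b b' p vh hP (fun i => by rw [hvv]; exact hP' i) hsc ?_ hs0
      (hone _ hB) (hone _ hC) v0 hv0lim qq hqq c
    intro i
    refine (hs i).le.trans ?_
    rw [div_le_one (by positivity)]
    have : (0 : ℝ) ≤ i := by positivity
    linarith

lemma rot_smul (q : Qg M N) (r : ℝ) (s : MatSpace M N) : rot q (r • s) = r • rot q s :=
  (rotL q).map_smul r s

lemma drift [Finite E] [Nonempty E] (h : S.IsCod pi) (hε : 0 < ε) (Fs : Set (MatSpace M N))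
    (hFs : ∃ q b y, S.Ph ε q b y = Fs) (h0 : (0 : MatSpace M N) ∈ Fs)
    (hmax : ∀ q b y, Fs ⊆ S.Ph ε q b y → S.Ph ε q b y = Fs) :
    ∃ (v : Big M N) (q : Qg M N), ¬ (v.toBlocks₁₁ = 0 ∧ v.toBlocks₂₁ = 0 ∧ v.toBlocks₂₂ = 0) ∧
      dL M N v = 0 ∧ ∀ c, ∀ r : ℝ, r • rot q (PP v (pi c)) ∈ stab Fs := by
  letI : TopologicalSpace E := ⊥
  haveI : DiscreteTopology E := ⟨rfl⟩
  obtain ⟨C0, C1, hC0, hC1, hp⟩ := drift1 h hε Fs hFs h0 hmax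
  have hcl : IsClosed (stab Fs : Set (MatSpace M N)) := by
    obtain ⟨q, b, y, hq⟩ := hFs
    exact stab_isClosed (hq ▸ isClosed_Ph q b y)
  choose v q hv1 hv2 hv3 hv4 hv5 using fun i : ℕ => hp (1 / (i + 1 : ℝ)) (by positivity)
  have hvpos : ∀ i, 0 < ‖v i‖ := fun i => lt_of_lt_of_le (by positivity) (hv1 i)
  have hlim1 : Tendsto (fun i : ℕ => 1 / (i + 1 : ℝ)) UU (𝓝 0) :=
    tendsto_one_div_add_atTop_nhds_zero_nat.mono_left UU_le
  have hvlim : Tendsto (fun i => ‖v i‖) UU (𝓝 0) := by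
    refine squeeze_zero (fun i => (hvpos i).le) hv2 ?_
    have := hlim1.const_mul C0
    rwa [mul_zero] at this
  set u : ℕ → Big M N := fun i => ‖v i‖⁻¹ • v i with hu
  have hun : ∀ i, ‖u i‖ = 1 := fun i => by
    simp only [hu]
    rw [norm_smul, norm_inv, norm_norm, inv_mul_cancel₀ (hvpos i).ne']
  have huv : ∀ i, v i = ‖v i‖ • u i := fun i => by
    simp only [hu]
    rw [smul_smul, mul_inv_cancel₀ (hvpos i).ne', one_smul]
  obtain ⟨u0, -, hu0⟩ := ulim_ball u 1 (fun i => (hun i).le)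
  have hu0n : ‖u0‖ = 1 := by
    have := hu0.norm
    simp only [hun] at this
    exact (tendsto_nhds_unique tendsto_const_nhds this).symm
  obtain ⟨qq, hqq⟩ := rot_lim q
  refine ⟨u0, qq, ?_, ?_, ?_⟩
  · rintro ⟨e1, e2, e3⟩
    have hu3 : ∀ i, ‖(u i).toBlocks₁₂‖ ≤ C1 * (‖(u i).toBlocks₁₁‖ + ‖(u i).toBlocks₂₁‖ +
      ‖(u i).toBlocks₂₂‖) := fun i => by
      have e1 : (u i).toBlocks₁₁ = ‖v i‖⁻¹ • (v i).toBlocks₁₁ := rfl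
      have e2 : (u i).toBlocks₁₂ = ‖v i‖⁻¹ • (v i).toBlocks₁₂ := rfl
      have e3 : (u i).toBlocks₂₁ = ‖v i‖⁻¹ • (v i).toBlocks₂₁ := rfl
      have e4 : (u i).toBlocks₂₂ = ‖v i‖⁻¹ • (v i).toBlocks₂₂ := rfl
      have hi := (inv_pos.2 (hvpos i)).le
      rw [e1, e2, e3, e4, norm_smul, norm_smul, norm_smul, norm_smul, Real.norm_of_nonneg hi]
      have := mul_le_mul_of_nonneg_left (hv3 i) hi
      linarith
    have h12 := le_of_tendsto_of_tendsto' (b12_lim hu0).norm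
      ((((b11_lim hu0).norm.add (b21_lim hu0).norm).add (b22_lim hu0).norm).const_mul C1) hu3
    have hb := norm_blocks u0
    rw [e1, e2, e3] at h12 hb
    simp only [norm_zero, add_zero, mul_zero, zero_add] at h12 hb
    linarith
  · have e1 : Tendsto (fun i => dL M N (u i)) UU (𝓝 (dL M N u0)) :=
      ((dL M N).continuous.tendsto u0).comp hu0
    refine tendsto_nhds_unique e1 (tendsto_const_nhds.congr fun i => ?_)
    simp only [hu]
    rw [map_smul, hv4, smul_zero]
  · intro c r
    have e1 := hqq _ _ (PP_lim hu0 (tendsto_const_nhds (x := pi c)))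
    have e2 : Tendsto (fun i => (⌊r / ‖v i‖⌋ : ℝ) * ‖v i‖) UU (𝓝 r) := by
      rw [tendsto_iff_norm_sub_tendsto_zero]
      refine squeeze_zero (fun i => norm_nonneg _) (fun i => ?_) hvlim
      have hp := hvpos i
      have f1 := Int.floor_le (r / ‖v i‖)
      have f2 := Int.lt_floor_add_one (r / ‖v i‖)
      rw [le_div_iff₀ hp] at f1
      rw [div_lt_iff₀ hp] at f2
      rw [Real.norm_eq_abs, abs_le]
      constructor <;> linarith
    refine hcl.mem_of_tendsto (e2.smul e1) (Eventually.of_forall fun i => ?_)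
    have e3 : ((⌊r / ‖v i‖⌋ : ℝ) * ‖v i‖) • rot (q i) (PP (u i) (pi c)) =
        ⌊r / ‖v i‖⌋ • rot (q i) (PP (v i) (pi c)) := by
      conv_rhs => rw [huv i, PP_smul, rot_smul, norm_smul, norm_norm, hun, mul_one]
      rw [← smul_smul, Int.cast_smul_eq_zsmul]
    show _ ∈ stab Fs
    rw [e3]
    exact (stab Fs).zsmul_mem (hv5 i c) _

end Sys

end part13


section part14

section basis
variable {M N : ℕ}

lemma uu_row (s : MatSpace M N) (A : Big M N) (i : Fin N) (j : Ix M N) :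
    (uu s * A) (Sum.inr i) j = A (Sum.inr i) j := by
  simp [uu, Matrix.mul_apply, Fintype.sum_sum_type, Matrix.one_apply]

lemma dg_row (q : Qg M N) (A : Big M N) (i : Fin N) (j : Ix M N) :
    (dg q * A) (Sum.inr i) j = (sc q)⁻¹ ^ M * ∑ k, lC q i k * A (Sum.inr k) j := by
  simp [dg, Matrix.mul_apply, Fintype.sum_sum_type, Finset.mul_sum, mul_assoc]

lemma uu_col (s : MatSpace M N) (A : Big M N) (i : Ix M N) (j : Fin M) :
    (A * uu s) i (Sum.inl j) = A i (Sum.inl j) := by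
  simp [uu, Matrix.mul_apply, Fintype.sum_sum_type, Matrix.one_apply]

lemma dg_col (q : Qg M N) (A : Big M N) (i : Ix M N) (j : Fin M) :
    (A * dg q) i (Sum.inl j) = sc q ^ N * ∑ k, A i (Sum.inl k) * lB q k j := by
  simp [dg, Matrix.mul_apply, Fintype.sum_sum_type, Finset.mul_sum, mul_left_comm]

lemma ent_le {m n : Type*} [Fintype m] [Fintype n] (A : Matrix m n ℝ) (i : m) (j : n) : |A i j| ≤ ‖A‖ :=
  (Real.norm_eq_abs _).symm.le.trans (Matrix.norm_entry_le_entrywise_sup_norm A)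

lemma sum_bd {k : ℕ} (f g : Fin k → ℝ) (a c : ℝ) (ha : ∀ i, |f i| ≤ a) (hc : ∀ i, |g i| ≤ c) :
    |∑ i, f i * g i| ≤ k * (a * c) := by
  refine (Finset.abs_sum_le_sum_abs _ _).trans ?_
  refine (Finset.sum_le_card_nsmul _ _ (a * c) fun i _ => ?_).trans (by simp)
  rw [abs_mul]
  exact mul_le_mul (ha i) (hc i) (abs_nonneg _) ((abs_nonneg _).trans (ha i))

end basis

namespace Sys
variable {M N : ℕ} {E : Type*} {S : Sys M N E} {ε : ℝ} {pi : (ℕ → E) → MatSpace M N}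

lemma small_basis (hε : 0 < ε) {b : ℕ → E} {y : Big M N} (g : S.Good ε b y) (η : ℝ) (hη : 0 < η) :
    ∃ (γ : (Matrix (Ix M N) (Ix M N) ℤ)ˣ) (Yi : Big M N), y * zm γ.1 * Yi = 1 ∧ Yi * (y * zm γ.1) = 1 ∧
      (∀ i j, |(y * zm γ.1) (Sum.inr i) j| ≤ η) ∧ ∀ i j, |Yi i (Sum.inl j)| ≤ η := by
  obtain ⟨R, hR, hmah⟩ := mahler_bdd (ι := Ix M N) ε hε
  obtain ⟨C, hC, hinv⟩ := inv_bd (ι := Ix M N) R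
  have hlim : Tendsto (fun n => S.hi ^ n * (N * (1 * R) + M * (C * 1))) atTop (𝓝 0) := by
    have := (hi_pow_tendsto (S := S)).mul_const ((N : ℝ) * (1 * R) + M * (C * 1))
    rwa [zero_mul] at this
  obtain ⟨n, hn⟩ := (hlim.eventually (gt_mem_nhds hη)).exists
  have hx : XX ε (S.F (bw b n) * y) := by
    have := g.2 n []
    rwa [S.Fi_nil, Matrix.one_mul] at this
  have hdet : |(S.F (bw b n) * y).det| = 1 := by
    rw [Matrix.det_mul, abs_mul, S.abs_det_F, g.1, one_mul]
  obtain ⟨γ, hγ⟩ := hmah _ hdet hx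
  obtain ⟨zi, h1, h2, h3⟩ := hinv (S.F (bw b n) * y * zm γ.1) hγ (by
    rw [Matrix.det_mul, abs_mul, hdet, abs_det_zm, one_mul])
  set z := S.F (bw b n) * y * zm γ.1 with hz
  have hY : y * zm γ.1 = S.Fi (bw b n) * z := by
    rw [hz, Matrix.mul_assoc (S.F (bw b n)), ← Matrix.mul_assoc (S.Fi (bw b n)), S.Fi_F, Matrix.one_mul]
  set w := bw b n with hw
  set t := S.tw w with ht
  have hsc : sc t ≤ S.hi ^ n := by
    have := S.sc_tw_le w
    rwa [hw, bw_length] at this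
  have hsc1 : sc t ≤ 1 := hsc.trans (pow_le_one₀ S.hi_pos.le S.hi_lt.le)
  have hpw : ∀ k : ℕ, 1 ≤ k → sc t ^ k ≤ S.hi ^ n := fun k hk => by
    have := pow_le_pow_of_le_one (sc_pos t).le hsc1 hk
    rw [pow_one] at this
    exact this.trans hsc
  have hhi : 0 < S.hi ^ n := pow_pos S.hi_pos _
  refine ⟨γ, zi * S.F w, ?_, ?_, ?_, ?_⟩
  · rw [hY, Matrix.mul_assoc, ← Matrix.mul_assoc z, h1, Matrix.one_mul, S.Fi_F]
  · rw [hY, Matrix.mul_assoc, ← Matrix.mul_assoc (S.F w), S.F_Fi, Matrix.one_mul, h2]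
  · intro i j
    rw [hY]
    show |(dg t⁻¹ * uu (-S.xw w) * z) (Sum.inr i) j| ≤ η
    rw [Matrix.mul_assoc, dg_row, sc_inv, inv_inv, abs_mul, abs_of_pos (pow_pos (sc_pos t) M)]
    simp only [uu_row]
    have e1 := sum_bd (fun k => lC t⁻¹ i k) (fun k => z (Sum.inr k) j) 1 R
      (fun k => (ent_le _ _ _).trans (lC_norm _)) (fun k => (ent_le _ _ _).trans hγ)
    have e2 := mul_le_mul (hpw M S.hM) e1 (abs_nonneg _) hhi.le
    refine e2.trans (le_trans ?_ hn.le)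
    refine mul_le_mul_of_nonneg_left ?_ hhi.le
    have : 0 ≤ (M : ℝ) * (C * 1) := by positivity
    linarith
  · intro i j
    show |(zi * (uu (S.xw w) * dg t)) i (Sum.inl j)| ≤ η
    rw [← Matrix.mul_assoc, dg_col, abs_mul, abs_of_pos (pow_pos (sc_pos t) N)]
    simp only [uu_col]
    have e1 := sum_bd (fun k => zi i (Sum.inl k)) (fun k => lB t k j) C 1
      (fun k => (ent_le _ _ _).trans h3) (fun k => (ent_le _ _ _).trans (lB_norm _))
    have e2 := mul_le_mul (hpw N S.hN) e1 (abs_nonneg _) hhi.le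
    refine e2.trans (le_trans ?_ hn.le)
    refine mul_le_mul_of_nonneg_left ?_ hhi.le
    have : 0 ≤ (N : ℝ) * (1 * R) := by positivity
    linarith

end Sys

section kill
variable {M N : ℕ}

lemma noscalar {n m : Type*} [Fintype n] [DecidableEq n] [Fintype m] (D : Matrix n n ℝ)
    (Q : Matrix n m ℝ) (Ri : Matrix m n ℝ) (hQ : Q * Ri = 1)
    (h1 : ∀ j, ∃ c : ℝ, D *ᵥ (fun i => Q i j) = c • (fun i => Q i j))
    (h2 : ∀ j k, ∃ c : ℝ, D *ᵥ ((fun i => Q i j) + fun i => Q i k) = c • ((fun i => Q i j) + fun i => Q i k)) :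
    ∃ d : ℝ, D = d • 1 := by
  suffices h : ∃ d : ℝ, ∀ j, D *ᵥ (fun i => Q i j) = d • (fun i => Q i j) by
    obtain ⟨d, hd⟩ := h
    refine ⟨d, ?_⟩
    have e : D * Q = d • Q := by
      ext i j
      have := congrFun (hd j) i
      simpa [Matrix.mulVec, dotProduct, Matrix.mul_apply] using this
    calc D = D * Q * Ri := by rw [Matrix.mul_assoc, hQ, Matrix.mul_one]
      _ = d • 1 := by rw [e, Matrix.smul_mul, hQ]
  by_cases h0 : ∀ j, (fun i => Q i j) = 0
  · refine ⟨0, fun j => ?_⟩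
    rw [h0 j, Matrix.mulVec_zero, smul_zero]
  push Not at h0
  obtain ⟨j0, hj0⟩ := h0
  choose c hc using h1
  refine ⟨c j0, fun j => ?_⟩
  obtain ⟨c', hc'⟩ := h2 j0 j
  have ha := hc j0
  have hb := hc j
  rw [Matrix.mulVec_add, ha, hb] at hc'
  generalize (fun i => Q i j0) = a at *
  generalize (fun i => Q i j) = b at *
  have e1 : (c j0 - c') • a = (c' - c j) • b := by
    rw [smul_add] at hc'
    rw [sub_smul, sub_smul, sub_eq_sub_iff_add_eq_add, hc', add_comm]
  by_cases hcj : c' = c j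
  · rw [hcj, sub_self, zero_smul] at e1
    rcases smul_eq_zero.1 e1 with e | e
    · rw [hb, sub_eq_zero.1 e]
    · exact absurd e hj0
  · have e2 : b = ((c' - c j)⁻¹ * (c j0 - c')) • a := by
      rw [← smul_smul, e1, smul_smul, inv_mul_cancel₀ (sub_ne_zero.2 hcj), one_smul]
    rw [e2, Matrix.mulVec_smul, ha, smul_comm]

lemma exists_functional {n : Type*} [Fintype n] (u v : n → ℝ) (h : ∀ c : ℝ, v ≠ c • u) :
    ∃ f : n → ℝ, f ⬝ᵥ u = 0 ∧ f ⬝ᵥ v = 1 := by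
  by_cases hu : u ⬝ᵥ u = 0
  · have hu0 : u = 0 := dotProduct_self_eq_zero.1 hu
    have hv : v ≠ 0 := by simpa using h 0
    refine ⟨(v ⬝ᵥ v)⁻¹ • v, by simp [hu0], ?_⟩
    rw [smul_dotProduct, smul_eq_mul, inv_mul_cancel₀]
    exact fun e => hv (dotProduct_self_eq_zero.1 e)
  · set f := v - ((v ⬝ᵥ u) / (u ⬝ᵥ u)) • u with hf
    have hf0 : f ≠ 0 := fun e => h _ (sub_eq_zero.1 e)
    have hff : f ⬝ᵥ f ≠ 0 := fun e => hf0 (dotProduct_self_eq_zero.1 e)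
    have hfu : f ⬝ᵥ u = 0 := by
      rw [hf, sub_dotProduct, smul_dotProduct, smul_eq_mul, div_mul_cancel₀ _ hu, sub_self]
    refine ⟨(f ⬝ᵥ f)⁻¹ • f, ?_, ?_⟩
    · rw [smul_dotProduct, hfu, smul_zero]
    · have : f ⬝ᵥ v = f ⬝ᵥ f := by
        conv_rhs => rw [hf, dotProduct_sub, ← hf, dotProduct_smul, hfu, smul_zero, sub_zero]
      rw [smul_dotProduct, this, smul_eq_mul, inv_mul_cancel₀ hff]

lemma uu_mulVec_inl (s : MatSpace M N) (x : Ix M N → ℝ) (i : Fin M) :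
    (uu s *ᵥ x) (Sum.inl i) = x (Sum.inl i) + (s *ᵥ fun k => x (Sum.inr k)) i := by
  simp [uu, Matrix.mulVec, dotProduct, Fintype.sum_sum_type, Matrix.one_apply]

lemma uu_mulVec_inr (s : MatSpace M N) (x : Ix M N → ℝ) (i : Fin N) :
    (uu s *ᵥ x) (Sum.inr i) = x (Sum.inr i) := by
  simp [uu, Matrix.mulVec, dotProduct, Fintype.sum_sum_type, Matrix.one_apply]

lemma kill_vec {ε η : ℝ} (hη0 : 0 ≤ η) (hη : η < ε) {s : MatSpace M N} {Y : Big M N} (hX : XX ε (uu s * Y))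
    (z : Ix M N → ℤ) (hz : z ≠ 0) (hq : ∀ i, |(Y *ᵥ zc z) (Sum.inr i)| ≤ η)
    (hs : (s *ᵥ fun k => (Y *ᵥ zc z) (Sum.inr k)) = -fun i => (Y *ᵥ zc z) (Sum.inl i)) : False := by
  have h1 := hX z hz
  rw [← Matrix.mulVec_mulVec] at h1
  have h2 : ‖uu s *ᵥ (Y *ᵥ zc z)‖ ≤ η := by
    refine (pi_norm_le_iff_of_nonneg hη0).2 ?_
    rintro (i | i)
    · rw [uu_mulVec_inl, hs]; simpa using hη0
    · rw [uu_mulVec_inr]; exact hq i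
  linarith

lemma kill_row {R η : ℝ} (hη : 0 ≤ η) (hR : 0 ≤ R) (hsm : (M + N : ℕ) * (η * R) < 1) {s : MatSpace M N}
    {y Yi : Big M N} (γ γ' : (Matrix (Ix M N) (Ix M N) ℤ)ˣ)
    (hYi : Yi * (y * zm γ.1) = 1) (hYi2 : y * zm γ.1 * Yi = 1) (hb : ‖uu s * y * zm γ'.1‖ ≤ R) (i : Ix M N)
    (hp : ∀ k, |Yi i (Sum.inl k)| ≤ η) 
    (hs : ∀ k, Yi i (Sum.inr k) = ∑ l, Yi i (Sum.inl l) * s l k) : False := by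
  set g := γ⁻¹ * γ' with hg
  have e1 : Yi * y = zm γ⁻¹.1 := by
    have : Yi * y = Yi * y * (zm γ.1 * zm γ⁻¹.1) := by rw [Sys.zm_inv, Matrix.mul_one]
    rw [this, ← Matrix.mul_assoc, Matrix.mul_assoc Yi, hYi, Matrix.one_mul]
  have e2 : (Yi * uu (-s)) * (uu s * y * zm γ'.1) = zm g.1 := by
    rw [hg, Units.val_mul, zm_mul, ← e1]
    simp only [Matrix.mul_assoc]
    rw [← Matrix.mul_assoc (uu (-s)), uu_mul, neg_add_cancel, uu_zero, Matrix.one_mul]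
  have hrow : ∀ j, |(Yi * uu (-s)) i j| ≤ η := by
    rintro (k | k)
    · rw [uu_col]; exact hp k
    · have : (Yi * uu (-s)) i (Sum.inr k) = 0 := by
        simp [uu, Matrix.mul_apply, Fintype.sum_sum_type, Matrix.one_apply, hs]
      rw [this, abs_zero]; exact hη
  have hz : ∀ j, g.1 i j = 0 := by
    intro j
    have h1 : |((g.1 i j : ℤ) : ℝ)| < 1 := by
      have : ((g.1 i j : ℤ) : ℝ) = zm g.1 i j := rfl
      rw [this, ← e2, Matrix.mul_apply]
      refine lt_of_le_of_lt ((Finset.abs_sum_le_sum_abs _ _).trans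
        (Finset.sum_le_card_nsmul _ _ (η * R) fun k _ => ?_)) ?_
      · rw [abs_mul]
        exact mul_le_mul (hrow k) ((ent_le _ _ _).trans hb) (abs_nonneg _) hη
      · simpa using hsm
    have h2 : |g.1 i j| < 1 := by exact_mod_cast h1
    exact Int.abs_lt_one_iff.1 h2
  have h3 : (g.1 * g⁻¹.1) i i = 1 := by rw [← Units.val_mul, mul_inv_cancel]; simp
  rw [Matrix.mul_apply] at h3
  simp [hz] at h3

end kill

end part14


section part15

namespace Sys
variable {M N : ℕ} {E : Type*} {S : Sys M N E} {ε : ℝ} {pi : (ℕ → E) → MatSpace M N}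

lemma outer_mul {m n : Type*} [Fintype n] (p : m → ℝ) (f u : n → ℝ) :
    Matrix.vecMulVec p f *ᵥ u = (f ⬝ᵥ u) • p := by
  ext i
  simp only [Matrix.mulVec, dotProduct, Matrix.vecMulVec_apply, Pi.smul_apply, smul_eq_mul, Finset.sum_mul]
  exact Finset.sum_congr rfl fun a _ => by ring

/-- The case analysis ending in a contradiction. -/
lemma contra_aux [Finite E] [Nonempty E] (h : S.IsCod pi) (hε : 0 < ε) {b : ℕ → E} {y : Big M N}
    (W : Submodule ℝ (MatSpace M N)) (v : Big M N)
    (hv : ¬ (v.toBlocks₁₁ = 0 ∧ v.toBlocks₂₁ = 0 ∧ v.toBlocks₂₂ = 0)) (hdL : dL M N v = 0)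
    (hW : ∀ c, PP v (pi c) ∈ W) (B1 B1' : Matrix (Fin M) (Fin M) ℝ) (C1 C1' : Matrix (Fin N) (Fin N) ℝ)
    (hB : B1 * B1' = 1) (hC : C1 * C1' = 1) (hG : ∀ h ∈ W, S.Good ε b (uu (B1 * h * C1) * y)) : False := by
  have hB' : B1' * B1 = 1 := mul_eq_one_comm.1 hB
  have hC' : C1' * C1 = 1 := mul_eq_one_comm.1 hC
  have hMpos : 0 < M := S.hM
  have hNpos : 0 < N := S.hN
  have g0 : S.Good ε b y := by
    have := hG 0 W.zero_mem
    rwa [Matrix.mul_zero, Matrix.zero_mul, uu_zero, Matrix.one_mul] at this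
  obtain ⟨R, hR, hmah⟩ := mahler_bdd (ι := Ix M N) ε hε
  obtain ⟨η, hη, hη1, hη2⟩ : ∃ η : ℝ, 0 < η ∧ 2 * η < ε ∧ (M + N : ℕ) * (η * R) < 1 := by
    have hD : (0 : ℝ) < (M + N : ℕ) := by exact_mod_cast (by omega)
    refine ⟨min (ε / 4) (1 / (2 * ((M + N : ℕ) * R))), by positivity, ?_, ?_⟩
    · have := min_le_left (ε / 4) (1 / (2 * (((M + N : ℕ) : ℝ) * R)))
      linarith
    · have := min_le_right (ε / 4) (1 / (2 * (((M + N : ℕ) : ℝ) * R)))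
      calc ((M + N : ℕ) : ℝ) * (min (ε / 4) (1 / (2 * ((M + N : ℕ) * R))) * R) 
          ≤ (M + N : ℕ) * (1 / (2 * ((M + N : ℕ) * R)) * R) := by gcongr
        _ = 1 / 2 := by field_simp
        _ < 1 := by norm_num
  obtain ⟨γ, Yi, hY1, hY2, hYq, hYp⟩ := small_basis hε g0 η hη
  set Y := y * zm γ.1 with hYdef
  have hX : ∀ h ∈ W, XX ε (uu (B1 * h * C1) * Y) := fun x hx => by
    have := XX_gamma (hG x hx).xx γ
    rwa [Matrix.mul_assoc] at this
  -- solving for a prescribed image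
  have solve : ∀ z : Ix M N → ℤ, z ≠ 0 → (∀ i, |(Y *ᵥ zc z) (Sum.inr i)| ≤ 2 * η) → 
      ∀ x ∈ W, x *ᵥ (C1 *ᵥ fun k => (Y *ᵥ zc z) (Sum.inr k)) = -(B1' *ᵥ fun i => (Y *ᵥ zc z) (Sum.inl i)) →
      False := by
    intro z hz hq x hx he
    refine kill_vec (by positivity) hη1 (hX x hx) z hz hq ?_
    rw [← Matrix.mulVec_mulVec, ← Matrix.mulVec_mulVec, he, Matrix.mulVec_neg, Matrix.mulVec_mulVec, hB,
      Matrix.one_mulVec]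
  set Q : Matrix (Fin N) (Ix M N) ℝ := C1 * Matrix.of fun i j => Y (Sum.inr i) j with hQ
  have hQR : Q * ((Matrix.of fun j k => Yi j (Sum.inr k)) * C1') = 1 := by
    rw [hQ, Matrix.mul_assoc, ← Matrix.mul_assoc (Matrix.of _)]
    have : (Matrix.of fun i j => Y (Sum.inr i) j) * (Matrix.of fun j k => Yi j (Sum.inr k)) =
        (1 : Matrix (Fin N) (Fin N) ℝ) := by
      ext i k
      have := congrFun (congrFun hY1 (Sum.inr i)) (Sum.inr k)
      rw [Matrix.mul_apply] at this ⊢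
      rw [Matrix.one_apply] at this ⊢
      simpa using this
    rw [this, Matrix.one_mul, hC]
  -- the lattice vectors used
  have v1 : ∀ j : Ix M N, ∃ z : Ix M N → ℤ, z ≠ 0 ∧ (∀ i, |(Y *ᵥ zc z) (Sum.inr i)| ≤ 2 * η) ∧
      (C1 *ᵥ fun k => (Y *ᵥ zc z) (Sum.inr k)) = fun i => Q i j := by
    intro j
    have e : zc (Pi.single j (1 : ℤ)) = Pi.single j (1 : ℝ) := by
      ext i
      by_cases hij : i = j
      · subst hij; simp [zc]
      · simp [zc, hij]
    have e2 : Y *ᵥ zc (Pi.single j (1 : ℤ)) = fun i => Y i j := by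
      rw [e]; ext i; simp
    refine ⟨Pi.single j 1, by simp, fun i => ?_, ?_⟩
    · rw [e2]
      exact (hYq i j).trans (by linarith)
    · rw [e2]
      rfl
  have v2 : ∀ j l : Ix M N, ∃ z : Ix M N → ℤ, z ≠ 0 ∧ (∀ i, |(Y *ᵥ zc z) (Sum.inr i)| ≤ 2 * η) ∧
      (C1 *ᵥ fun k => (Y *ᵥ zc z) (Sum.inr k)) = (fun i => Q i j) + fun i => Q i l := by
    intro j l
    have e : zc (Pi.single j (1 : ℤ) + Pi.single l (1 : ℤ)) = Pi.single j (1 : ℝ) + Pi.single l (1 : ℝ) := by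
      ext i
      by_cases hij : i = j <;> by_cases hil : i = l
      · subst hij; subst hil; simp [zc]; norm_num
      · subst hij; simp [zc, hil]
      · subst hil; simp [zc, hij]
      · simp [zc, hij, hil]
    have e2 : Y *ᵥ zc (Pi.single j (1 : ℤ) + Pi.single l (1 : ℤ)) = (fun i => Y i j) + fun i => Y i l := by
      rw [e, Matrix.mulVec_add]; ext i; simp
    refine ⟨Pi.single j 1 + Pi.single l 1, ?_, fun i => ?_, ?_⟩
    · intro hz
      have := congrFun hz j
      by_cases hjl : j = l
      · subst hjl; simp at this
      · simp [hjl] at this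
    · rw [e2]
      refine (abs_add_le _ _).trans ?_
      linarith [hYq i j, hYq i l]
    · rw [e2]
      have : (fun k => ((fun i => Y i j) + fun i => Y i l) (Sum.inr k)) =
        (fun k => Y (Sum.inr k) j) + fun k => Y (Sum.inr k) l := rfl
      rw [this, Matrix.mulVec_add]
      rfl
  obtain ⟨hp1, hp2⟩ := poly_span h W v hW
  by_cases h21 : v.toBlocks₂₁ = 0
  swap
  · have hWt := hp1 h21
    have : ∃ j, (fun i => Q i j) ≠ 0 := by
      by_contra hcon
      push Not at hcon
      have hQ0 : Q = 0 := by
        ext i j; exact congrFun (hcon j) i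
      rw [hQ0, Matrix.zero_mul] at hQR
      have := congrFun (congrFun hQR ⟨0, hNpos⟩) ⟨0, hNpos⟩
      simp at this
    obtain ⟨j, hj⟩ := this
    obtain ⟨z, hz, hq, hz2⟩ := v1 j
    obtain ⟨f, -, hf⟩ := exists_functional (0 : Fin N → ℝ) (fun i => Q i j) (by simpa using hj)
    refine solve z hz hq (Matrix.vecMulVec (-(B1' *ᵥ fun i => (Y *ᵥ zc z) (Sum.inl i))) f) 
      (by rw [hWt]; trivial) ?_
    rw [hz2, outer_mul, hf, one_smul]
  have hW2 := hp2 h21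
  set A := v.toBlocks₁₁ with hA
  set D := v.toBlocks₂₂ with hD
  have key : ∀ z : Ix M N → ℤ, z ≠ 0 → (∀ i, |(Y *ᵥ zc z) (Sum.inr i)| ≤ 2 * η) → 
      ∃ c : ℝ, D *ᵥ (C1 *ᵥ fun k => (Y *ᵥ zc z) (Sum.inr k)) = c • (C1 *ᵥ fun k => (Y *ᵥ zc z) (Sum.inr k)) := by
    intro z hz hq
    by_contra hcon
    push Not at hcon
    obtain ⟨f, hf0, hf1⟩ := exists_functional _ _ hcon
    refine solve z hz hq _ (hW2 (Matrix.vecMulVec (B1' *ᵥ fun i => (Y *ᵥ zc z) (Sum.inl i)) f)) ?_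
    generalize (C1 *ᵥ fun k => (Y *ᵥ zc z) (Sum.inr k)) = c1 at *
    generalize (B1' *ᵥ fun i => (Y *ᵥ zc z) (Sum.inl i)) = c2 at *
    rw [Matrix.sub_mulVec, ← Matrix.mulVec_mulVec, ← Matrix.mulVec_mulVec, outer_mul, outer_mul, hf0, hf1,
      zero_smul, Matrix.mulVec_zero, one_smul, zero_sub]
  obtain ⟨d, hd⟩ := noscalar D Q _ hQR (fun j => by
    obtain ⟨z, hz, hq, hz2⟩ := v1 j
    have := key z hz hq
    rwa [hz2] at this) (fun j l => by
    obtain ⟨z, hz, hq, hz2⟩ := v2 j l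
    have := key z hz hq
    rwa [hz2] at this)
  by_cases hAd : A = d • 1
  · have hvv : v = Matrix.fromBlocks (d • 1) v.toBlocks₁₂ 0 (d • 1) := by
      conv_lhs => rw [← Matrix.fromBlocks_toBlocks v, ← hA, ← hD, hAd, hd, h21]
    rw [hvv, dL_scalar] at hdL
    have hD0 : ((M + N : ℕ) : ℝ) ≠ 0 := by exact_mod_cast (by omega)
    have hd0 : d = 0 := by
      rcases mul_eq_zero.1 hdL with e | e
      · exact absurd e hD0
      · exact e
    exact hv ⟨by rw [hAd, hd0, zero_smul], h21, by rw [hd, hd0, zero_smul]⟩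
  · set G := A - d • (1 : Matrix (Fin M) (Fin M) ℝ) with hGdef
    have hG0 : G ≠ 0 := sub_ne_zero.2 hAd
    set P : Matrix (Ix M N) (Fin M) ℝ := Matrix.of fun i k => Yi i (Sum.inl k) with hP
    have hP1 : (Matrix.of fun (i : Fin M) j => Y (Sum.inl i) j) * P = 1 := by
      ext i k
      have := congrFun (congrFun hY1 (Sum.inl i)) (Sum.inl k)
      rw [Matrix.mul_apply] at this ⊢
      rw [Matrix.one_apply] at this ⊢
      simpa [hP] using this
    have hPne : P * (B1 * G) ≠ 0 := by
      intro e
      apply hG0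
      calc G = B1' * ((Matrix.of fun (i : Fin M) j => Y (Sum.inl i) j) * P * (B1 * G)) := by
              rw [hP1, Matrix.one_mul, ← Matrix.mul_assoc, hB', Matrix.one_mul]
        _ = 0 := by rw [Matrix.mul_assoc, e, Matrix.mul_zero, Matrix.mul_zero]
    have : ∃ i, (fun k => (P * (B1 * G)) i k) ≠ 0 := by
      by_contra hcon
      push Not at hcon
      exact hPne (by ext i k; exact congrFun (hcon i) k)
    obtain ⟨i, hi⟩ := this
    obtain ⟨f, -, hf⟩ := exists_functional (0 : Fin M → ℝ) (fun k => (P * (B1 * G)) i k) (by simpa using hi)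
    set x : MatSpace M N := Matrix.vecMulVec f (fun k => ((Matrix.of fun j k => Yi j (Sum.inr k)) * C1') i k) with hx
    have hxW : G * x ∈ W := by
      have := hW2 x
      rw [hd] at this
      rw [hGdef, Matrix.sub_mul, Matrix.smul_mul, Matrix.one_mul]
      rwa [Matrix.mul_smul, Matrix.mul_one] at this
    have gd := hG _ hxW
    obtain ⟨γ', hγ'⟩ := hmah _ gd.1 gd.xx
    refine kill_row hη.le hR.le hη2 γ γ' hY2 hY1 hγ' i (hYp i) ?_
    intro k
    have e1 : P * (B1 * (G * x) * C1) = P * (B1 * G) * x * C1 := by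
      simp only [Matrix.mul_assoc]
    have e2 : (P * (B1 * (G * x) * C1)) i k = ∑ l, Yi i (Sum.inl l) * (B1 * (G * x) * C1) l k := rfl
    rw [← e2, e1]
    have e3 : ∀ l, (P * (B1 * G) * x) i l = ((Matrix.of fun j k => Yi j (Sum.inr k)) * C1') i l := by
      intro l
      rw [Matrix.mul_apply]
      simp only [hx, Matrix.vecMulVec_apply]
      simp only [← mul_assoc]
      rw [← Finset.sum_mul]
      have : ∑ a, (P * (B1 * G)) i a * f a = 1 := by
        rw [← hf, dotProduct]
        exact Finset.sum_congr rfl fun a _ => mul_comm _ _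
      rw [this, one_mul]
    have e4 : (P * (B1 * G) * x * C1) i k = ((Matrix.of fun j k => Yi j (Sum.inr k)) * C1' * C1) i k := by
      rw [Matrix.mul_apply, Matrix.mul_apply]
      exact Finset.sum_congr rfl fun a _ => by rw [e3]
    rw [e4, Matrix.mul_assoc, hC', Matrix.mul_one]
    rfl

theorem no_bad [Finite E] [Nonempty E] (h : S.IsCod pi) (hε : 0 < ε) (y₀ : Big M N) (hdet : |y₀.det| = 1) :
    ¬ ∀ w, XX ε (S.Fi w * y₀) := by
  intro hall
  obtain ⟨Fs, q0, b, y, h0, hFs, hmax⟩ := exists_maximal hε (exists_good hε y₀ hdet hall)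
  obtain ⟨v, qq, hv, hdL, hst⟩ := drift h hε Fs ⟨q0, b, y, hFs⟩ h0 hmax
  let W : Submodule ℝ (MatSpace M N) :=
    { carrier := {x | ∀ r : ℝ, r • rot qq x ∈ stab Fs}
      add_mem' := by
        intro a c ha hc r
        have : rot qq (a + c) = rot qq a + rot qq c := (rotL qq).map_add a c
        rw [this, smul_add]
        exact (stab Fs).add_mem (ha r) (hc r)
      zero_mem' := by
        intro r
        have : rot qq (0 : MatSpace M N) = 0 := (rotL qq).map_zero
        rw [this, smul_zero]
        exact (stab Fs).zero_mem
      smul_mem' := by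
        intro t a ha r
        rw [rot_smul, smul_smul]
        exact ha _ }
  have hD : 0 < sc q0 ^ (M + N) := pow_pos (sc_pos _) _
  refine contra_aux h hε (b := b) (y := y) W v hv hdL (fun c r => hst c r) (lB q0 * lB qq) ((lB qq)ᵀ * (lB q0)ᵀ)
    ((lC qq)ᵀ * (lC q0)ᵀ) (lC q0 * lC qq) ?_ ?_ ?_
  · rw [Matrix.mul_assoc, ← Matrix.mul_assoc (lB qq), lB_mul_tr, Matrix.one_mul, lB_mul_tr]
  · rw [Matrix.mul_assoc, ← Matrix.mul_assoc ((lC q0)ᵀ), lC_tr_mul, Matrix.one_mul, lC_tr_mul]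
  · intro x hx
    have e1 : (sc q0 ^ (M + N))⁻¹ • rot qq x ∈ S.Ph ε q0 b y := by
      have := (mem_stab.1 (hx ((sc q0 ^ (M + N))⁻¹)) 0).2 h0
      rw [zero_add] at this
      rw [hFs]; exact this
    have e2 : S.Good ε b (uu (act q0 ((sc q0 ^ (M + N))⁻¹ • rot qq x)) * y) := e1
    have e3 : act q0 ((sc q0 ^ (M + N))⁻¹ • rot qq x) = lB q0 * lB qq * x * ((lC qq)ᵀ * (lC q0)ᵀ) := by
      rw [act_smul, act_eq, smul_smul, inv_mul_cancel₀ hD.ne', one_smul]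
      simp only [rot, Matrix.mul_assoc]
    rwa [e3] at e2

end Sys

end part15


section part16

section BA
variable {M N : ℕ}

/-- the badly approximable matrices with constant `c` -/
def BAc (M N : ℕ) (c : ℝ) : Set (MatSpace M N) :=
  {α | ∀ q : Fin N → ℤ, q ≠ 0 → ∀ p : Fin M → ℤ,
    c * ‖fun j => (q j : ℝ)‖ ^ (-(N : ℝ) / M) ≤
      ‖α.mulVec (fun j => (q j : ℝ)) - fun i => (p i : ℝ)‖}

lemma dg_inl (q : Qg M N) (x : Ix M N → ℝ) :
    (fun i => (dg q *ᵥ x) (Sum.inl i)) = sc q ^ N • (lB q *ᵥ fun k => x (Sum.inl k)) := by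
  ext i
  simp [dg, Matrix.mulVec, dotProduct, Fintype.sum_sum_type, Finset.mul_sum, mul_assoc]

lemma dg_inr (q : Qg M N) (x : Ix M N → ℝ) :
    (fun i => (dg q *ᵥ x) (Sum.inr i)) = (sc q)⁻¹ ^ M • (lC q *ᵥ fun k => x (Sum.inr k)) := by
  ext i
  simp [dg, Matrix.mulVec, dotProduct, Fintype.sum_sum_type, Finset.mul_sum, mul_assoc]

lemma comp_norm {ι κ : Type*} [Fintype ι] [Fintype κ] (x : ι → ℝ) (f : κ → ι) : ‖fun k => x (f k)‖ ≤ ‖x‖ :=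
  (pi_norm_le_iff_of_nonneg (norm_nonneg _)).2 fun k => norm_le_pi_norm x (f k)

lemma int_norm {ι : Type*} [Fintype ι] (z : ι → ℤ) (hz : z ≠ 0) : 1 ≤ ‖fun i => (z i : ℝ)‖ := by
  obtain ⟨i, hi⟩ := Function.ne_iff.1 hz
  refine le_trans ?_ (norm_le_pi_norm _ i)
  rw [Real.norm_eq_abs]
  have : (1 : ℤ) ≤ |z i| := Int.one_le_abs hi
  exact_mod_cast this

lemma ba_XX (hM : 1 ≤ M) (hN : 1 ≤ N) {c : ℝ} (hc : 0 < c) {α : MatSpace M N} (hα : α ∈ BAc M N c)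
    (t : Qg M N) (ht : sc t ≤ 1) : XX (min c 1 / (M + N)) (dg t⁻¹ * uu (-α)) := by
  intro z hz
  by_contra hlt
  push Not at hlt
  set Z := (dg t⁻¹ * uu (-α)) *ᵥ zc z with hZ
  have hM' : (1 : ℝ) ≤ M := by exact_mod_cast hM
  have hN' : (1 : ℝ) ≤ N := by exact_mod_cast hN
  have hK : (0 : ℝ) < M + N := by linarith
  have hm : 0 < min c 1 := lt_min hc one_pos
  have hKe : (M + N) * ‖Z‖ < min c 1 := by
    rw [lt_div_iff₀ hK] at hlt
    linarith
  have hdZ : dg t *ᵥ Z = uu (-α) *ᵥ zc z := by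
    rw [hZ, Matrix.mulVec_mulVec, ← Matrix.mul_assoc, dg_mul, mul_inv_cancel, dg_one, Matrix.one_mul]
  set q : Fin N → ℤ := fun k => z (Sum.inr k) with hq
  set p : Fin M → ℤ := fun k => z (Sum.inl k) with hp
  have hs := sc_pos t
  have e1 : ‖α *ᵥ (fun j => (q j : ℝ)) - fun i => (p i : ℝ)‖ ≤ sc t ^ N * (M * ‖Z‖) := by
    have h1 := dg_inl t Z
    rw [hdZ] at h1
    have h2 : (α *ᵥ (fun j => (q j : ℝ)) - fun i => (p i : ℝ)) =
        -(fun i => (uu (-α) *ᵥ zc z) (Sum.inl i)) := by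
      ext i
      rw [Pi.neg_apply, uu_mulVec_inl, Matrix.neg_mulVec, Pi.neg_apply, neg_add, neg_neg, Pi.sub_apply]
      have : (zc z (Sum.inl i)) = (p i : ℝ) := rfl
      rw [this, add_comm, sub_eq_add_neg]
      rfl
    rw [h2, norm_neg, h1, norm_smul, Real.norm_of_nonneg (pow_pos hs _).le]
    refine mul_le_mul_of_nonneg_left ?_ (pow_pos hs _).le
    refine (mulVec_norm_le _ _).trans ?_
    rw [Fintype.card_fin]
    have h3 := lB_norm t
    have h4 := comp_norm Z (Sum.inl : Fin M → Ix M N)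
    calc (M : ℝ) * ‖lB t‖ * ‖fun k => Z (Sum.inl k)‖ ≤ M * 1 * ‖Z‖ := by gcongr
      _ = _ := by ring
  have e2 : ‖fun j => (q j : ℝ)‖ ≤ (sc t)⁻¹ ^ M * (N * ‖Z‖) := by
    have h1 := dg_inr t Z
    rw [hdZ] at h1
    have h2 : (fun j => (q j : ℝ)) = (fun i => (uu (-α) *ᵥ zc z) (Sum.inr i)) := by
      ext i
      rw [uu_mulVec_inr]
      rfl
    have hsi := (pow_pos (inv_pos.2 hs) M).le
    rw [h2, h1, norm_smul, Real.norm_of_nonneg hsi]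
    refine mul_le_mul_of_nonneg_left ?_ hsi
    refine (mulVec_norm_le _ _).trans ?_
    rw [Fintype.card_fin]
    have h3 := lC_norm t
    have h4 := comp_norm Z (Sum.inr : Fin N → Ix M N)
    calc (N : ℝ) * ‖lC t‖ * ‖fun k => Z (Sum.inr k)‖ ≤ N * 1 * ‖Z‖ := by gcongr
      _ = _ := by ring
  have hZ0 := norm_nonneg Z
  by_cases hq0 : q = 0
  · have hp0 : p ≠ 0 := by
      intro hp0
      apply hz
      ext i
      rcases i with i | i
      · exact congrFun hp0 i
      · exact congrFun hq0 i
    have h1 := int_norm p hp0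
    have h2 : ‖α *ᵥ (fun j => (q j : ℝ)) - fun i => (p i : ℝ)‖ = ‖fun i => (p i : ℝ)‖ := by
      have : (fun j => (q j : ℝ)) = 0 := by ext j; simp [hq0]
      rw [this, Matrix.mulVec_zero, zero_sub, norm_neg]
    rw [h2] at e1
    have h3 : sc t ^ N ≤ 1 := pow_le_one₀ hs.le ht
    have h4 : sc t ^ N * (M * ‖Z‖) ≤ 1 * (M * ‖Z‖) := by gcongr
    have h5 := min_le_right c 1
    nlinarith
  · have h1 := hα q hq0 p
    have hqn := int_norm q hq0
    set a := ‖α *ᵥ (fun j => (q j : ℝ)) - fun i => (p i : ℝ)‖ with ha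
    set Q := ‖fun j => (q j : ℝ)‖ with hQ
    have hQ0 : 0 < Q := by linarith
    have ha0 : 0 ≤ a := norm_nonneg _
    have h2 : c ^ M ≤ a ^ M * Q ^ N := by
      have h3 : (c * Q ^ (-(N : ℝ) / M)) ^ M ≤ a ^ M := pow_le_pow_left₀ (by positivity) h1 M
      rw [mul_pow, ← Real.rpow_natCast (Q ^ _), ← Real.rpow_mul hQ0.le, div_mul_cancel₀ _ (by positivity),
        Real.rpow_neg hQ0.le, Real.rpow_natCast] at h3
      calc c ^ M = c ^ M * (Q ^ N)⁻¹ * Q ^ N := by field_simp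
        _ ≤ _ := by gcongr
    have h4 : a ^ M * Q ^ N ≤ ((M + N) * ‖Z‖) ^ (M + N) := by
      calc a ^ M * Q ^ N ≤ (sc t ^ N * (M * ‖Z‖)) ^ M * ((sc t)⁻¹ ^ M * (N * ‖Z‖)) ^ N := by gcongr
        _ = (sc t ^ (N * M) * (sc t)⁻¹ ^ (M * N)) * ((M * ‖Z‖) ^ M * (N * ‖Z‖) ^ N) := by
            rw [mul_pow (sc t ^ N), mul_pow ((sc t)⁻¹ ^ M), ← pow_mul, ← pow_mul]; ring
        _ = (M * ‖Z‖) ^ M * (N * ‖Z‖) ^ N := by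
            rw [mul_comm N M, ← mul_pow, mul_inv_cancel₀ hs.ne', one_pow, one_mul]
        _ ≤ ((M + N) * ‖Z‖) ^ M * ((M + N) * ‖Z‖) ^ N := by
            gcongr <;> linarith
        _ = _ := by rw [pow_add]
    have h5 : ((M + N) * ‖Z‖) ^ (M + N) < (min c 1) ^ (M + N) :=
      pow_lt_pow_left₀ hKe (by positivity) (by omega)
    have h6 : (min c 1) ^ (M + N) ≤ (min c 1) ^ M := 
      pow_le_pow_of_le_one hm.le (min_le_right _ _) (by omega)
    have h7 : (min c 1) ^ M ≤ c ^ M := pow_le_pow_left₀ hm.le (min_le_left _ _) _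
    linarith

end BA

namespace Sys
variable {M N : ℕ} {E : Type*} {S : Sys M N E} {ε : ℝ} {pi : (ℕ → E) → MatSpace M N}

lemma uniform [Finite E] [Nonempty E] (h : S.IsCod pi) (hε : 0 < ε) :
    ∃ l : ℕ, ∀ y : Big M N, |y.det| = 1 → ∃ w : List E, w.length ≤ l ∧ ¬ XX ε (S.Fi w * y) := by
  by_contra hcon
  push Not at hcon
  choose y hdet hall using hcon
  obtain ⟨R, hR, hmah⟩ := mahler_bdd (ι := Ix M N) ε hε
  have hx : ∀ l, XX ε (y l) := fun l => by
    have := hall l [] (by simp)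
    rwa [S.Fi_nil, Matrix.one_mul] at this
  choose γ hγ using fun l => hmah (y l) (hdet l) (hx l)
  obtain ⟨y0, -, hy0⟩ := ulim_ball (fun l => y l * zm (γ l).1) R hγ
  refine no_bad h hε y0 (absdet_limit hy0 (Eventually.of_forall fun l => ?_)) fun w => ?_
  · rw [Matrix.det_mul, abs_mul, hdet, abs_det_zm, one_mul]
  · refine XX_limit (mm_lim (tendsto_const_nhds (x := S.Fi w)) hy0) ?_
    have : ∀ᶠ l in UU, w.length ≤ l := UU_le (eventually_ge_atTop w.length)
    filter_upwards [this] with l hl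
    rw [← Matrix.mul_assoc]
    exact XX_gamma (hall l w hl) (γ l)

lemma porous [Finite E] [Nonempty E] (h : S.IsCod pi) {c : ℝ} (hc : 0 < c) :
    ∃ K : ℝ, ∀ b : ℕ → E, ∀ n : ℕ, ∃ (b' : ℕ → E) (δ : ℝ), 0 < δ ∧ δ ≤ S.hi ^ n ∧ ‖pi b - pi b'‖ ≤ K * δ ∧
      ∀ β : MatSpace M N, ‖β - pi b'‖ ≤ δ → β ∉ BAc M N c := by
  obtain ⟨X, hX, -, hpX⟩ := h.bdd
  have hk := kap_pos (M := M) (N := N)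
  have hM' : (1 : ℝ) ≤ M := by exact_mod_cast S.hM
  have hN' : (1 : ℝ) ≤ N := by exact_mod_cast S.hN
  set C2 := kap M N * (1 + kap M N * X) with hC2
  set C3 := ((M + N : ℕ) : ℝ) * (2 + C2) with hC3
  have hC3p : 0 < C3 := by
    have : (0 : ℝ) < (M + N : ℕ) := by push_cast; linarith
    positivity
  set ε0 := min c 1 / (M + N : ℝ) with hε0
  have hε0p : 0 < ε0 := by
    have : 0 < min c 1 := lt_min hc one_pos
    positivity
  obtain ⟨l, hl⟩ := uniform h (ε := ε0 / C3) (by positivity)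
  obtain ⟨b0⟩ : Nonempty (ℕ → E) := inferInstance
  refine ⟨kap M N * (2 * X) / (S.lo ^ l) ^ (M + N), fun b n => ?_⟩
  set w := pf b n with hw
  obtain ⟨w', hw', hxx⟩ := hl (S.Fi w) (S.abs_det_Fi w)
  rw [← S.Fi_append] at hxx
  set v := w ++ w' with hv
  set t := S.tw v with ht
  have hst := sc_pos t
  have hlo := S.lo_pos
  unfold XX at hxx
  push Not at hxx
  obtain ⟨z, hz, hzz⟩ := hxx
  obtain ⟨b1, hb1⟩ := h.mem_word w' b0
  obtain ⟨b', hb'⟩ := h.mem_word w b1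
  have hb'v : pi b' = S.ph v (pi b0) := by
    rw [hv, S.ph_append, hb1, hb']
  have hscw : sc t = sc (S.tw w) * sc (S.tw w') := by rw [ht, hv, S.tw_append, sc_mul]
  have hlo1 : S.lo ≤ 1 := S.lo_le_one
  have hscw' : S.lo ^ l ≤ sc (S.tw w') :=
    (pow_le_pow_of_le_one hlo.le hlo1 hw').trans (lo_pow_le w')
  have hsc1 : sc t ≤ 1 := (S.sc_tw_le v).trans (pow_le_one₀ S.hi_pos.le S.hi_lt.le)
  have hD : 0 < sc t ^ (M + N) := pow_pos hst _
  refine ⟨b', sc t ^ (M + N), hD, ?_, ?_, ?_⟩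
  · refine (S.sc_tw_pow_le v).trans (pow_le_pow_of_le_one S.hi_pos.le S.hi_lt.le ?_)
    rw [hv, List.length_append, hw, pf_length]; omega
  · have e1 : pi b - pi b' = act (S.tw w) (pi (bsh b n) - pi b1) := by
      rw [← hb', h.shift b n, ← hw, act_sub]
      simp only [ph]; abel
    rw [e1]
    refine (act_norm _ _).trans ?_
    have e2 : ‖pi (bsh b n) - pi b1‖ ≤ 2 * X := (norm_sub_le _ _).trans (by linarith [hpX (bsh b n), hpX b1])
    have hsw := sc_pos (S.tw w)
    rw [hscw, mul_pow, div_mul_eq_mul_div, le_div_iff₀ (by positivity)]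
    calc sc (S.tw w) ^ (M + N) * (kap M N * ‖pi (bsh b n) - pi b1‖) * (S.lo ^ l) ^ (M + N)
        ≤ sc (S.tw w) ^ (M + N) * (kap M N * (2 * X)) * (sc (S.tw w')) ^ (M + N) := by gcongr
      _ = _ := by ring
  · intro β hβ hβA
    have g1 := ba_XX S.hM S.hN hc hβA t hsc1 z hz
    set s := act t⁻¹ (-(β - S.xw v)) with hs
    have e1 : dg t⁻¹ * uu (-β) = uu s * S.Fi v := by
      show _ = uu s * (dg t⁻¹ * uu (-S.xw v))
      rw [← Matrix.mul_assoc, hs, ← dg_uu, Matrix.mul_assoc, uu_mul]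
      congr 2; abel
    have e2 : ‖β - S.xw v‖ ≤ sc t ^ (M + N) * (1 + kap M N * X) := by
      have : β - S.xw v = (β - pi b') + act t (pi b0) := by
        rw [hb'v]; simp only [ph]; rw [← ht]; abel
      rw [this]
      refine (norm_add_le _ _).trans ?_
      have h1 := act_norm t (pi b0)
      have h2 : sc t ^ (M + N) * (kap M N * ‖pi b0‖) ≤ sc t ^ (M + N) * (kap M N * X) := by
        have := hpX b0
        gcongr
      linarith
    have e3 : ‖s‖ ≤ C2 := by
      have h1 := act_norm t⁻¹ (-(β - S.xw v))
      rw [norm_neg, sc_inv] at h1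
      refine h1.trans ?_
      calc (sc t)⁻¹ ^ (M + N) * (kap M N * ‖β - S.xw v‖) 
          ≤ (sc t)⁻¹ ^ (M + N) * (kap M N * (sc t ^ (M + N) * (1 + kap M N * X))) := by gcongr
        _ = C2 := by rw [hC2, inv_pow]; field_simp
    have e4 : ‖(dg t⁻¹ * uu (-β)) *ᵥ zc z‖ < ε0 := by
      rw [e1, ← Matrix.mulVec_mulVec]
      have h1 := mulVec_norm_le (uu s) (S.Fi v *ᵥ zc z)
      have h2 : ‖uu s‖ ≤ 2 + C2 := (uu_norm s).trans (by linarith)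
      have hcard : Fintype.card (Ix M N) = M + N := by simp
      rw [hcard] at h1
      calc _ ≤ _ := h1
        _ ≤ C3 * ‖S.Fi v *ᵥ zc z‖ := by
            rw [hC3]; gcongr
        _ < C3 * (ε0 / C3) := by gcongr
        _ = ε0 := by field_simp
    linarith

end Sys

end part16


section part17

section meas
variable {X : Type*} [MetricSpace X] [MeasurableSpace X] [BorelSpace X] [SecondCountableTopology X]

lemma measSupport_closed (ν : Measure X) : IsClosed (measSupport ν) := by
  rw [← isOpen_compl_iff, Metric.isOpen_iff]
  intro x hx
  simp only [measSupport, Set.mem_compl_iff, Set.mem_setOf_eq, not_forall, not_not] at hx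
  obtain ⟨ε, hε, h⟩ := hx
  refine ⟨ε / 2, by positivity, fun y hy hmem => hmem (ε / 2) (by positivity) ?_⟩
  refine measure_mono_null (ball_subset_ball' ?_) h
  rw [mem_ball] at hy
  linarith

lemma measSupport_compl (ν : Measure X) : ν (measSupport ν)ᶜ = 0 := by
  refine measure_null_of_locally_null _ fun x hx => ?_
  simp only [measSupport, Set.mem_compl_iff, Set.mem_setOf_eq, not_forall, not_not] at hx
  obtain ⟨ε, hε, h⟩ := hx
  exact ⟨ball x ε, mem_nhdsWithin_of_mem_nhds (ball_mem_nhds x hε), h⟩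

theorem porous_null (ν : Measure X) [IsLocallyFiniteMeasure ν] (hd : IsDoubling ν) (A : Set X) (C0 : ℝ)
    (ρ : ℕ → ℝ) (hρ : Tendsto ρ atTop (𝓝 0))
    (hA : ∀ x ∈ measSupport ν, ∀ n, ∃ x' ∈ measSupport ν, ∃ δ : ℝ, 0 < δ ∧ δ ≤ ρ n ∧ dist x x' ≤ C0 * δ ∧
      ∀ a ∈ A, ¬ dist a x' ≤ δ) : ν A = 0 := by
  set K := measSupport ν with hK
  have hKm : MeasurableSet K := (measSupport_closed ν).measurableSet
  have hKc : ν Kᶜ = 0 := measSupport_compl ν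
  set μ : Measure K := ν.comap Subtype.val with hμ
  have hemb : MeasurableEmbedding (Subtype.val : K → X) := MeasurableEmbedding.subtype_coe hKm
  have hμa : ∀ s : Set K, μ s = ν (Subtype.val '' s) := fun s => hemb.comap_apply ν s
  have hinter : ∀ T : Set X, ν (T ∩ K) = ν T := fun T => by
    refine le_antisymm (measure_mono Set.inter_subset_left) ?_
    calc ν T ≤ ν ((T ∩ K) ∪ Kᶜ) := measure_mono fun x hx => by
          by_cases h : x ∈ K
          · exact Or.inl ⟨hx, h⟩
          · exact Or.inr h
      _ ≤ ν (T ∩ K) + ν Kᶜ := measure_union_le _ _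
      _ = ν (T ∩ K) := by rw [hKc, add_zero]
  have hcb : ∀ (x : K) (r : ℝ), μ (closedBall x r) = ν (closedBall (x : X) r) := fun x r => by
    have : (Subtype.val '' (closedBall x r)) = closedBall (x : X) r ∩ K := by
      ext z
      simp only [Set.mem_image, mem_closedBall, Set.mem_inter_iff]
      constructor
      · rintro ⟨y, hy, rfl⟩
        exact ⟨hy, y.2⟩
      · rintro ⟨h1, h2⟩
        exact ⟨⟨z, h2⟩, h1, rfl⟩
    rw [hμa, this, hinter]
  haveI hlf : IsLocallyFiniteMeasure μ := by
    refine ⟨fun x => ?_⟩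
    obtain ⟨s, hs, hfin⟩ := ν.finiteAt_nhds (x : X)
    refine ⟨Subtype.val ⁻¹' s, continuous_subtype_val.continuousAt.preimage_mem_nhds hs, ?_⟩
    rw [hμa]
    exact lt_of_le_of_lt (measure_mono (Set.image_preimage_subset _ _)) hfin
  haveI hud : IsUnifLocDoublingMeasure μ := by
    obtain ⟨C, hC1, hC⟩ := hd
    refine ⟨⟨C * C, ?_⟩⟩
    have : Set.Ioc (0 : ℝ) (1 / 2) ∈ 𝓝[>] (0 : ℝ) := Ioc_mem_nhdsGT (by norm_num)
    filter_upwards [this] with r hr x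
    rw [hcb, hcb]
    have e1 := hC x x.2 (2 * r) (by linarith [hr.1]) (by linarith [hr.2])
    have e2 := hC x x.2 r hr.1 (by linarith [hr.2])
    calc ν (closedBall (x : X) (2 * r)) ≤ ν (ball (x : X) (2 * (2 * r))) :=
          measure_mono (closedBall_subset_ball (by linarith [hr.1]))
      _ ≤ C * ν (ball (x : X) (2 * r)) := e1
      _ ≤ C * (C * ν (ball (x : X) r)) := by gcongr
      _ ≤ C * (C * ν (closedBall (x : X) r)) := by gcongr; exact ball_subset_closedBall
      _ = _ := by rw [← mul_assoc, ENNReal.coe_mul]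
  have hdens := IsUnifLocDoublingMeasure.ae_tendsto_measure_inter_div μ (Subtype.val ⁻¹' A) C0
  have hfalse : ∀ᵐ x ∂(μ.restrict (Subtype.val ⁻¹' A)), False := by
    filter_upwards [hdens] with x hx
    choose w hw δ hδ0 hδ1 hδ2 hδ3 using hA x x.2
    have hlim : Tendsto δ atTop (𝓝[>] 0) := by
      refine tendsto_nhdsWithin_iff.2 ⟨?_, Eventually.of_forall hδ0⟩
      exact squeeze_zero (fun n => (hδ0 n).le) hδ1 hρ
    have h1 := hx (ι := ℕ) (l := atTop) (fun n => ⟨w n, hw n⟩) δ hlim (Eventually.of_forall fun n => hδ2 n)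
    have h2 : ∀ n, (Subtype.val ⁻¹' A) ∩ closedBall (⟨w n, hw n⟩ : K) (δ n) = ∅ := by
      intro n
      rw [Set.eq_empty_iff_forall_notMem]
      rintro a ⟨ha, hb⟩
      exact hδ3 n a ha hb
    simp only [h2, measure_empty, ENNReal.zero_div] at h1
    exact zero_ne_one (tendsto_nhds_unique tendsto_const_nhds h1)
  have h0 : μ (Subtype.val ⁻¹' A) = 0 := by
    rw [← Measure.restrict_eq_zero]
    simpa using hfalse
  rw [hμa, Subtype.image_preimage_coe, Set.inter_comm, hinter] at h0
  exact h0

end meas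

end part17

/-- **Theorem.** Let `K` be the limit set of an irreducible finite algebraic similarity IFS
on the space of `M × N` real matrices satisfying the open set condition.  If `ν` is a
doubling locally finite Borel measure with `supp ν = K`, then `ν(BA) = 0`. -/
theorem doubling_measure_badlyApproximableMat_eq_zero
    (M N : ℕ) (hM : 1 ≤ M) (hN : 1 ≤ N)
    {E : Type*} [Fintype E] [Nonempty E]
    (φ : E → MatSpace M N → MatSpace M N) (r : E → ℝ)
    (hsim : ∀ e, IsAlgebraicSimilarity (r e) (φ e))
    (hcontr : ∀ e, r e < 1)
    (hirr : IrreducibleMatIFS φ)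
    (hosc : OpenSetConditionMat φ)
    (π : (ℕ → E) → MatSpace M N)
    (hπ : ∀ (b : ℕ → E) (α₀ : MatSpace M N),
      Tendsto (fun n => seqApply φ b n α₀) atTop (𝓝 (π b)))
    (K : Set (MatSpace M N)) (hK : K = Set.range π)
    (ν : Measure (MatSpace M N)) [IsLocallyFiniteMeasure ν]
    (hdbl : IsDoubling ν)
    (hsupp : measSupport ν = K) :
    ν (badlyApproximableMat M N) = 0 := by
  choose hr B hB C hC δ hφ using hsim
  have hMN : (0 : ℝ) < ((M + N : ℕ) : ℝ) := by exact_mod_cast (by omega : 0 < M + N)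
  have hσ0 : ∀ e, 0 < r e ^ (((M + N : ℕ) : ℝ)⁻¹) := fun e => Real.rpow_pos_of_pos (hr e) _
  have hσ1 : ∀ e, r e ^ (((M + N : ℕ) : ℝ)⁻¹) < 1 := fun e =>
    Real.rpow_lt_one (hr e).le (hcontr e) (inv_pos.2 hMN)
  have hσp : ∀ e, (r e ^ (((M + N : ℕ) : ℝ)⁻¹)) ^ (M + N) = r e := fun e =>
    Real.rpow_inv_natCast_pow (hr e).le (by omega)
  obtain ⟨e0, he0⟩ := Finite.exists_min fun e => r e ^ (((M + N : ℕ) : ℝ)⁻¹)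
  obtain ⟨e1, he1⟩ := Finite.exists_max fun e => r e ^ (((M + N : ℕ) : ℝ)⁻¹)
  have hCt : ∀ e, (C e)ᵀ ∈ Matrix.orthogonalGroup (Fin N) ℝ := fun e => by
    have := Unitary.star_mem (hC e)
    rwa [Matrix.star_eq_conjTranspose, Matrix.conjTranspose_eq_transpose_of_trivial] at this
  let S : Sys M N E :=
    { t := fun e => (⟨r e ^ (((M + N : ℕ) : ℝ)⁻¹), hσ0 e⟩, ⟨B e, hB e⟩, ⟨(C e)ᵀ, hCt e⟩)
      δ := δ
      hM := hM
      hN := hN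
      lo := r e0 ^ (((M + N : ℕ) : ℝ)⁻¹)
      hi := r e1 ^ (((M + N : ℕ) : ℝ)⁻¹)
      lo_pos := hσ0 e0
      hi_pos := hσ0 e1
      hi_lt := hσ1 e1
      lo_le := he0
      le_hi := he1 }
  have hph1 : ∀ e x, S.ph [e] x = φ e x := by
    intro e x
    have hx : S.xw [e] = δ e := by
      show act (S.t e) (S.xw []) + S.δ e = δ e
      have : S.xw [] = 0 := rfl
      rw [this, act_zero, zero_add]
    rw [Sys.ph, S.tw_single, hx, hφ]
    congr 1
    show (r e ^ (((M + N : ℕ) : ℝ)⁻¹)) ^ (M + N) • (B e * x * ((C e)ᵀ)ᵀ) = _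
    rw [hσp, Matrix.transpose_transpose]
  have hph : ∀ b n x, S.ph (pf b n) x = seqApply φ b n x := by
    intro b n
    induction n with
    | zero =>
      intro x
      show act (S.tw []) x + S.xw [] = x
      have h1 : S.xw [] = 0 := rfl
      have h2 : S.tw [] = 1 := rfl
      rw [h1, h2, act_one, add_zero]
    | succ n ih =>
      intro x
      show S.ph (pf b n ++ [b n]) x = seqApply φ b n (φ (b n) x)
      rw [S.ph_append, hph1, ih]
  have hcod : S.IsCod π := by
    refine ⟨fun c x => ?_, fun L hL hLe => ?_⟩
    · simp only [hph]
      exact hπ c x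
    · by_contra hne
      refine hirr ⟨L, hL, hne, fun e => ?_⟩
      have := hLe e
      rwa [show S.ph [e] = φ e from funext (hph1 e)] at this
  have hk : ∀ k : ℕ, ν (BAc M N (1 / ((k : ℝ) + 1))) = 0 := by
    intro k
    obtain ⟨C0, hC0⟩ := S.porous hcod (c := 1 / ((k : ℝ) + 1)) (by positivity)
    have hbor : @BorelSpace (MatSpace M N)
        (@UniformSpace.toTopologicalSpace _ (@PseudoMetricSpace.toUniformSpace _
          (@MetricSpace.toPseudoMetricSpace _ inferInstance))) _ := ⟨rfl⟩
    have hsec : SecondCountableTopology (MatSpace M N) :=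
      (inferInstance : SecondCountableTopology (Fin M → Fin N → ℝ))
    have hlf : IsLocallyFiniteMeasure ν := inferInstance
    refine @porous_null (MatSpace M N) _ _ hbor hsec ν hlf hdbl _ C0
      (fun n => S.hi ^ n) S.hi_pow_tendsto ?_
    intro x hx n
    rw [hsupp, hK] at hx
    obtain ⟨b, rfl⟩ := hx
    obtain ⟨b', d, hd0, hd1, hd2, hd3⟩ := hC0 b n
    refine ⟨π b', ?_, d, hd0, hd1, ?_, ?_⟩
    · rw [hsupp, hK]
      exact ⟨b', rfl⟩
    · rw [dist_eq_norm]
      exact hd2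
    · intro a ha hda
      rw [dist_eq_norm] at hda
      exact hd3 a hda ha
  refine measure_mono_null ?_ (measure_iUnion_null hk)
  rintro α ⟨c, hc, hα⟩
  obtain ⟨k, hk⟩ := exists_nat_one_div_lt hc
  refine Set.mem_iUnion.2 ⟨k, fun q hq p => le_trans ?_ (hα q hq p)⟩
  exact mul_le_mul_of_nonneg_right hk.le (Real.rpow_nonneg (norm_nonneg _) _)
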